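/- (Main embedding theorem over a common base field.) Let F be a field, and for i = 1, 2 let K_i/F be a finite separable field extension of degree e_i and let D_i be a division ring with center K_i of degree d_i (dim_{K_i} D_i = d_i²), regarded as an F-algebra via F ⊆ K_i ⊆ D_i. Set m_i = d_i e_i and let N be any positive multiple of lcm(m₁², m₂²). Then there exist a field extension F'/F that is finitely generated as a field extension and in which F is algebraically closed (every element of F' algebraic over F lies in F), and a division ring E' with center F' of degree N (dim_{F'} E' = N²), together with injective F-algebra homomorphisms D₁ → E' and D₂ → E' compatible with the inclusion F ⊆ F'. -/

import Mathlib

/-- A witness for the main embedding theorem: a field extension `F'` of `F` together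
with a division ring `E'` which is an `F'`-algebra, with compatible `F`-algebra
structure (so that embeddings of `F`-algebras into `E'` are compatible with the
inclusion `F ⊆ F'`). -/
structure RegularEmbeddingWitness (F : Type) [Field F] : Type 1 where
  F' : Type
  [fieldF' : Field F']
  [algebraF' : Algebra F F']
  E' : Type
  [divisionRingE' : DivisionRing E']
  [algebraE' : Algebra F' E']
  [algebraFE' : Algebra F E']
  [tower : IsScalarTower F F' E']

attribute [instance] RegularEmbeddingWitness.fieldF'
attribute [instance] RegularEmbeddingWitness.algebraF'
attribute [instance] RegularEmbeddingWitness.divisionRingE'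
attribute [instance] RegularEmbeddingWitness.algebraE'
attribute [instance] RegularEmbeddingWitness.algebraFE'
attribute [instance] RegularEmbeddingWitness.tower

section Descent
open Module

theorem desc_basis {𝓛 V Γ : Type*} [Field 𝓛] [AddCommGroup V] [Module 𝓛 V] 
    (σ : Γ → 𝓛 →+* 𝓛) (ρ : Γ → V →+ V) (hρ : ∀ γ c v, ρ γ (c • v) = σ γ c • ρ γ v)
    {k : Type*} [Field k] [Algebra k 𝓛] [Module k V] [IsScalarTower k 𝓛 V]
    (hk : ∀ c, (∀ γ, σ γ c = c) → c ∈ (algebraMap k 𝓛).range)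
    (Fix : Submodule k V) (hF : ∀ v, v ∈ Fix ↔ ∀ γ, ρ γ v = v)
    {ι : Type*} [Fintype ι] (b : Basis ι 𝓛 V) (hb : ∀ i, b i ∈ Fix) (v : V) (hv : v ∈ Fix) (i : ι) :
    b.repr v i ∈ (algebraMap k 𝓛).range := by
  apply hk
  intro γ
  have h1 : ρ γ v = v := (hF v).1 hv γ
  have h2 : v = ∑ i, b.repr v i • b i := (b.sum_repr v).symm
  have h3 : ρ γ v = ∑ i, σ γ (b.repr v i) • b i := by
    conv_lhs => rw [h2]
    rw [map_sum]
    refine Finset.sum_congr rfl fun i _ => ?_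
    rw [hρ, (hF _).1 (hb i)]
  have h4 := congrArg (fun w => b.repr w i) (h1.symm.trans h3)
  simp only [Basis.repr_sum_self] at h4
  exact h4.symm

theorem desc_exists_basis {𝓛 V Γ : Type*} [Field 𝓛] [AddCommGroup V] [Module 𝓛 V] [FiniteDimensional 𝓛 V]
    (σ : Γ → 𝓛 →+* 𝓛) (ρ : Γ → V →+ V) (hρ : ∀ γ c v, ρ γ (c • v) = σ γ c • ρ γ v)
    {k : Type*} [Field k] [Algebra k 𝓛] [Module k V] [IsScalarTower k 𝓛 V]
    (hk : ∀ c, (∀ γ, σ γ c = c) → c ∈ (algebraMap k 𝓛).range)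
    (Fix : Submodule k V) (hF : ∀ v, v ∈ Fix ↔ ∀ γ, ρ γ v = v)
    (hs : ⊤ ≤ Submodule.span 𝓛 (Fix : Set V)) :
    ∃ B : Basis (Fin (finrank 𝓛 V)) k Fix, LinearIndependent 𝓛 (fun i => (B i : V)) := by
  classical
  let b0 := Basis.ofSpan hs
  haveI : Fintype _ := FiniteDimensional.fintypeBasisIndex b0
  have hb0 : ∀ i, b0 i ∈ Fix := fun i => Basis.ofSpan_subset hs ⟨i, rfl⟩
  let e : _ ≃ Fin (finrank 𝓛 V) := Fintype.equivFinOfCardEq (finrank_eq_card_basis b0).symm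
  let b := b0.reindex e
  have hb : ∀ i, b i ∈ Fix := fun i => by simp [b, hb0]
  have hli : LinearIndependent k (fun i => (⟨b i, hb i⟩ : Fix)) := by
    have h1 : LinearIndependent k (fun i => b i) := 
      b.linearIndependent.restrict_scalars (R := k) (by
        intro x y hxy; simpa [Algebra.smul_def] using hxy)
    exact LinearIndependent.of_comp Fix.subtype h1
  have hsp : ⊤ ≤ Submodule.span k (Set.range (fun i => (⟨b i, hb i⟩ : Fix))) := by
    rintro ⟨v, hv⟩ -
    have h2 : v = ∑ i, b.repr v i • b i := (b.sum_repr v).symm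
    choose c hc using fun i => desc_basis σ ρ hρ hk Fix hF b hb v hv i
    have h3 : (⟨v, hv⟩ : Fix) = ∑ i, c i • (⟨b i, hb i⟩ : Fix) := by
      apply Subtype.ext
      simp only [Submodule.coe_sum, Submodule.coe_smul]
      conv_lhs => rw [h2]
      refine Finset.sum_congr rfl fun i _ => ?_
      rw [← hc, algebraMap_smul]
    rw [h3]
    exact Submodule.sum_mem _ fun i _ => Submodule.smul_mem _ _ (Submodule.subset_span ⟨i, rfl⟩)
  refine ⟨Basis.mk hli hsp, ?_⟩
  simpa using b.linearIndependent

/-- Galois descent : honest semilinear action of a subgroup. -/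
theorem galois_span {F L V : Type*} [Field F] [Field L] [Algebra F L] [FiniteDimensional F L]
    [AddCommGroup V] [Module L V]
    (H : Subgroup (L ≃ₐ[F] L)) (ρ : H → V →+ V) (hρ : ∀ g c v, ρ g (c • v) = g.1 c • ρ g v)
    (h1 : ∀ v, ρ 1 v = v) (hm : ∀ g h v, ρ g (ρ h v) = ρ (g * h) v) :
    ⊤ ≤ Submodule.span L {v | ∀ g, ρ g v = v} := by
  classical
  haveI : Fintype H := Fintype.ofFinite H
  intro v _
  by_contra hv
  obtain ⟨f, hf, hker⟩ := Submodule.exists_le_ker_of_notMem hv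
  have hli : LinearIndependent L (fun g : H => ((g.1 : L →* L) : L → L)) :=
    (linearIndependent_monoidHom L L).comp (fun g : H => (g.1 : L →* L)) (by
      intro a b hab
      apply Subtype.ext
      ext x
      exact DFunLike.congr_fun hab x)
  have h0 : ∑ g : H, f (ρ g v) • ((g.1 : L →* L) : L → L) = 0 := by
    funext c
    have hmem : (∑ g : H, ρ g (c • v)) ∈ Submodule.span L {v | ∀ g, ρ g v = v} := by
      apply Submodule.subset_span
      intro g
      rw [map_sum]
      simp only [hm]
      exact Fintype.sum_equiv (Equiv.mulLeft g) _ _ (fun x => rfl)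
    have := hker hmem
    simp only [LinearMap.mem_ker, map_sum, hρ, map_smul, smul_eq_mul] at this
    simpa [mul_comm] using this
  have := (Fintype.linearIndependent_iff.1 hli) _ h0 1
  rw [h1] at this
  exact hf this

end Descent

section Twisted
open Module

variable {F L : Type} [Field F] [Field L] [Algebra F L]

/-- Twisted semilinear representations with cocycle `z ^ t` of dimension `r`. -/
def Tw (H : Subgroup (L ≃ₐ[F] L)) (z : H → H → Lˣ) (t : ℤ) (r : ℕ) : Prop :=
  ∃ τ : H → Matrix (Fin r) (Fin r) L, τ 1 = 1 ∧
    ∀ g h, τ g * (τ h).map g.1 = ((z g h ^ t : Lˣ) : L) • τ (g * h)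

variable {H : Subgroup (L ≃ₐ[F] L)} {z : H → H → Lˣ}

theorem Tw.of_matrix {ι : Type} [Fintype ι] [DecidableEq ι] {t : ℤ} (τ : H → Matrix ι ι L)
    (h1 : τ 1 = 1) (h2 : ∀ g h, τ g * (τ h).map g.1 = ((z g h ^ t : Lˣ) : L) • τ (g * h)) :
    Tw H z t (Fintype.card ι) := by
  let e := Fintype.equivFin ι
  refine ⟨fun g => Matrix.reindex e e (τ g), ?_, ?_⟩
  · simp [h1]
  · intro g h
    have := congrArg (Matrix.reindex e e) (h2 g h)
    simp only [Matrix.reindex_apply] at this ⊢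
    rw [Matrix.submatrix_mul_equiv _ _ _ e.symm _ |>.symm] at this
    exact this

theorem Tw.of_module {M : Type} [AddCommGroup M] [Module L M] [FiniteDimensional L M] {t : ℤ}
    (ρ : H → M →+ M) (hρ : ∀ g c v, ρ g (c • v) = g.1 c • ρ g v)
    (h1 : ∀ v, ρ 1 v = v)
    (hm : ∀ g h v, ρ g (ρ h v) = ((z g h ^ t : Lˣ) : L) • ρ (g * h) v) :
    Tw H z t (finrank L M) := by
  classical
  let b := finBasis L M
  refine ⟨fun g => Matrix.of fun i j => b.repr (ρ g (b j)) i, ?_, ?_⟩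
  · ext i j
    simp [h1, Matrix.one_apply, Finsupp.single_apply, eq_comm]
  · intro g h
    ext i j
    have h3 := congrArg (fun v => b.repr v i) (hm g h (b j))
    have h2 : ρ h (b j) = ∑ l, b.repr (ρ h (b j)) l • b l := (b.sum_repr _).symm
    have h4 : ρ g (ρ h (b j)) = ∑ l, g.1 (b.repr (ρ h (b j)) l) • ρ g (b l) := by
      conv_lhs => rw [h2]
      simp only [map_sum, hρ]
    rw [h4] at h3
    simp only [map_sum, map_smul, Finsupp.coe_finsetSum, Finset.sum_apply, Finsupp.smul_apply,
      smul_eq_mul] at h3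
    simp only [Matrix.mul_apply, Matrix.map_apply, Matrix.of_apply, Matrix.smul_apply, smul_eq_mul]
    rw [← h3]
    exact Finset.sum_congr rfl fun l _ => mul_comm _ _

theorem Tw.kron {t t' : ℤ} {r r' : ℕ} (h : Tw H z t r) (h' : Tw H z t' r') :
    Tw H z (t + t') (r * r') := by
  obtain ⟨τ, h1, h2⟩ := h
  obtain ⟨τ', h1', h2'⟩ := h'
  have := Tw.of_matrix (z := z) (t := t + t') (fun g => Matrix.kronecker (τ g) (τ' g)) 
    (by simp [h1, h1']) (by
      intro g h
      have : (Matrix.kronecker (τ h) (τ' h)).map g.1 = 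
          Matrix.kronecker ((τ h).map g.1) ((τ' h).map g.1) := by
        ext i j; simp [Matrix.kronecker]
      rw [this]
      have h5 := Matrix.mul_kronecker_mul (τ g) ((τ h).map g.1) (τ' g) ((τ' h).map g.1) 
      unfold Matrix.kronecker at *
      rw [← h5, h2, h2', Matrix.smul_kronecker, Matrix.kronecker_smul, smul_smul, zpow_add]
      simp)
  simpa using this

theorem Tw.zero : Tw H z 0 1 := ⟨fun _ => 1, rfl, fun g h => by simp⟩

theorem Tw.pow {t : ℤ} {r : ℕ} (h : Tw H z t r) (n : ℕ) : Tw H z (n * t) (r ^ n) := by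
  induction n with
  | zero => simpa using Tw.zero
  | succ n ih =>
    have := ih.kron h
    rw [pow_succ]
    convert this using 1
    push_cast; ring

/-- semilinear ring endomorphism of a polynomial ring given by a matrix. -/
noncomputable def semiHom {ι : Type} [Fintype ι] (g : L →+* L) (A : Matrix ι ι L) :
    MvPolynomial ι L →+* MvPolynomial ι L :=
  MvPolynomial.eval₂Hom (MvPolynomial.C.comp g)
    (fun j => ∑ i, MvPolynomial.C (A i j) * MvPolynomial.X i)

theorem semiHom_smul {ι : Type} [Fintype ι] (g : L →+* L) (A : Matrix ι ι L) (c : L)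
    (f : MvPolynomial ι L) : semiHom g A (c • f) = g c • semiHom g A f := by
  simp [semiHom, MvPolynomial.smul_eq_C_mul]

theorem semiHom_homog {ι : Type} [Fintype ι] (g : L →+* L) (A : Matrix ι ι L) (n : ℕ)
    (f : MvPolynomial ι L) (hf : f.IsHomogeneous n) : (semiHom g A f).IsHomogeneous n := by
  have := hf.eval₂ (MvPolynomial.C.comp g : L →+* MvPolynomial ι L)
    (fun j => ∑ i, MvPolynomial.C (A i j) * MvPolynomial.X i) (n := 1) ?_ ?_
  · simpa [semiHom] using this
  · intro r
    exact MvPolynomial.isHomogeneous_C _ _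
  · intro i
    refine MvPolynomial.IsHomogeneous.sum _ _ _ fun j _ => ?_
    simpa using (MvPolynomial.isHomogeneous_C ι (A j i)).mul (MvPolynomial.isHomogeneous_X L j)

theorem finrank_homog (r n : ℕ) :
    finrank L (MvPolynomial.homogeneousSubmodule (Fin r) L n) = Nat.multichoose r n := by
  rw [MvPolynomial.homogeneousSubmodule_eq_finsupp_supported]
  have e := AddMonoidAlgebra.supportedEquivFinsupp (S := L) (R := L) {d : Fin r →₀ ℕ | d.degree = n}
  have hc : Nat.multichoose r n = ((Finset.univ : Finset (Fin r)).finsuppAntidiag n).card := by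
    rw [Finset.card_finsuppAntidiag_nat_eq_multichoose, Finset.card_univ, Fintype.card_fin]
  rw [hc]
  have h : {d : Fin r →₀ ℕ | d.degree = n} = 
      ((Finset.univ : Finset (Fin r)).finsuppAntidiag n : Set (Fin r →₀ ℕ)) := by
    ext d
    simp [Finset.mem_finsuppAntidiag, Finsupp.degree_eq_sum]
  rw [h] at e ⊢
  rw [LinearEquiv.finrank_eq e]
  simp

instance (r n : ℕ) : FiniteDimensional L (MvPolynomial.homogeneousSubmodule (Fin r) L n) := by
  rw [MvPolynomial.homogeneousSubmodule_eq_finsupp_supported]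
  have e := AddMonoidAlgebra.supportedEquivFinsupp (S := L) (R := L) {d : Fin r →₀ ℕ | d.degree = n}
  have h : {d : Fin r →₀ ℕ | d.degree = n} = 
      ((Finset.univ : Finset (Fin r)).finsuppAntidiag n : Set (Fin r →₀ ℕ)) := by
    ext d
    simp [Finset.mem_finsuppAntidiag, Finsupp.degree_eq_sum]
  rw [h] at e ⊢
  exact Module.Finite.equiv e.symm

theorem semiHom_comp {ι : Type} [Fintype ι] (g h : L →+* L) (A B : Matrix ι ι L) :
    (semiHom g A).comp (semiHom h B) = semiHom (g.comp h) (A * B.map g) := by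
  apply MvPolynomial.ringHom_ext
  · intro c; simp [semiHom]
  · intro j
    simp only [semiHom, RingHom.comp_apply, MvPolynomial.eval₂Hom_X', map_sum, map_mul,
      MvPolynomial.eval₂Hom_C, Matrix.mul_apply, Matrix.map_apply, Finset.mul_sum, Finset.sum_mul]
    rw [Finset.sum_comm]
    refine Finset.sum_congr rfl fun i _ => Finset.sum_congr rfl fun l _ => ?_
    ring

theorem semiHom_scale {ι : Type} [Fintype ι] (g : L →+* L) (A : Matrix ι ι L) (c : L) (n : ℕ)
    (f : MvPolynomial ι L) (hf : f.IsHomogeneous n) :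
    semiHom g (c • A) f = c ^ n • semiHom g A f := by
  have key : ∀ m : ι →₀ ℕ, ∀ a : L, semiHom g (c • A) (MvPolynomial.monomial m a)
      = c ^ m.degree • semiHom g A (MvPolynomial.monomial m a) := by
    intro m a
    simp only [semiHom, MvPolynomial.eval₂Hom_monomial, Matrix.smul_apply, smul_eq_mul, map_mul,
      MvPolynomial.smul_eq_C_mul]
    have : ∀ j, (∑ i, MvPolynomial.C c * MvPolynomial.C (A i j) * MvPolynomial.X i : MvPolynomial ι L)
       = MvPolynomial.C c * (∑ i, MvPolynomial.C (A i j) * MvPolynomial.X i) := by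
      intro j; rw [Finset.mul_sum]; simp only [mul_assoc]
    simp only [this, mul_pow, Finsupp.prod, Finset.prod_mul_distrib, Finset.prod_pow_eq_pow_sum,
      Finsupp.degree_apply]
    simp only [map_pow]
    ring
  conv_lhs => rw [f.as_sum]
  conv_rhs => rw [f.as_sum]
  rw [map_sum, map_sum, Finset.smul_sum]
  refine Finset.sum_congr rfl fun m hm => ?_
  rw [key]
  rw [MvPolynomial.mem_support_iff] at hm
  have := hf hm
  have h2 : m.degree = n := by rw [Finsupp.degree_eq_weight_one]; exact this
  rw [h2]

theorem Tw.sym {t : ℤ} {r : ℕ} (h : Tw H z t r) (n : ℕ) : Tw H z (n * t) (Nat.multichoose r n) := by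
  obtain ⟨τ, h1, h2⟩ := h
  rw [← finrank_homog (L := L)]
  let ρ : H → (MvPolynomial.homogeneousSubmodule (Fin r) L n) →+
      (MvPolynomial.homogeneousSubmodule (Fin r) L n) := fun g =>
    { toFun := fun f => ⟨semiHom (g.1 : L →+* L) (τ g) f.1, semiHom_homog _ _ _ _ f.2⟩
      map_zero' := by ext1; simp
      map_add' := by intro a b; ext1; simp }
  refine Tw.of_module ρ ?_ ?_ ?_
  · intro g c v
    apply Subtype.ext
    exact semiHom_smul _ _ _ _
  · intro v
    apply Subtype.ext
    have : semiHom ((1 : H).1 : L →+* L) (τ 1) = RingHom.id _ := by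
      apply MvPolynomial.ringHom_ext
      · intro c; simp [semiHom]
      · intro j; simp [semiHom, h1, Matrix.one_apply]
    change semiHom ((1 : H).1 : L →+* L) (τ 1) v.1 = v.1
    rw [this]; rfl
  · intro g h v
    apply Subtype.ext
    change ((semiHom (g.1 : L →+* L) (τ g)).comp (semiHom (h.1 : L →+* L) (τ h))) v.1 = 
      _ • semiHom _ (τ (g * h)) v.1
    rw [semiHom_comp]
    have h3 := h2 g h
    have : (τ g * (τ h).map (g.1 : L →+* L)) = ((z g h ^ t : Lˣ) : L) • τ (g * h) := h3
    rw [this, semiHom_scale _ _ _ n _ v.2]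
    congr 1
    rw [← Units.val_pow_eq_pow_val, ← zpow_natCast, ← zpow_mul, mul_comm]

theorem Tw.det {t : ℤ} {r : ℕ} (h : Tw H z t r) (n : ℤ) : Tw H z (n * (r * t)) 1 := by
  obtain ⟨τ, h1, h2⟩ := h
  refine ⟨fun g => ((τ g).det ^ n) • 1, by simp [h1], ?_⟩
  intro g h
  have := congrArg Matrix.det (h2 g h)
  rw [Matrix.det_mul, Matrix.det_smul] at this
  have h3 : ((τ h).map g.1).det = g.1 ((τ h).det) := by
    have := RingHom.map_det (g.1 : L →+* L) (τ h)
    exact this.symm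
  rw [h3] at this
  ext i j
  have hi : i = j := Subsingleton.elim _ _
  subst hi
  have hi : i = 0 := Subsingleton.elim _ _
  subst hi
  simp only [Fintype.card_fin] at this
  simp only [Matrix.mul_apply, Matrix.map_apply, Matrix.smul_apply, Matrix.one_apply_eq, smul_eq_mul,
    mul_one, Finset.univ_unique, Finset.sum_singleton, Fin.default_eq_zero, map_zpow₀, Units.val_zpow_eq_zpow_val] at this ⊢
  rw [← mul_zpow, this, mul_zpow]
  congr 1
  rw [← zpow_natCast, ← zpow_mul, ← zpow_mul]
  congr 1
  ring

end Twisted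

section NT

theorem nt_val_add {p r i : ℕ} [hp : Fact p.Prime] (hr : r ≠ 0) (hi : 0 < i)
    (hi2 : i < p ^ padicValNat p r) : padicValNat p (r + i) = padicValNat p i := by
  have hd : p ^ padicValNat p r ∣ r := pow_padicValNat_dvd
  apply le_antisymm
  · have h1 : padicValNat p (r + i) < padicValNat p r := by
      by_contra h
      push Not at h
      have h2 : p ^ padicValNat p r ∣ r + i := (padicValNat_dvd_iff_le (by omega)).2 h
      have h3 := (Nat.dvd_add_right hd).1 h2
      exact absurd (Nat.le_of_dvd hi h3) (by omega)
    rw [← padicValNat_dvd_iff_le (by omega)]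
    exact (Nat.dvd_add_right ((pow_dvd_pow p h1.le).trans hd)).1 pow_padicValNat_dvd
  · have h1 : padicValNat p i < padicValNat p r := by
      by_contra h
      push Not at h
      have h2 : p ^ padicValNat p r ∣ i := (padicValNat_dvd_iff_le (by omega)).2 h
      exact absurd (Nat.le_of_dvd hi h2) (by omega)
    rw [← padicValNat_dvd_iff_le (by omega)]
    exact (Nat.dvd_add_right ((pow_dvd_pow p h1.le).trans hd)).2 pow_padicValNat_dvd

theorem nt_choose {p r : ℕ} [hp : Fact p.Prime] (hr : r ≠ 0) (m : ℕ)
    (hm : m < p ^ padicValNat p r) : padicValNat p ((r + m).choose m) = 0 := by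
  induction m with
  | zero => simp
  | succ m ih =>
    have h1 := ih (by omega)
    have h2 : (r + m + 1) * (r + m).choose m = (r + m + 1).choose (m + 1) * (m + 1) :=
      Nat.add_one_mul_choose_eq (r + m) m
    have h3 : (r + m).choose m ≠ 0 := (Nat.choose_pos (by omega)).ne'
    have h4 : (r + m + 1).choose (m + 1) ≠ 0 := (Nat.choose_pos (by omega)).ne'
    have h5 := congrArg (padicValNat p) h2
    rw [padicValNat.mul (by omega) h3, padicValNat.mul h4 (by omega)] at h5
    have h6 := nt_val_add (p := p) hr (Nat.succ_pos m) hm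
    rw [Nat.succ_eq_add_one, ← add_assoc] at h6
    rw [← add_assoc]
    omega

theorem nt_multichoose {p r : ℕ} [hp : Fact p.Prime] (hr : r ≠ 0) (j : ℕ) (hj : 0 < j)
    (hm : j ≤ p ^ padicValNat p r) :
    Nat.multichoose r j ≠ 0 ∧ padicValNat p (Nat.multichoose r j) + padicValNat p j = padicValNat p r := by
  obtain ⟨m, rfl⟩ : ∃ m, j = m + 1 := ⟨j - 1, by omega⟩
  obtain ⟨s, rfl⟩ : ∃ m, r = m + 1 := ⟨r - 1, by omega⟩
  rw [Nat.multichoose_eq]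
  have e : s + 1 + (m + 1) - 1 = s + m + 1 := by omega
  rw [e]
  have h4 : (s + m + 1).choose (m + 1) ≠ 0 := (Nat.choose_pos (by omega)).ne'
  refine ⟨h4, ?_⟩
  have h2 : (s + m + 1) * (s + m).choose m = (s + m + 1).choose (m + 1) * (m + 1) :=
      Nat.add_one_mul_choose_eq (s + m) m
  have h3 : (s + m + 1) * (s + m).choose m = (s + m + 1).choose m * (s + 1) := by
    have := Nat.add_one_mul_choose_eq (s + m) s
    rw [Nat.choose_symm_add (a := s) (b := m)] at this
    rw [this]
    congr 1
    rw [show s + m + 1 = (s + 1) + m by omega, Nat.choose_symm_add]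
  have h5 := congrArg (padicValNat p) (h2.symm.trans h3)
  have h6 : (s + m + 1).choose m ≠ 0 := (Nat.choose_pos (by omega)).ne'
  rw [padicValNat.mul h4 (by omega), padicValNat.mul h6 (by omega)] at h5
  have h7 := nt_choose (p := p) hr m (by omega)
  rw [show s + 1 + m = s + m + 1 by omega] at h7
  omega

end NT

section Index
open Module
variable {F L : Type} [Field F] [Field L] [Algebra F L]
variable {H : Subgroup (L ≃ₐ[F] L)} {z : H → H → Lˣ}

theorem Tw.mul_nat {t : ℤ} {r : ℕ} (h : Tw H z t r) (hr : r ≠ 0) (p : ℕ) [hp : Fact p.Prime] (j : ℕ) :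
    ∃ R, R ≠ 0 ∧ Tw H z (j * t) R ∧ padicValNat p R ≤ padicValNat p r := by
  set q := p ^ padicValNat p r with hq
  have hqpos : 0 < q := pow_pos hp.out.pos _
  have hA := nt_multichoose (p := p) hr q hqpos le_rfl
  rw [hq, padicValNat.prime_pow, ← hq] at hA
  have hmod : Nat.multichoose r (j % q) ≠ 0 ∧ padicValNat p (Nat.multichoose r (j % q)) ≤ padicValNat p r := by
    rcases Nat.eq_zero_or_pos (j % q) with h0 | h0
    · rw [h0]; simp
    · have := nt_multichoose (p := p) hr (j % q) h0 (Nat.mod_lt _ hqpos).le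
      exact ⟨this.1, by omega⟩
  refine ⟨Nat.multichoose r (j % q) * Nat.multichoose r q ^ (j / q), ?_, ?_, ?_⟩
  · exact mul_ne_zero hmod.1 (pow_ne_zero _ hA.1)
  · have := (h.sym (j % q)).kron ((h.sym q).pow (j / q))
    convert this using 1
    have h3 : (j : ℤ) = (j % q : ℕ) + q * (j / q : ℕ) := by exact_mod_cast (Nat.mod_add_div j q).symm
    conv_lhs => rw [h3]
    ring
  · rw [padicValNat.mul hmod.1 (pow_ne_zero _ hA.1), padicValNat.pow]
    have : padicValNat p (Nat.multichoose r q) = 0 := by omega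
    rw [this]; omega

theorem Tw.neg_one {u : ℤ} {r d : ℕ} (h : Tw H z u r) (hr : r ≠ 0) (hd : Tw H z 1 d) (hd0 : d ≠ 0)
    (p : ℕ) [hp : Fact p.Prime] (hu : ¬ (p : ℤ) ∣ u) :
    ∃ R, R ≠ 0 ∧ Tw H z (-1) R ∧ padicValNat p R ≤ padicValNat p r := by
  set q := p ^ padicValNat p d with hq
  have hqpos : 0 < q := pow_pos hp.out.pos _
  have hA := nt_multichoose (p := p) hd0 q hqpos le_rfl
  rw [hq, padicValNat.prime_pow, ← hq] at hA
  have hco : IsCoprime u (q : ℤ) := by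
    rw [hq]; push_cast
    apply IsCoprime.pow_right
    rw [isCoprime_comm]
    exact (Nat.prime_iff_prime_int.1 hp.out).coprime_iff_not_dvd.2 hu
  obtain ⟨x, y, hxy⟩ := hco
  have hdz : (d : ℤ) ≠ 0 := by exact_mod_cast hd0
  obtain ⟨j, hj⟩ : ∃ j : ℕ, (j : ℤ) = (-x) % d := ⟨((-x) % d).toNat, Int.toNat_of_nonneg (Int.emod_nonneg _ hdz)⟩
  obtain ⟨i, hi⟩ : ∃ j : ℕ, (j : ℤ) = (-y) % d := ⟨((-y) % d).toNat, Int.toNat_of_nonneg (Int.emod_nonneg _ hdz)⟩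
  obtain ⟨R, hR0, hR, hRv⟩ := h.mul_nat hr p j
  refine ⟨R * Nat.multichoose d q ^ i, mul_ne_zero hR0 (pow_ne_zero _ hA.1), ?_, ?_⟩
  · have h1 := (hR.kron ((hd.sym q).pow i)).kron (hd.det ( u * ((-x) / d) + q * ((-y) / d)))
    simp only [mul_one] at h1
    convert h1 using 1
    rw [hj, hi]
    have e1 := Int.emod_add_mul_ediv (-x) d
    have e2 := Int.emod_add_mul_ediv (-y) d
    linear_combination hxy - u * e1 - q * e2
  · rw [padicValNat.mul hR0 (pow_ne_zero _ hA.1), padicValNat.pow]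
    have : padicValNat p (Nat.multichoose d q) = 0 := by omega
    rw [this]; omega

theorem tw_fix_dvd [FiniteDimensional F L] [IsGalois F L] {D : Type} [DivisionRing D] [Algebra F D]
    [FiniteDimensional F D] {d R : ℕ} (θ : H → Matrix (Fin d) (Fin d) L) (hθ1 : θ 1 = 1)
    (hθ : ∀ g h, θ g * (θ h).map g.1 = (z g h : L) • θ (g * h))
    (φ : D →ₐ[F] Matrix (Fin d) (Fin d) L) (hφ : ∀ g y, θ g * (φ y).map g.1 = φ y * θ g)
    (hR : Tw H z (-1) R) :
    finrank F D ∣ R * d * H.index := by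
  classical
  obtain ⟨τ, hτ1, hτ⟩ := hR
  have mapmul : ∀ (g : H) {a b c : ℕ} (A : Matrix (Fin a) (Fin b) L) (B : Matrix (Fin b) (Fin c) L),
      (A * B).map g.1 = A.map g.1 * B.map g.1 := by
    intro g a b c A B
    exact Matrix.map_mul (f := (g.1 : L →+* L))
  let ρ : H → (Matrix (Fin d) (Fin R) L) →+ (Matrix (Fin d) (Fin R) L) := fun g =>
    { toFun := fun v => θ g * v.map g.1 * (τ g).transpose
      map_zero' := by simp
      map_add' := by
        intro a b
        rw [Matrix.map_add _ (fun x y => map_add g.1 x y), Matrix.mul_add, Matrix.add_mul] }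
  have hρdef : ∀ g v, ρ g v = θ g * v.map g.1 * (τ g).transpose := fun _ _ => rfl
  have hρ : ∀ g (c : L) (v : (Matrix (Fin d) (Fin R) L)), ρ g (c • v) = g.1 c • ρ g v := by
    intro g c v
    have : (c • v).map g.1 = g.1 c • v.map g.1 := by ext i j; simp
    rw [hρdef, hρdef, this, Matrix.mul_smul, Matrix.smul_mul]
  have h1 : ∀ v, ρ 1 v = v := by
    intro v
    rw [hρdef, hθ1, hτ1]
    have : v.map (1 : H).1 = v := by ext i j; simp
    rw [this]; simp
  have hm : ∀ g h v, ρ g (ρ h v) = ρ (g * h) v := by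
    intro g h v
    simp only [hρdef]
    rw [mapmul, mapmul]
    have e1 : (v.map h.1).map g.1 = v.map (g * h).1 := by ext i j; simp
    have e2 : ((τ h).transpose.map g.1) * (τ g).transpose = ((z g h ^ (-1 : ℤ) : Lˣ) : L) • (τ (g * h)).transpose := by
      rw [← Matrix.transpose_smul, ← hτ g h, Matrix.transpose_mul, Matrix.transpose_map]
    rw [e1]
    calc θ g * ((θ h).map g.1 * v.map (g * h).1 * ((τ h).transpose.map g.1)) * (τ g).transpose
        = (θ g * (θ h).map g.1) * v.map (g * h).1 * (((τ h).transpose.map g.1) * (τ g).transpose) := by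
          simp only [Matrix.mul_assoc]
      _ = _ := by
          rw [e2, hθ, Matrix.smul_mul, Matrix.smul_mul, Matrix.mul_smul, smul_smul]
          simp
  let k := IntermediateField.fixedField H
  let Fix : Submodule k (Matrix (Fin d) (Fin R) L) :=
    { carrier := {v | ∀ g, ρ g v = v}
      add_mem' := by
        intro a b ha hb g
        rw [map_add, ha g, hb g]
      zero_mem' := by intro g; exact map_zero _
      smul_mem' := by
        intro c v hv g
        have : c • v = (c : L) • v := rfl
        rw [this, hρ, hv g, show g.1 (c : L) = c from c.2 g] }
  have hk : ∀ c : L, (∀ g : H, (g.1 : L →+* L) c = c) → c ∈ (algebraMap k L).range := by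
    intro c hc
    exact ⟨⟨c, fun g => hc g⟩, rfl⟩
  have hspan : ⊤ ≤ Submodule.span L (Fix : Set (Matrix (Fin d) (Fin R) L)) := galois_span H ρ hρ h1 hm
  obtain ⟨B, -⟩ := desc_exists_basis (fun g : H => (g.1 : L →+* L)) ρ hρ hk Fix (fun v => Iff.rfl) hspan
  have hfr : finrank k Fix = d * R := by
    rw [finrank_eq_card_basis B, Fintype.card_fin, Module.finrank_matrix]
    simp
  have hfinFix : Module.Finite k Fix := Module.Finite.of_basis B
  have hfF : finrank F Fix = H.index * (d * R) := by
    rw [← Module.finrank_mul_finrank F k Fix, hfr]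
    congr 1
    have e1 := IntermediateField.finrank_fixedField_eq_card H
    have e2 : finrank F k * finrank k L = finrank F L := Module.finrank_mul_finrank F k L
    have e3 := IsGalois.card_aut_eq_finrank F L
    have e4 := H.index_mul_card
    change finrank k L = _ at e1
    rw [e1, ← e3, ← e4] at e2
    exact Nat.eq_of_mul_eq_mul_right Nat.card_pos e2
  have hmem : ∀ (y : D) (v : Fix), φ y * v.1 ∈ Fix := by
    intro y v g
    have hv : ρ g v.1 = v.1 := v.2 g
    rw [hρdef, mapmul, ← Matrix.mul_assoc, hφ, Matrix.mul_assoc, Matrix.mul_assoc, ← Matrix.mul_assoc (θ g), ← hρdef, hv]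
  letI : Module D Fix :=
    { smul := fun y v => ⟨φ y * v.1, hmem y v⟩
      one_smul := by intro v; apply Subtype.ext; change φ 1 * v.1 = v.1; rw [map_one, Matrix.one_mul]
      mul_smul := by
        intro a b v; apply Subtype.ext; change φ (a * b) * v.1 = φ a * (φ b * v.1)
        rw [map_mul, Matrix.mul_assoc]
      smul_zero := by intro a; apply Subtype.ext; exact Matrix.mul_zero _
      smul_add := by
        intro a v w; apply Subtype.ext; change φ a * (v.1 + w.1) = φ a * v.1 + φ a * w.1
        rw [Matrix.mul_add]
      add_smul := by
        intro a b v; apply Subtype.ext; change φ (a + b) * v.1 = φ a * v.1 + φ b * v.1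
        rw [map_add, Matrix.add_mul]
      zero_smul := by intro v; apply Subtype.ext; change φ 0 * v.1 = 0; rw [map_zero, Matrix.zero_mul] }
  haveI : IsScalarTower F D Fix := by
    constructor
    intro c y v
    apply Subtype.ext
    change φ (c • y) * v.1 = c • (φ y * v.1)
    rw [map_smul, Matrix.smul_mul]
  have := Module.finrank_mul_finrank F D Fix
  rw [hfF] at this
  exact ⟨_, by rw [this]; ring⟩

end Index

section Weights
open Module

variable {L M X T : Type*} [Field L] [AddCommGroup M] [Module L M] [Monoid T]

/-- joint weight space -/
def wtsp (f : T → M →ₗ[L] M) (χ : T → L) : Submodule L M where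
  carrier := {m | ∀ t, f t m = χ t • m}
  add_mem' := by intro a b ha hb t; rw [map_add, ha t, hb t, smul_add]
  zero_mem' := by intro t; simp
  smul_mem' := by intro c m hm t; rw [map_smul, hm t, smul_comm]

theorem mem_wtsp {f : T → M →ₗ[L] M} {χ : T → L} {m : M} : m ∈ wtsp f χ ↔ ∀ t, f t m = χ t • m := Iff.rfl

theorem wt_component (f : T → M →ₗ[L] M) (χ : X → T →* L) (hχ : Function.Injective χ)
    (W : Submodule L M) (hW : ∀ t, ∀ w ∈ W, f t w ∈ W) {s : Finset X} (m : X → M)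
    (hm : ∀ x ∈ s, m x ∈ wtsp f (χ x)) (hs : ∑ x ∈ s, m x ∈ W) : ∀ x ∈ s, m x ∈ W := by
  intro x hx
  by_contra hv
  obtain ⟨g, hg, hker⟩ := Submodule.exists_le_ker_of_notMem hv
  have hli : LinearIndependent L (fun x : X => ((χ x : T →* L) : T → L)) :=
    (linearIndependent_monoidHom T L).comp χ hχ
  apply hg
  refine linearIndependent_iff'.1 hli s (fun x => g (m x)) ?_ x hx
  funext t
  have h1 := hker (hW t _ hs)
  rw [LinearMap.mem_ker, map_sum, map_sum] at h1
  simp only [Finset.sum_apply, Pi.smul_apply, smul_eq_mul, Pi.zero_apply]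
  rw [← h1]
  refine Finset.sum_congr rfl fun y hy => ?_
  rw [mem_wtsp.1 (hm y hy) t, map_smul, smul_eq_mul, mul_comm]

theorem weight_sum [DecidableEq X] [FiniteDimensional L M] (f : T → M →ₗ[L] M) (χ : X → T →* L)
    (hχ : Function.Injective χ)
    {ι : Type*} [Fintype ι] (b : Basis ι L M) (wt : ι → X) (hb : ∀ i, b i ∈ wtsp f (χ (wt i)))
    (W : Submodule L M) (hW : ∀ t, ∀ w ∈ W, f t w ∈ W) :
    ∃ X0 : Finset X, (∀ x, x ∉ X0 → finrank L (W ⊓ wtsp f (χ x) : Submodule L M) = 0) ∧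
      finrank L W = ∑ x ∈ X0, finrank L (W ⊓ wtsp f (χ x) : Submodule L M) := by
  classical
  let X0 := Finset.univ.image wt
  have hdec : ∀ v : M, ∃ m : X → M, (∀ x, m x ∈ wtsp f (χ x)) ∧ v = ∑ x ∈ X0, m x := by
    intro v
    refine ⟨fun x => ∑ i with wt i = x, b.repr v i • b i, ?_, ?_⟩
    · intro x
      refine Submodule.sum_mem _ fun i hi => Submodule.smul_mem _ _ ?_
      have : wt i = x := by simpa using hi
      rw [← this]; exact hb i
    · rw [Finset.sum_fiberwise_of_maps_to (fun i _ => Finset.mem_image_of_mem _ (Finset.mem_univ i))]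
      exact (b.sum_repr v).symm
  refine ⟨X0, ?_, ?_⟩
  · intro x hx
    have : (W ⊓ wtsp f (χ x) : Submodule L M) = ⊥ := by
      rw [eq_bot_iff]
      rintro v ⟨hv, hvx⟩
      obtain ⟨m, hm, hvm⟩ := hdec v
      let m' : X → M := fun y => if y = x then v else - m y
      have hm' : ∀ y ∈ insert x X0, m' y ∈ wtsp f (χ y) := by
        intro y _
        by_cases hy : y = x
        · simp only [m', hy, if_true]; exact hvx
        · simp only [m', hy, if_false]; exact Submodule.neg_mem _ (hm y)
      have hsum : ∑ y ∈ insert x X0, m' y ∈ (⊥ : Submodule L M) := by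
        rw [Submodule.mem_bot, Finset.sum_insert hx]
        have : ∑ y ∈ X0, m' y = - ∑ y ∈ X0, m y := by
          rw [← Finset.sum_neg_distrib]
          refine Finset.sum_congr rfl fun y hy => ?_
          have : y ≠ x := fun h => hx (h ▸ hy)
          simp [m', this]
        rw [this, ← hvm]; simp [m']
      have := wt_component f χ hχ ⊥ (by intro t w hw; simp_all) m' hm' hsum x (Finset.mem_insert_self _ _)
      simpa [m'] using this
    rw [this]; simp
  · let Φ : (∀ x : X0, (W ⊓ wtsp f (χ x.1) : Submodule L M)) →ₗ[L] W :=
      { toFun := fun m => ∑ x, ⟨(m x).1, (m x).2.1⟩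
        map_add' := by
          intro a b
          rw [← Finset.sum_add_distrib]; rfl
        map_smul' := by
          intro c a
          rw [Finset.smul_sum]; rfl }
    have hΦ : ∀ m, ((Φ m : W) : M) = ∑ x, (m x).1 := by
      intro m
      simp [Φ]
    have hbij : Function.Bijective Φ := by
      constructor
      · rw [injective_iff_map_eq_zero]
        intro m hm
        have h1 : ∑ x : X0, (m x).1 = 0 := by rw [← hΦ, hm]; rfl
        have h2 := wt_component f (fun x : X0 => χ x.1) (fun a b hab => Subtype.ext (hχ hab)) ⊥
          (by intro t w hw; simp_all) (s := Finset.univ) (fun x => (m x).1) (fun x _ => (m x).2.2)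
          (by rw [h1]; exact Submodule.zero_mem _)
        funext x
        apply Subtype.ext
        simpa using h2 x (Finset.mem_univ _)
      · intro v
        obtain ⟨m, hm, hvm⟩ := hdec v.1
        have h2 := wt_component f χ hχ W hW m (s := X0) (fun x _ => hm x) (by rw [← hvm]; exact v.2)
        refine ⟨fun x => ⟨m x.1, h2 x.1 x.2, hm x.1⟩, ?_⟩
        apply Subtype.ext
        rw [hΦ, hvm]
        exact Finset.sum_coe_sort X0 m
    rw [← LinearEquiv.finrank_eq (LinearEquiv.ofBijective Φ hbij), Module.finrank_pi_fintype]
    exact Finset.sum_coe_sort X0 (fun x => finrank L (W ⊓ wtsp f (χ x) : Submodule L M))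

theorem orbit_dvd {A X : Type*} [Group A] [MulAction A X] [Finite A] [DecidableEq X] (X0 : Finset X)
    (f : X → ℕ) (h0 : ∀ x, x ∉ X0 → f x = 0) (hinv : ∀ (a : A) x, f (a • x) = f x) (q : ℕ)
    (hq : ∀ x, f x ≠ 0 → q ∣ Nat.card (MulAction.orbit A x) * f x) : q ∣ ∑ x ∈ X0, f x := by
  classical
  let S : Finset X := X0.filter (fun x => f x ≠ 0)
  have hS : ∀ x, x ∈ S ↔ f x ≠ 0 := by
    intro x
    simp only [S, Finset.mem_filter, and_iff_right_iff_imp]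
    intro hx; by_contra h; exact hx (h0 x h)
  have hsum : ∑ x ∈ X0, f x = ∑ x ∈ S, f x := by
    rw [Finset.sum_filter_ne_zero]
  rw [hsum]
  let π : X → Quotient (MulAction.orbitRel A X) := Quotient.mk _
  rw [← Finset.sum_fiberwise_of_maps_to (t := S.image π) (g := π) 
    (fun x hx => Finset.mem_image_of_mem _ hx)]
  refine Finset.dvd_sum fun c hc => ?_
  obtain ⟨x, hx, rfl⟩ := Finset.mem_image.1 hc
  have hfx := (hS x).1 hx
  have h1 : ∀ y ∈ S.filter (fun y => π y = π x), f y = f x := by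
    intro y hy
    have : π y = π x := (Finset.mem_filter.1 hy).2
    obtain ⟨a, ha⟩ : y ∈ MulAction.orbit A x := Quotient.exact this
    rw [← ha]; exact hinv a x
  rw [Finset.sum_congr rfl h1, Finset.sum_const, smul_eq_mul]
  have h2 : ((S.filter (fun y => π y = π x) : Finset X) : Set X) = MulAction.orbit A x := by
    ext y
    simp only [Finset.coe_filter, Set.mem_setOf_eq, hS]
    constructor
    · rintro ⟨_, h⟩
      exact Quotient.exact h
    · rintro ⟨a, rfl⟩
      refine ⟨by simpa [hinv] using hfx, Quotient.sound ⟨a, rfl⟩⟩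
  have h3 : (S.filter (fun y => π y = π x)).card = Nat.card (MulAction.orbit A x) := by
    rw [← h2]; simp
  rw [h3]
  exact hq x hfx

end Weights

section SD
open Module

/-- Splitting data for a division algebra `D` over `F` in a Galois extension `L`. -/
structure SplitData (F L D I : Type) (d : ℕ) [Field F] [Field L] [Algebra F L] [DivisionRing D]
    [Algebra F D] [Fintype I] [MulAction (L ≃ₐ[F] L) I] where
  φ : I → D →ₐ[F] Matrix (Fin d) (Fin d) L
  θ : (L ≃ₐ[F] L) → I → Matrix (Fin d) (Fin d) L
  z : (L ≃ₐ[F] L) → (L ≃ₐ[F] L) → I → Lˣ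
  θ_unit : ∀ g i, IsUnit (θ g i)
  θ_one : ∀ i, θ 1 i = 1
  θ_φ : ∀ g i y, θ g i * (φ i y).map g = φ (g • i) y * θ g i
  θ_mul : ∀ g h i, θ g (h • i) * (θ h i).map g = (z g h i : L) • θ (g * h) i
  dpos : 0 < d
  dim : finrank F D = d ^ 2 * Fintype.card I

variable {F L D I : Type} {d : ℕ} [Field F] [Field L] [Algebra F L] [DivisionRing D]
    [Algebra F D] [Fintype I] [MulAction (L ≃ₐ[F] L) I] {S : SplitData F L D I d}

theorem SplitData.nonempty (S : SplitData F L D I d) : Nonempty (Fin d) := ⟨⟨0, S.dpos⟩⟩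

theorem SplitData.z_aux (S : SplitData F L D I d) {A : Matrix (Fin d) (Fin d) L} (hA : IsUnit A) (c : Lˣ) (h : A = (c : L) • A) :
    c = 1 := by
  have := S.nonempty
  have h1 : ((c : L) - 1) • A = 0 := by rw [sub_smul, one_smul, ← h, sub_self]
  rcases smul_eq_zero.1 h1 with h2 | h2
  · ext; rw [sub_eq_zero] at h2; exact h2
  · exact absurd h2 hA.ne_zero

theorem SplitData.z_one_left (S : SplitData F L D I d) (h : L ≃ₐ[F] L) (i : I) : S.z 1 h i = 1 := by
  apply S.z_aux (S.θ_unit h i)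
  have := S.θ_mul 1 h i
  rw [S.θ_one, one_mul, one_mul] at this
  rw [← this]
  ext; simp

theorem SplitData.z_one_right (S : SplitData F L D I d) (g : L ≃ₐ[F] L) (i : I) : S.z g 1 i = 1 := by
  apply S.z_aux (S.θ_unit g i)
  have := S.θ_mul g 1 i
  rw [S.θ_one, one_smul, mul_one] at this
  rw [← this]
  have : (1 : Matrix (Fin d) (Fin d) L).map g = 1 := by
    rw [Matrix.map_one] <;> simp
  rw [this, mul_one]

/-- twisted action -/
structure TwAct (S : SplitData F L D I d) (κ M : Type) [Fintype κ] [DecidableEq κ]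
    [AddCommGroup M] [Module L M] where
  ρ : (L ≃ₐ[F] L) → (I → Matrix κ κ L) → M →+ M
  smul : ∀ g P (c : L) m, ρ g P (c • m) = g c • ρ g P m
  one : ∀ m, ρ 1 1 m = m
  mul : ∀ g h P P' m, (∀ i, IsUnit (P i)) → (∀ i, IsUnit (P' i)) → 
    ρ g P (ρ h P' m) = ρ (g * h) (fun i => (S.z g h i : L) • (P (h • i) * (P' i).map g)) m

variable {κ M : Type} [Fintype κ] [DecidableEq κ] [AddCommGroup M] [Module L M]

/-- Torus operators -/
def TwAct.tor (A : TwAct S κ M) (t : I → κ → Lˣ) : M →ₗ[L] M where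
  toFun := A.ρ 1 (fun i => Matrix.diagonal fun j => (t i j : L))
  map_add' := map_add _
  map_smul' := by intro c m; rw [A.smul]; simp

theorem diag_unit (t : κ → Lˣ) : IsUnit (Matrix.diagonal fun j => (t j : L)) := by
  apply IsUnit.of_mul_eq_one (b := Matrix.diagonal fun j => ((t j)⁻¹ : Lˣ).1)
  rw [Matrix.diagonal_mul_diagonal]
  simp

theorem TwAct.tor_comm (A : TwAct S κ M) (g : L ≃ₐ[F] L) (P : I → Matrix κ κ L) (hP : ∀ i, IsUnit (P i))
    (t t' : I → κ → Lˣ)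
    (h : ∀ i, (Matrix.diagonal fun j => (t (g • i) j : L)) * P i 
      = P i * (Matrix.diagonal fun j => g (t' i j : L))) (m : M) :
    A.tor t (A.ρ g P m) = A.ρ g P (A.tor t' m) := by
  change A.ρ 1 _ (A.ρ g P m) = A.ρ g P (A.ρ 1 _ m)
  rw [A.mul _ _ _ _ _ (fun i => diag_unit _) hP, A.mul _ _ _ _ _ hP (fun i => diag_unit _)]
  rw [one_mul, mul_one]
  congr 2
  funext i
  rw [S.z_one_left, S.z_one_right, Units.val_one, one_smul, one_smul, one_smul]
  have h1 : (P i).map (1 : L ≃ₐ[F] L) = P i := by ext; simp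
  rw [h1, h i, Matrix.diagonal_map (map_zero g)]

theorem unit_map (g : L ≃ₐ[F] L) {P : Matrix κ κ L} (h : IsUnit P) : IsUnit (P.map g) := 
  h.map ((g : L →+* L).mapMatrix (m := κ))

theorem TwAct.inj (A : TwAct S κ M) (g : L ≃ₐ[F] L) (P : I → Matrix κ κ L) (hP : ∀ i, IsUnit (P i))
    (m : M) (hm : A.ρ g P m = 0) : m = 0 := by
  let Q : I → Matrix κ κ L := fun i => (S.z g⁻¹ g i : L) • (P i).map (g⁻¹ : L ≃ₐ[F] L)
  have hQ : ∀ i, IsUnit (Q i) := fun i => by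
    have := (unit_map g⁻¹ (hP i))
    exact (this.smul (S.z g⁻¹ g i))
  choose u hu using hQ
  have h1 := A.mul g⁻¹ g (fun i => (((u (g⁻¹ • i))⁻¹ : (Matrix κ κ L)ˣ) : Matrix κ κ L)) P m (fun i => Units.isUnit _) hP
  rw [hm, map_zero, inv_mul_cancel] at h1
  have h2 : (fun i => (S.z g⁻¹ g i : L) • ((((u (g⁻¹ • g • i))⁻¹ : (Matrix κ κ L)ˣ) : Matrix κ κ L)
      * (P i).map (g⁻¹ : L ≃ₐ[F] L))) = 1 := by
    funext i
    rw [inv_smul_smul, ← Matrix.mul_smul]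
    change _ * Q i = 1
    rw [← hu]; simp
  rw [h2, A.one] at h1
  exact h1.symm

theorem TwAct.finrank_le [FiniteDimensional L M] (A : TwAct S κ M) (g : L ≃ₐ[F] L) (P : I → Matrix κ κ L) (hP : ∀ i, IsUnit (P i))
    (U V : Submodule L M) (hUV : ∀ u ∈ U, A.ρ g P u ∈ V) : finrank L U ≤ finrank L V := by
  let b := finBasis L U
  let j : U →+ V := 
    { toFun := fun u => ⟨A.ρ g P u.1, hUV u.1 u.2⟩
      map_zero' := by apply Subtype.ext; simp
      map_add' := by intro a b; apply Subtype.ext; simp }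
  have h1 : LinearIndependent L (fun x => j (b x)) := 
    b.linearIndependent.map_of_injective_injective (g.symm : L → L) j (by simp) (by
      intro m hm
      apply Subtype.ext
      exact A.inj g P hP _ (congrArg Subtype.val hm)) (by
      intro r m
      apply Subtype.ext
      change A.ρ g P (g.symm r • m.1) = r • A.ρ g P m.1
      rw [A.smul]; simp)
  simpa using h1.fintype_card_le_finrank

/-- characters of a torus -/
def tchar (X : Type) [Fintype X] (L : Type) [Field L] (w : X → ℤ) : (X → Lˣ) →* L where
  toFun t := ((∏ x, t x ^ w x : Lˣ) : L)
  map_one' := by simp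
  map_mul' := by intro a b; simp [mul_zpow, Finset.prod_mul_distrib]

theorem exists_zpow_ne [Infinite L] (m : ℤ) (hm : m ≠ 0) : ∃ t : Lˣ, t ^ m ≠ 1 := by
  by_contra hcon
  push Not at hcon
  have h2 : ∀ t : Lˣ, t ^ m.natAbs = 1 := by
    intro t
    rcases Int.natAbs_eq m with h | h
    · have := hcon t; rw [h] at this; simpa using this
    · have := hcon t; rw [h] at this; simpa using this
  have hpos : 0 < m.natAbs := Int.natAbs_pos.2 hm
  have h3 := Polynomial.X_pow_sub_C_ne_zero hpos (1 : L)
  have h4 : (Set.univ : Set L) ⊆ insert 0 ((Polynomial.X ^ m.natAbs - Polynomial.C (1:L)).rootSet L) := by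
    intro x _
    by_cases hx : x = 0
    · left; exact hx
    · right
      rw [Polynomial.mem_rootSet]
      refine ⟨h3, ?_⟩
      have := congrArg Units.val (h2 (Units.mk0 x hx))
      simp at this
      simp [this]
  exact Set.infinite_univ ((Set.Finite.insert 0 (Polynomial.rootSet_finite _ L)).subset h4)

theorem tchar_inj [Infinite L] (X : Type) [Fintype X] : Function.Injective (tchar X L) := by
  classical
  intro w w' h
  funext x
  by_contra hx
  obtain ⟨t, ht⟩ := exists_zpow_ne (L := L) (w x - w' x) (sub_ne_zero.2 hx)
  have h1 := DFunLike.congr_fun h (Pi.mulSingle x t)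
  have key : ∀ v : X → ℤ, tchar X L v (Pi.mulSingle x t) = ((t ^ v x : Lˣ) : L) := by
    intro v
    change ((∏ y, (Pi.mulSingle x t : X → Lˣ) y ^ v y : Lˣ) : L) = _
    rw [Finset.prod_eq_single x]
    · simp
    · intro y _ hy; simp [hy]
    · simp
  rw [key, key, Units.val_inj] at h1
  apply ht
  rw [zpow_sub, h1, mul_inv_cancel]

end SD

section Fixed
open Module

theorem fixed_of_sum {A X : Type*} [Group A] [Finite A] [Fintype X] [MulAction A X] (p : ℕ)
    [hp : Fact p.Prime] (hA : IsPGroup p A) (w : X → ℤ) (hw : ∀ (a : A) x, w (a • x) = w x)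
    (hs : ¬ (p : ℤ) ∣ ∑ x, w x) : ∃ x, (∀ a : A, a • x = x) ∧ ¬ (p : ℤ) ∣ w x := by
  classical
  by_contra hcon
  push Not at hcon
  apply hs
  have hp0 : (p : ℤ) ≠ 0 := by exact_mod_cast hp.out.ne_zero
  have h1 := orbit_dvd (A := A) (Finset.univ : Finset X) (fun x => (w x % p).toNat) (by simp)
    (fun a x => by simp [hw]) p (by
      intro x hx
      by_cases hfix : ∀ a : A, a • x = x
      · exfalso; apply hx
        have := Int.emod_eq_zero_of_dvd (hcon x hfix)
        simp [this]
      · apply Dvd.dvd.mul_right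
        obtain ⟨n, hn⟩ := hA.card_orbit x
        rw [hn]
        apply dvd_pow_self
        rintro rfl
        rw [pow_zero, Nat.card_eq_one_iff_unique] at hn
        apply hfix
        intro a
        have := hn.1
        exact congrArg Subtype.val (Subsingleton.elim (⟨a • x, MulAction.mem_orbit x a⟩ : MulAction.orbit A x) 
          ⟨x, MulAction.mem_orbit_self x⟩))
  have h2 : (p : ℤ) ∣ ∑ x, (w x % p) := by
    have h3 := Int.natCast_dvd_natCast.2 h1
    rw [Nat.cast_sum] at h3
    convert h3 using 2 with x
    rw [Int.toNat_of_nonneg (Int.emod_nonneg _ hp0)]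
  rw [Int.dvd_iff_emod_eq_zero] at h2 ⊢
  rw [Finset.sum_int_mod, h2]

theorem free_action (κ : Type) [Fintype κ] (p : ℕ) [hp : Fact p.Prime] :
    ∃ (C : Type) (_ : Group C) (_ : Finite C) (_ : MulAction C κ),
      Nat.card C = p ^ padicValNat p (Fintype.card κ) ∧ ∀ (c : C) (x : κ), c • x = x → c = 1 := by
  let a := padicValNat p (Fintype.card κ)
  have : NeZero (p ^ a) := ⟨pow_ne_zero _ hp.out.ne_zero⟩
  obtain ⟨m, hm⟩ : p ^ a ∣ Fintype.card κ := pow_padicValNat_dvd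
  have e : κ ≃ Multiplicative (ZMod (p ^ a)) × Fin m := Fintype.equivOfCardEq (by
    rw [Fintype.card_prod, Fintype.card_fin, Fintype.card_multiplicative, ZMod.card, hm])
  refine ⟨Multiplicative (ZMod (p ^ a)), inferInstance, inferInstance,
    { smul := fun c x => e.symm (c * (e x).1, (e x).2)
      one_smul := ?_
      mul_smul := ?_ }, ?_, ?_⟩
  · intro c c' x
    change e.symm (_, _) = e.symm (_ * (e (e.symm (_, _))).1, (e (e.symm (_, _))).2)
    simp [mul_assoc]
  · intro x
    change e.symm (1 * (e x).1, (e x).2) = x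
    rw [one_mul]; simp
  · change Nat.card (ZMod (p ^ a)) = _
    rw [Nat.card_zmod]
  · intro c x h
    have h : e.symm (c * (e x).1, (e x).2) = x := h
    have h2 := congrArg (fun y => (e y).1) h
    simpa using h2

end Fixed

section DD
open Module
variable {F L D I : Type} {d : ℕ} [Field F] [Field L] [Algebra F L] [DivisionRing D]
    [Algebra F D] [Fintype I] [DecidableEq I] [MulAction (L ≃ₐ[F] L) I] {S : SplitData F L D I d}
variable {κ M : Type} [Fintype κ] [DecidableEq κ] [AddCommGroup M] [Module L M]

def TwAct.torI (A : TwAct S κ M) (t : I → Lˣ) : M →ₗ[L] M := A.tor (fun i _ => t i)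

def TwAct.torK (A : TwAct S κ M) (i0 : I) (t : κ → Lˣ) : M →ₗ[L] M :=
  A.tor (fun i j => if i = i0 then t j else 1)

theorem TwAct.memI (A : TwAct S κ M) (g : L ≃ₐ[F] L) (P : I → Matrix κ κ L) (hP : ∀ i, IsUnit (P i))
    (w : I → ℤ) (m : M) (hm : m ∈ wtsp A.torI (tchar I L w)) :
    A.ρ g P m ∈ wtsp A.torI (tchar I L (fun i => w (g⁻¹ • i))) := by
  intro t
  have h1 := hm (fun i => Units.map (g.symm : L →* L) (t (g • i)))
  have h2 := A.tor_comm g P hP (fun i _ => t i) (fun i _ => Units.map (g.symm : L →* L) (t (g • i)))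
    (by
      intro i
      ext a b
      simp [Matrix.mul_diagonal, Matrix.diagonal_mul, mul_comm]) m
  change A.tor _ _ = _
  rw [h2]
  change A.ρ g P (A.torI _ m) = _
  rw [h1, A.smul]
  congr 1
  change g ((∏ x, _ : Lˣ) : L) = ((∏ x, _ : Lˣ) : L)
  symm
  rw [← Equiv.prod_comp (MulAction.toPerm g : Equiv.Perm I)]
  simp

theorem TwAct.memK (A : TwAct S κ M) (i0 : I) (g : L ≃ₐ[F] L) (hg : g • i0 = i0)
    (P : I → Matrix κ κ L) (hP : ∀ i, IsUnit (P i)) (σ : Equiv.Perm κ)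
    (hσ : ∀ a b, P i0 a b = if a = σ b then 1 else 0)
    (w : κ → ℤ) (m : M) (hm : m ∈ wtsp (A.torK i0) (tchar κ L w)) :
    A.ρ g P m ∈ wtsp (A.torK i0) (tchar κ L (fun j => w (σ⁻¹ j))) := by
  intro t
  have h1 := hm (fun j => Units.map (g.symm : L →* L) (t (σ j)))
  have h2 := A.tor_comm g P hP (fun i j => if i = i0 then t j else 1)
    (fun i j => if i = i0 then Units.map (g.symm : L →* L) (t (σ j)) else 1)
    (by
      intro i
      by_cases hi : i = i0
      · subst hi
        ext a b
        simp only [Matrix.mul_diagonal, Matrix.diagonal_mul, hg, if_true, hσ]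
        by_cases h : a = σ b
        · simp [h]
        · simp [h]
      · have : g • i ≠ i0 := by
          intro h; apply hi
          rw [← hg] at h
          exact MulAction.injective g h
        ext a b
        simp [Matrix.mul_diagonal, Matrix.diagonal_mul, hi, this]) m
  change A.tor _ _ = _
  rw [h2]
  change A.ρ g P (A.torK i0 _ m) = _
  rw [h1, A.smul]
  congr 1
  change g ((∏ x, _ : Lˣ) : L) = ((∏ x, _ : Lˣ) : L)
  symm
  rw [← Equiv.prod_comp σ]
  simp

theorem tchar_const {X : Type} [Fintype X] (w : X → ℤ) (c : Lˣ) :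
    tchar X L w (fun _ => c) = ((c ^ (∑ x, w x) : Lˣ) : L) := by
  change ((∏ x, _ : Lˣ) : L) = _
  congr 1
  induction (Finset.univ : Finset X) using Finset.cons_induction with
  | empty => simp
  | cons a s ha ih => rw [Finset.prod_cons, Finset.sum_cons, zpow_add, ih]


theorem wt_nonzero (W : Submodule L M) (h : finrank L W ≠ 0) : ∃ m ∈ W, m ≠ 0 := by
  by_contra hcon
  push Not at hcon
  apply h
  have : W = ⊥ := by
    rw [Submodule.eq_bot_iff]; exact hcon
  rw [this]; simp

theorem zpow_inj_of [Infinite L] {a b : ℤ} (h : ∀ c : Lˣ, c ^ a = c ^ b) : a = b := by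
  by_contra hab
  obtain ⟨t, ht⟩ := exists_zpow_ne (L := L) (a - b) (sub_ne_zero.2 hab)
  apply ht
  rw [zpow_sub, h, mul_inv_cancel]

theorem TwAct.sumK [Infinite L] (A : TwAct S κ M) (i0 : I) (w : I → ℤ) (μ : κ → ℤ) (m : M) (h0 : m ≠ 0)
    (hm : m ∈ wtsp A.torI (tchar I L w)) (hm' : m ∈ wtsp (A.torK i0) (tchar κ L μ)) :
    ∑ j, μ j = w i0 := by
  apply zpow_inj_of (L := L)
  intro c
  have h1 := hm' (fun _ => c)
  have h2 := hm (Pi.mulSingle i0 c)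
  have h3 : A.torK i0 (fun _ => c) = A.torI (Pi.mulSingle i0 c) := by
    unfold TwAct.torK TwAct.torI
    congr 1
    funext i j
    simp [Pi.mulSingle_apply]
  rw [h3, h2, tchar_const] at h1
  have h4 : tchar I L w (Pi.mulSingle i0 c) = ((c ^ w i0 : Lˣ) : L) := by
    change ((∏ x, _ : Lˣ) : L) = _
    rw [Finset.prod_eq_single i0]
    · simp
    · intro y _ hy; simp [hy]
    · simp
  rw [h4] at h1
  have := smul_left_injective L h0 h1
  exact (Units.ext this).symm

theorem TwAct.actI (A : TwAct S κ M) (i0 : I) (w : I → ℤ) (m : M)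
    (hm : m ∈ wtsp A.torI (tchar I L w)) (c : Lˣ) :
    A.torI (Pi.mulSingle i0 c) m = ((c ^ w i0 : Lˣ) : L) • m := by
  rw [hm]
  congr 1
  change ((∏ x, _ : Lˣ) : L) = _
  rw [Finset.prod_eq_single i0]
  · simp
  · intro y _ hy; simp [hy]
  · simp

/-- The innermost divisibility. -/
theorem TwAct.inner [FiniteDimensional F L] [IsGalois F L] [FiniteDimensional F D] [FiniteDimensional L M]
    (A : TwAct S κ M) (Hn : (L ≃ₐ[F] L) → I → Matrix κ κ L) (hHu : ∀ g i, IsUnit (Hn g i))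
    (hH1 : ∀ i, Hn 1 i = 1) 
    (hHm : ∀ g h i, (S.z g h i : L) • (Hn g (h • i) * (Hn h i).map g) = Hn (g * h) i)
    (W : Submodule L M) (hW : ∀ g P, (∀ i, IsUnit (P i)) → ∀ m ∈ W, A.ρ g P m ∈ W)
    (p : ℕ) [hp : Fact p.Prime] (H : Subgroup (L ≃ₐ[F] L)) (w : I → ℤ) (hw : ∀ g ∈ H, ∀ i, w (g • i) = w i)
    (i0 : I) (hi0 : ∀ g ∈ H, g • i0 = i0) (hpw : ¬ (p : ℤ) ∣ w i0) (μ : κ → ℤ)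
    (hr : finrank L (W ⊓ wtsp A.torI (tchar I L w) ⊓ wtsp (A.torK i0) (tchar κ L μ) : Submodule L M) ≠ 0) :
    padicValNat p (d * Fintype.card I) ≤ padicValNat p 
      (finrank L (W ⊓ wtsp A.torI (tchar I L w) ⊓ wtsp (A.torK i0) (tchar κ L μ) : Submodule L M) * H.index) := by
  set Y : Submodule L M := W ⊓ wtsp A.torI (tchar I L w) ⊓ wtsp (A.torK i0) (tchar κ L μ) with hY
  let G' : (L ≃ₐ[F] L) → I → Matrix κ κ L := fun g i => if i = i0 then 1 else Hn g i
  have hGu : ∀ g i, IsUnit (G' g i) := by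
    intro g i
    by_cases h : i = i0
    · simp [G', h]
    · simp [G', h, hHu]
  have hYs : ∀ g ∈ H, ∀ m ∈ Y, A.ρ g (G' g) m ∈ Y := by
    intro g hg m hm
    refine ⟨⟨hW g _ (hGu g) m hm.1.1, ?_⟩, ?_⟩
    · have := A.memI g (G' g) (hGu g) w m hm.1.2
      have e : (fun i => w (g⁻¹ • i)) = w := by funext i; rw [hw _ (H.inv_mem hg)]
      rw [e] at this
      exact this
    · exact A.memK i0 g (hi0 g hg) (G' g) (hGu g) 1 (by
        intro a b; simp only [G', if_true, Matrix.one_apply]; rfl) μ m hm.2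
  let ρ : H → Y →+ Y := fun g =>
    { toFun := fun m => ⟨A.ρ g.1 (G' g.1) m.1, hYs g.1 g.2 m.1 m.2⟩
      map_zero' := by ext1; simp
      map_add' := by intro a b; ext1; simp }
  let z : H → H → Lˣ := fun g h => S.z g.1 h.1 i0
  have T1 : Tw H z (w i0) (finrank L Y) := by
    apply Tw.of_module ρ
    · intro g c v; ext1; exact A.smul _ _ _ _
    · intro v; ext1
      change A.ρ 1 (G' 1) v.1 = v.1
      have : G' 1 = 1 := by
        funext i; by_cases h : i = i0 <;> simp [G', h, hH1]
      rw [this, A.one]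
    · intro g h v
      ext1
      change A.ρ g.1 (G' g.1) (A.ρ h.1 (G' h.1) v.1) = ((z g h ^ w i0 : Lˣ) : L) • A.ρ (g.1 * h.1) (G' (g.1 * h.1)) v.1
      have hmem : A.ρ (g.1 * h.1) (G' (g.1 * h.1)) v.1 ∈ wtsp A.torI (tchar I L w) :=
        (hYs _ (H.mul_mem g.2 h.2) v.1 v.2).1.2
      rw [← A.actI i0 w _ hmem, A.mul _ _ _ _ _ (hGu _) (hGu _)]
      change _ = A.ρ 1 _ (A.ρ _ _ _)
      rw [A.mul _ _ _ _ _ (fun i => diag_unit _) (hGu _), one_mul]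
      congr 2
      funext i
      rw [S.z_one_left, Units.val_one, one_smul]
      have hm1 : ∀ P : Matrix κ κ L, P.map (1 : L ≃ₐ[F] L) = P := by intro P; ext; simp
      rw [hm1, mul_smul]
      by_cases hi : i = i0
      · subst hi
        simp only [G', hi0 h.1 h.2, if_true, hi0 g.1 g.2, Pi.mulSingle_eq_same]
        rw [Matrix.map_one _ (map_zero _) (map_one _), mul_one, mul_one, ← Matrix.smul_one_eq_diagonal]
      · have hne : ∀ g ∈ H, g • i ≠ i0 := by
          intro g hg h; apply hi
          rw [← hi0 g hg] at h
          exact MulAction.injective g h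
        have h1 : h.1 • i ≠ i0 := hne h.1 h.2
        have h2 : g.1 • h.1 • i ≠ i0 := by rw [← mul_smul]; exact hne _ (H.mul_mem g.2 h.2)
        simp only [G', hi, h1, if_false, hHm]
        simp [h2]
  have T2 : Tw H z 1 d := ⟨fun g => S.θ g.1 i0, S.θ_one i0, fun g h => by
    have := S.θ_mul g.1 h.1 i0
    rw [hi0 h.1 h.2] at this
    rw [this, zpow_one]; rfl⟩
  obtain ⟨R, hR0, hR, hRv⟩ := T1.neg_one hr T2 S.dpos.ne' p hpw
  have T3 := tw_fix_dvd (z := z) (D := D) (fun g => S.θ g.1 i0) (S.θ_one i0) (fun g h => by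
    have := S.θ_mul g.1 h.1 i0
    rw [hi0 h.1 h.2] at this
    rw [this]; rfl) (S.φ i0) (fun g y => by
    have := S.θ_φ g.1 i0 y
    rw [hi0 g.1 g.2] at this
    exact this) hR
  rw [S.dim] at T3
  have T4 : d * Fintype.card I ∣ R * H.index := by
    apply Nat.dvd_of_mul_dvd_mul_right S.dpos
    convert T3 using 1 <;> ring
  have hidx : H.index ≠ 0 := Subgroup.index_ne_zero_of_finite
  calc padicValNat p (d * Fintype.card I) ≤ padicValNat p (R * H.index) := by
        apply padicValNat_dvd_iff_le (mul_ne_zero hR0 hidx) |>.1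
        exact pow_padicValNat_dvd.trans T4
    _ = padicValNat p R + padicValNat p H.index := padicValNat.mul hR0 hidx
    _ ≤ padicValNat p (finrank L Y) + padicValNat p H.index := by omega
    _ = _ := (padicValNat.mul hr hidx).symm

end DD

section D2
open Module
variable {F L D I : Type} {d : ℕ} [Field F] [Field L] [Algebra F L] [DivisionRing D]
    [Algebra F D] [Fintype I] [DecidableEq I] [MulAction (L ≃ₐ[F] L) I] {S : SplitData F L D I d}
variable {κ M : Type} [Fintype κ] [DecidableEq κ] [AddCommGroup M] [Module L M]

theorem arrow_smul_apply {C X : Type} [Group C] [MulAction C X] (c : C) (f : X → ℤ) (x : X) :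
    (letI : MulAction C (X → ℤ) := arrowAction; (c • f) x) = f (c⁻¹ • x) := rfl

theorem TwAct.middle [FiniteDimensional F L] [IsGalois F L] [FiniteDimensional F D] [FiniteDimensional L M]
    [Infinite L]
    (A : TwAct S κ M) (Hn : (L ≃ₐ[F] L) → I → Matrix κ κ L) (hHu : ∀ g i, IsUnit (Hn g i))
    (hH1 : ∀ i, Hn 1 i = 1) 
    (hHm : ∀ g h i, (S.z g h i : L) • (Hn g (h • i) * (Hn h i).map g) = Hn (g * h) i)
    {ι : Type} [Fintype ι] (b : Basis ι L M) (lam : ι → I → κ → ℤ)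
    (hb : ∀ a t, A.tor t (b a) = ((∏ i, ∏ j, t i j ^ lam a i j : Lˣ) : L) • b a)
    (W : Submodule L M) (hW : ∀ g P, (∀ i, IsUnit (P i)) → ∀ m ∈ W, A.ρ g P m ∈ W)
    (p : ℕ) [hp : Fact p.Prime] (H : Subgroup (L ≃ₐ[F] L)) (w : I → ℤ) (hw : ∀ g ∈ H, ∀ i, w (g • i) = w i)
    (i0 : I) (hi0 : ∀ g ∈ H, g • i0 = i0) (hpw : ¬ (p : ℤ) ∣ w i0) :
    p ^ padicValNat p (d * Fintype.card I) * p ^ padicValNat p (Fintype.card κ) ∣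
      finrank L (W ⊓ wtsp A.torI (tchar I L w) : Submodule L M) * H.index := by
  classical
  set W' : Submodule L M := W ⊓ wtsp A.torI (tchar I L w) with hW'
  have hstab : ∀ t, ∀ m ∈ W', A.torK i0 t m ∈ W' := by
    intro t m hm
    have hu : ∀ i, IsUnit (Matrix.diagonal fun j => (((if i = i0 then t j else 1 : Lˣ)) : L)) := fun i => diag_unit _
    refine ⟨hW 1 _ hu m hm.1, ?_⟩
    have := A.memI 1 _ hu w m hm.2
    have e : (fun i => w ((1 : L ≃ₐ[F] L)⁻¹ • i)) = w := by funext i; simp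
    rw [e] at this
    exact this
  obtain ⟨X0, hX0, hsum⟩ := weight_sum (A.torK i0) (tchar κ L) (tchar_inj κ) b (fun a => lam a i0) (by
    intro a t
    change A.tor _ _ = _
    rw [hb]
    congr 1
    change _ = ((∏ x, _ : Lˣ) : L)
    congr 1
    rw [Finset.prod_eq_single i0]
    · simp
    · intro i _ hi; simp [hi]
    · simp) W' hstab
  rw [hsum, Finset.sum_mul]
  obtain ⟨C, _, _, _, hC, hfree⟩ := free_action κ p
  letI : MulAction C (κ → ℤ) := arrowAction
  have hinv : ∀ (c : C) (μ : κ → ℤ), finrank L (W' ⊓ wtsp (A.torK i0) (tchar κ L μ) : Submodule L M) ≤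
      finrank L (W' ⊓ wtsp (A.torK i0) (tchar κ L (c • μ)) : Submodule L M) := by
    intro c μ
    let P : I → Matrix κ κ L := fun i => if i = i0 then (MulAction.toPerm c⁻¹ : Equiv.Perm κ).permMatrix L else 1
    have hP : ∀ i, IsUnit (P i) := by
      intro i
      by_cases h : i = i0
      · simp only [P, h, if_true]
        rw [Matrix.isUnit_iff_isUnit_det, Matrix.det_permutation]
        exact ((Equiv.Perm.sign _).isUnit.map (Int.castRingHom L))
      · simp [P, h]
    apply A.finrank_le 1 P hP
    intro m hm
    refine ⟨⟨hW 1 P hP m hm.1.1, ?_⟩, ?_⟩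
    · have := A.memI 1 P hP w m hm.1.2
      have e : (fun i => w ((1 : L ≃ₐ[F] L)⁻¹ • i)) = w := by funext i; simp
      rw [e] at this
      exact this
    · have := A.memK i0 1 (one_smul _ _) P hP (MulAction.toPerm c) (by
        intro a b
        simp only [P, if_true, Equiv.Perm.permMatrix, PEquiv.toMatrix_apply, Equiv.toPEquiv_apply, Option.mem_def,
          Option.some.injEq, MulAction.toPerm_apply]
        simp only [inv_smul_eq_iff]) μ m hm.2
      exact this
  have hinv2 : ∀ (c : C) (μ : κ → ℤ), finrank L (W' ⊓ wtsp (A.torK i0) (tchar κ L (c • μ)) : Submodule L M) =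
      finrank L (W' ⊓ wtsp (A.torK i0) (tchar κ L μ) : Submodule L M) := by
    intro c μ
    apply le_antisymm _ (hinv c μ)
    have := hinv c⁻¹ (c • μ)
    rwa [inv_smul_smul] at this
  apply orbit_dvd (A := C) X0 (fun μ => finrank L (W' ⊓ wtsp (A.torK i0) (tchar κ L μ) : Submodule L M) * H.index)
  · intro x hx; simp [hX0 x hx]
  · intro a x; simp only [hinv2]
  · intro μ hμ
    have hr := left_ne_zero_of_mul hμ
    obtain ⟨m, hm, hm0⟩ := wt_nonzero _ hr
    have hs := A.sumK i0 w μ m hm0 hm.1.2 hm.2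
    have hin := A.inner Hn hHu hH1 hHm W hW p H w hw i0 hi0 hpw μ hr
    have hCp : IsPGroup p C := IsPGroup.of_card hC
    obtain ⟨x, hx, _⟩ := fixed_of_sum (A := MulAction.stabilizer C μ) (X := κ) p (hCp.to_subgroup _) μ (by
      rintro ⟨c, hc⟩ x
      have h := (MulAction.stabilizer C μ).inv_mem hc
      have h2 := congrFun (MulAction.mem_stabilizer_iff.1 h) x
      rw [← h2]
      change _ = μ (c⁻¹⁻¹ • x)
      rw [inv_inv]; rfl) (by rw [hs]; exact hpw)
    have hbot : MulAction.stabilizer C μ = ⊥ := by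
      rw [Subgroup.eq_bot_iff_forall]
      intro c hc
      exact hfree c x (hx ⟨c, hc⟩)
    have hco : Nat.card (MulAction.orbit C μ) = Nat.card C := by
      have := MulAction.index_stabilizer C μ
      rw [hbot, Subgroup.index_bot] at this
      rw [this]; rfl
    rw [hco, hC, mul_comm]
    apply mul_dvd_mul_left
    exact (padicValNat_dvd_iff_le hμ).2 hin

theorem TwAct.main [FiniteDimensional F L] [IsGalois F L] [FiniteDimensional F D] [FiniteDimensional L M]
    [Infinite L]
    (A : TwAct S κ M) (Hn : (L ≃ₐ[F] L) → I → Matrix κ κ L) (hHu : ∀ g i, IsUnit (Hn g i))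
    (hH1 : ∀ i, Hn 1 i = 1) 
    (hHm : ∀ g h i, (S.z g h i : L) • (Hn g (h • i) * (Hn h i).map g) = Hn (g * h) i)
    {ι : Type} [Fintype ι] (b : Basis ι L M) (lam : ι → I → κ → ℤ)
    (hb : ∀ a t, A.tor t (b a) = ((∏ i, ∏ j, t i j ^ lam a i j : Lˣ) : L) • b a)
    (n : ℤ) (hn : ∀ a, ∑ i, ∑ j, lam a i j = n)
    (W : Submodule L M) (hW : ∀ g P, (∀ i, IsUnit (P i)) → ∀ m ∈ W, A.ρ g P m ∈ W)
    (p : ℕ) [hp : Fact p.Prime] (hpn : ¬ (p : ℤ) ∣ n) :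
    p ^ padicValNat p (d * Fintype.card I) * p ^ padicValNat p (Fintype.card κ) ∣ finrank L W := by
  classical
  have hprod : ∀ (v : I → κ → ℤ) (t : I → Lˣ), ∏ i, ∏ j, t i ^ v i j = ∏ i, t i ^ ∑ j, v i j := by
    intro v t
    refine Finset.prod_congr rfl fun i _ => ?_
    induction (Finset.univ : Finset κ) using Finset.cons_induction with
    | empty => simp
    | cons a s ha ih => rw [Finset.prod_cons, Finset.sum_cons, zpow_add, ih]
  have hbI : ∀ a, b a ∈ wtsp A.torI (tchar I L (fun i => ∑ j, lam a i j)) := by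
    intro a t
    change A.tor _ _ = _
    rw [hb]
    congr 1
    change _ = ((∏ x, _ : Lˣ) : L)
    rw [hprod]
  obtain ⟨X0, hX0, hsum⟩ := weight_sum A.torI (tchar I L) (tchar_inj I) b _ hbI W (by
    intro t m hm
    exact hW 1 _ (fun i => diag_unit _) m hm)
  have hscal : ∀ (c : Lˣ) m, A.torI (fun _ => c) m = ((c ^ n : Lˣ) : L) • m := by
    intro c
    have : A.torI (fun _ => c) = ((c ^ n : Lˣ) : L) • (LinearMap.id : M →ₗ[L] M) := by
      apply b.ext
      intro a
      rw [hbI a, tchar_const, hn]; rfl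
    intro m; rw [this]; rfl
  rw [hsum]
  let P : Sylow p (L ≃ₐ[F] L) := default
  letI : MulAction P (I → ℤ) := arrowAction
  have hinv : ∀ (c : P) (w : I → ℤ), finrank L (W ⊓ wtsp A.torI (tchar I L w) : Submodule L M) ≤
      finrank L (W ⊓ wtsp A.torI (tchar I L (c • w)) : Submodule L M) := by
    intro c w
    apply A.finrank_le c.1 (Hn c.1) (hHu _)
    intro m hm
    exact ⟨hW _ _ (hHu _) m hm.1, A.memI c.1 (Hn c.1) (hHu _) w m hm.2⟩
  apply orbit_dvd (A := P) X0 (fun w => finrank L (W ⊓ wtsp A.torI (tchar I L w) : Submodule L M)) hX0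
  · intro c w
    apply le_antisymm _ (hinv c w)
    have := hinv c⁻¹ (c • w)
    rwa [inv_smul_smul] at this
  · intro w hr
    obtain ⟨m, hm, hm0⟩ := wt_nonzero _ hr
    have hs : ∑ i, w i = n := by
      apply zpow_inj_of (L := L)
      intro c
      have h1 := hm.2 (fun _ => c)
      rw [hscal, tchar_const] at h1
      exact (Units.ext (smul_left_injective L hm0 h1)).symm
    have hfix : ∀ c : P, c ∈ MulAction.stabilizer P w → ∀ i, w (c • i) = w i := by
      intro c hc x
      have h := (MulAction.stabilizer P w).inv_mem hc
      have h2 := congrFun (MulAction.mem_stabilizer_iff.1 h) x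
      rw [← h2]
      change _ = w (c⁻¹⁻¹ • x)
      rw [inv_inv]
    obtain ⟨i0, hi0, hpw⟩ := fixed_of_sum (A := MulAction.stabilizer P w) (X := I) p (P.2.to_subgroup _) w (by
      rintro ⟨c, hc⟩ x
      exact hfix c hc x) (by rw [hs]; exact hpn)
    have hmid := A.middle Hn hHu hH1 hHm b lam hb W hW p ((MulAction.stabilizer P w).map (P : Subgroup (L ≃ₐ[F] L)).subtype) w (by
      rintro _ ⟨c, hc, rfl⟩ i
      exact hfix c hc i) i0 (by
      rintro _ ⟨c, hc, rfl⟩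
      exact hi0 ⟨c, hc⟩) hpw
    rw [Subgroup.index_map_subtype, MulAction.index_stabilizer, ← mul_assoc] at hmid
    have hcop : ¬ p ∣ (P : Subgroup (L ≃ₐ[F] L)).index := P.not_dvd_index
    rw [← pow_add] at hmid ⊢
    have := (Nat.Coprime.pow_left _ ((Nat.Prime.coprime_iff_not_dvd hp.out).2 hcop)).dvd_of_dvd_mul_right hmid
    rw [mul_comm (finrank L _)] at this
    exact this

end D2

section Blocks
open Module
variable {F L D I : Type} {d : ℕ} [Field F] [Field L] [Algebra F L] [DivisionRing D]
    [Algebra F D] [Fintype I] [DecidableEq I] [MulAction (L ≃ₐ[F] L) I]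
variable {κ : Type} [Fintype κ] [DecidableEq κ]

/-- Block monomial matrices. -/
def Bk (g : L ≃ₐ[F] L) (P : I → Matrix κ κ L) (Q : I → Matrix (Fin d) (Fin d) L) :
    Matrix (I × κ × Fin d) (I × κ × Fin d) L :=
  fun x y => if x.1 = g • y.1 then P y.1 x.2.1 y.2.1 * Q y.1 x.2.2 y.2.2 else 0

theorem Bk_mul (g h : L ≃ₐ[F] L) (P P' : I → Matrix κ κ L) (Q Q' : I → Matrix (Fin d) (Fin d) L) :
    Bk g P Q * (Bk h P' Q').map g = 
      Bk (g * h) (fun i => P (h • i) * (P' i).map g) (fun i => Q (h • i) * (Q' i).map g) := by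
  ext ⟨i, j, a⟩ ⟨i', j', a'⟩
  simp only [Bk, Matrix.mul_apply, Matrix.map_apply, Fintype.sum_prod_type]
  rw [Finset.sum_eq_single (h • i')]
  · simp only [if_true]
    by_cases hi : i = g • h • i'
    · simp only [hi, mul_smul, if_true, map_mul]
      rw [Finset.sum_mul_sum]
      refine Finset.sum_congr rfl fun x _ => Finset.sum_congr rfl fun y _ => ?_
      ring
    · simp [hi, mul_smul]
  · intro b _ hb
    simp [hb]
  · simp

theorem Bk_one : Bk (1 : L ≃ₐ[F] L) (1 : I → Matrix κ κ L) (1 : I → Matrix (Fin d) (Fin d) L) = 1 := by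
  ext ⟨i, j, a⟩ ⟨i', j', a'⟩
  simp only [Bk, Matrix.one_apply, one_smul, Pi.one_apply, Prod.mk.injEq]
  by_cases h1 : i = i' <;> by_cases h2 : j = j' <;> by_cases h3 : a = a' <;> simp [h1, h2, h3]

theorem Bk_smul (g : L ≃ₐ[F] L) (P : I → Matrix κ κ L) (Q : I → Matrix (Fin d) (Fin d) L) (c : I → L) :
    Bk g P (fun i => c i • Q i) = Bk g (fun i => c i • P i) Q := by
  ext ⟨i, j, a⟩ ⟨i', j', a'⟩
  simp only [Bk, Matrix.smul_apply, smul_eq_mul]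
  split_ifs
  · ring
  · rfl

theorem isUnit_exists_inv_map (g : L ≃ₐ[F] L) {n : Type} [Fintype n] [DecidableEq n] {P : Matrix n n L} (h : IsUnit P) :
    ∃ P' : Matrix n n L, P * P'.map g = 1 := by
  obtain ⟨u, rfl⟩ := h
  refine ⟨(u⁻¹ : (Matrix n n L)ˣ).1.map (g⁻¹ : L ≃ₐ[F] L), ?_⟩
  rw [Matrix.map_map]
  have : ((g : L → L) ∘ ((g⁻¹ : L ≃ₐ[F] L) : L → L)) = id := by
    funext x
    exact g.apply_symm_apply x
  rw [this, Matrix.map_id, Units.mul_inv]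

theorem Bk_unit (g : L ≃ₐ[F] L) (P : I → Matrix κ κ L) (Q : I → Matrix (Fin d) (Fin d) L)
    (hP : ∀ i, IsUnit (P i)) (hQ : ∀ i, IsUnit (Q i)) : IsUnit (Bk g P Q) := by
  choose P' hP' using fun i => isUnit_exists_inv_map g (hP i)
  choose Q' hQ' using fun i => isUnit_exists_inv_map g (hQ i)
  have h := Bk_mul g g⁻¹ P (fun i => P' (g⁻¹ • i)) Q (fun i => Q' (g⁻¹ • i))
  simp only [hP', hQ', mul_inv_cancel] at h
  have h2 := h.trans Bk_one
  exact IsUnit.of_mul_eq_one _ h2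

variable (S : SplitData F L D I d)

/-- the elements of the group -/
def SplitData.E (g : L ≃ₐ[F] L) (P : I → Matrix κ κ L) : Matrix (I × κ × Fin d) (I × κ × Fin d) L :=
  Bk g P (S.θ g)

theorem SplitData.E_mul (g h : L ≃ₐ[F] L) (P P' : I → Matrix κ κ L) :
    S.E g P * (S.E h P').map g = S.E (g * h) (fun i => (S.z g h i : L) • (P (h • i) * (P' i).map g)) := by
  unfold SplitData.E
  rw [Bk_mul]
  simp only [S.θ_mul]
  rw [Bk_smul]

theorem SplitData.E_one : S.E 1 (1 : I → Matrix κ κ L) = 1 := by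
  unfold SplitData.E
  have : S.θ 1 = 1 := funext S.θ_one
  rw [this, Bk_one]

theorem SplitData.E_unit (g : L ≃ₐ[F] L) (P : I → Matrix κ κ L) (hP : ∀ i, IsUnit (P i)) : IsUnit (S.E g P) :=
  Bk_unit _ _ _ hP (S.θ_unit g)

theorem SplitData.E_diag (t : I → κ → L) :
    S.E 1 (fun i => Matrix.diagonal (t i)) = Matrix.diagonal (fun x => t x.1 x.2.1) := by
  unfold SplitData.E
  have : S.θ 1 = 1 := funext S.θ_one
  rw [this]
  ext ⟨i, j, a⟩ ⟨i', j', a'⟩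
  simp only [Bk, Matrix.diagonal_apply, one_smul, Pi.one_apply, Prod.mk.injEq, Matrix.one_apply]
  by_cases h1 : i = i' <;> by_cases h2 : j = j' <;> by_cases h3 : a = a' <;> simp [h1, h2, h3]

/-- the representation -/
def SplitData.Phi (κ : Type) [Fintype κ] [DecidableEq κ] (y : D) :
    Matrix (I × κ × Fin d) (I × κ × Fin d) L :=
  Bk (1 : L ≃ₐ[F] L) 1 (fun i => S.φ i y)

theorem map_one_alg {n : Type} (P : Matrix n n L) : P.map (1 : L ≃ₐ[F] L) = P := by ext; simp

theorem SplitData.E_Phi (g : L ≃ₐ[F] L) (P : I → Matrix κ κ L) (y : D) :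
    S.E g P * (S.Phi κ y).map g = S.Phi κ y * S.E g P := by
  unfold SplitData.E SplitData.Phi
  conv_rhs => rw [← map_one_alg (F := F) (Bk g P (S.θ g))]
  rw [Bk_mul, Bk_mul, mul_one, one_mul]
  congr 1
  · funext i
    rw [one_smul, map_one_alg]
    have : ((1 : I → Matrix κ κ L) i).map g = 1 := by
      rw [Pi.one_apply, Matrix.map_one] <;> simp
    rw [this]; simp
  · funext i
    rw [one_smul, map_one_alg, S.θ_φ]

theorem SplitData.Phi_mul (y y' : D) : S.Phi κ (y * y') = S.Phi κ y * S.Phi κ y' := by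
  unfold SplitData.Phi
  conv_rhs => rw [← map_one_alg (F := F) (Bk _ _ (fun i => S.φ i y'))]
  rw [Bk_mul, one_mul]
  congr 1
  · funext i
    rw [map_one_alg]; simp
  · funext i
    rw [map_one_alg]; simp

theorem SplitData.Phi_one : S.Phi κ 1 = 1 := by
  unfold SplitData.Phi
  simp only [map_one]
  exact Bk_one

theorem SplitData.Phi_add (y y' : D) : S.Phi κ (y + y') = S.Phi κ y + S.Phi κ y' := by
  ext ⟨i, j, a⟩ ⟨i', j', a'⟩
  simp only [SplitData.Phi, Bk, Matrix.add_apply, map_add]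
  split_ifs
  · ring
  · simp

theorem SplitData.Phi_alg (c : F) : S.Phi κ (algebraMap F D c) = algebraMap F _ c := by
  ext ⟨i, j, a⟩ ⟨i', j', a'⟩
  simp only [SplitData.Phi, Bk, AlgHom.commutes, Matrix.algebraMap_matrix_apply, one_smul, Pi.one_apply,
     Matrix.one_apply, Prod.mk.injEq]
  by_cases h1 : i = i' <;> by_cases h2 : j = j' <;> by_cases h3 : a = a' <;> simp [h1, h2, h3]

theorem SplitData.honest (s : ℕ) : ∃ Hn : (L ≃ₐ[F] L) → I → Matrix (Fin s × Fin d) (Fin s × Fin d) L,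
    (∀ g i, IsUnit (Hn g i)) ∧ (∀ i, Hn 1 i = 1) ∧
    ∀ g h i, (S.z g h i : L) • (Hn g (h • i) * (Hn h i).map g) = Hn (g * h) i := by
  refine ⟨fun g i => Matrix.kroneckerMap (· * ·) (1 : Matrix (Fin s) (Fin s) L) ((S.θ g i)⁻¹).transpose, ?_, ?_, ?_⟩
  · intro g i
    have h1 : (S.θ g i) * (S.θ g i)⁻¹ = 1 := Matrix.mul_nonsing_inv _ ((Matrix.isUnit_iff_isUnit_det _).1 (S.θ_unit g i))
    apply IsUnit.of_mul_eq_one (Matrix.kroneckerMap (· * ·) (1 : Matrix (Fin s) (Fin s) L) (S.θ g i).transpose)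
    change Matrix.kroneckerMap (· * ·) _ _ * _ = _
    rw [← Matrix.mul_kronecker_mul, ← Matrix.transpose_mul, h1]
    simp
  · intro i
    simp [S.θ_one]
  · intro g h i
    have hd : ∀ g i, IsUnit (S.θ g i).det := fun g i => (Matrix.isUnit_iff_isUnit_det _).1 (S.θ_unit g i)
    have hm : ((S.θ h i)⁻¹.transpose).map g = (((S.θ h i).map g)⁻¹).transpose := by
      rw [Matrix.transpose_map]
      congr 1
      symm
      apply Matrix.inv_eq_right_inv
      have := congrArg (fun A : Matrix _ _ L => A.map g) (Matrix.mul_nonsing_inv _ (hd h i))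
      have h3 : ((S.θ h i) * (S.θ h i)⁻¹).map g = (S.θ h i).map g * ((S.θ h i)⁻¹).map g := 
        Matrix.map_mul (f := (g : L →+* L))
      rw [h3] at this
      rw [this, Matrix.map_one] <;> simp
    have hk : (Matrix.kroneckerMap (· * ·) (1 : Matrix (Fin s) (Fin s) L) ((S.θ h i)⁻¹).transpose).map g
        = Matrix.kroneckerMap (· * ·) (1 : Matrix (Fin s) (Fin s) L) (((S.θ h i)⁻¹).transpose.map g) := by
      ext ⟨a, b⟩ ⟨a', b'⟩
      simp only [Matrix.map_apply, Matrix.kroneckerMap_apply, map_mul, Matrix.one_apply]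
      split_ifs <;> simp
    change _ • (Matrix.kroneckerMap (· * ·) _ _ * Matrix.map (Matrix.kroneckerMap (· * ·) _ _) _) = Matrix.kroneckerMap (· * ·) _ _
    rw [hk, ← Matrix.mul_kronecker_mul, hm, ← Matrix.transpose_mul, one_mul, ← Matrix.mul_inv_rev, S.θ_mul,
      ← Matrix.kronecker_smul, ← Matrix.transpose_smul]
    congr 2
    symm
    apply Matrix.inv_eq_right_inv
    rw [Matrix.mul_smul, ← Matrix.smul_mul]
    exact Matrix.mul_nonsing_inv _ (by rw [← S.θ_mul, Matrix.det_mul]; exact (hd _ _).mul ((Matrix.isUnit_iff_isUnit_det _).1 (unit_map g (S.θ_unit h i))))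
end Blocks

section Acts
open Module MvPolynomial
variable {F L : Type} [Field F] [Field L] [Algebra F L]
variable {Cc J₁ J₂ : Type} [Fintype Cc] [DecidableEq Cc] [Fintype J₁] [DecidableEq J₁] [Fintype J₂] [DecidableEq J₂]

/-- substitution matrix for `x_c ↦ A x_c B`. -/
def TT (Cc : Type) [DecidableEq Cc] (A : Matrix J₁ J₁ L) (B : Matrix J₂ J₂ L) :
    Matrix (Cc × J₁ × J₂) (Cc × J₁ × J₂) L :=
  fun x y => if x.1 = y.1 then A y.2.1 x.2.1 * B x.2.2 y.2.2 else 0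

theorem TT_mul (g : L ≃ₐ[F] L) (A A' : Matrix J₁ J₁ L) (B B' : Matrix J₂ J₂ L) :
    TT Cc A B * (TT Cc A' B').map g = TT Cc (A'.map g * A) (B * B'.map g) := by
  ext ⟨c, i, j⟩ ⟨c', i', j'⟩
  simp only [TT, Matrix.mul_apply, Matrix.map_apply, Fintype.sum_prod_type]
  rw [Finset.sum_eq_single c']
  · by_cases hc : c = c'
    · simp only [hc, if_true, map_mul]
      rw [Finset.sum_mul_sum]
      refine Finset.sum_congr rfl fun x _ => Finset.sum_congr rfl fun y _ => ?_
      ring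
    · simp [hc]
  · intro b _ hb
    simp [hb]
  · simp

theorem TT_one : TT Cc (1 : Matrix J₁ J₁ L) (1 : Matrix J₂ J₂ L) = 1 := by
  ext ⟨i, j, a⟩ ⟨i', j', a'⟩
  simp only [TT, Matrix.one_apply, Prod.mk.injEq]
  by_cases h1 : i = i' <;> by_cases h2 : j = j' <;> by_cases h3 : a = a' <;> simp [h1, h2, h3, eq_comm]

theorem map_inv_unit (g : L ≃ₐ[F] L) {A : Matrix J₁ J₁ L} (hA : IsUnit A) : (A.map g)⁻¹ = A⁻¹.map g := by
  apply Matrix.inv_eq_right_inv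
  have := congrArg (fun A : Matrix _ _ L => A.map g) (Matrix.mul_nonsing_inv _ ((Matrix.isUnit_iff_isUnit_det _).1 hA))
  have h3 : (A * A⁻¹).map g = A.map g * (A⁻¹).map g := Matrix.map_mul (f := (g : L →+* L))
  simp only [h3] at this
  rw [this, Matrix.map_one] <;> simp

/-- the substitution attached to `(g, A, B)`: `x ↦ A⁻¹ x B`. -/
noncomputable def Psi (Cc : Type) [Fintype Cc] [DecidableEq Cc] (g : L ≃ₐ[F] L) (A : Matrix J₁ J₁ L) (B : Matrix J₂ J₂ L) :
    MvPolynomial (Cc × J₁ × J₂) L →+* MvPolynomial (Cc × J₁ × J₂) L :=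
  semiHom (g : L →+* L) (TT Cc A⁻¹ B)

theorem Psi_comp (g h : L ≃ₐ[F] L) (A A' : Matrix J₁ J₁ L) (hA' : IsUnit A') (B B' : Matrix J₂ J₂ L) 
    (f : MvPolynomial (Cc × J₁ × J₂) L) :
    Psi Cc g A B (Psi Cc h A' B' f) = Psi Cc (g * h) (A * A'.map g) (B * B'.map g) f := by
  have := DFunLike.congr_fun (semiHom_comp (g : L →+* L) (h : L →+* L) (TT Cc A⁻¹ B) (TT Cc A'⁻¹ B')) f
  rw [RingHom.comp_apply] at this
  unfold Psi
  rw [this]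
  have h2 := TT_mul (Cc := Cc) g A⁻¹ A'⁻¹ B B'
  rw [← map_inv_unit g hA', ← Matrix.mul_inv_rev] at h2
  rw [← h2]
  rfl

theorem Psi_one (f : MvPolynomial (Cc × J₁ × J₂) L) : Psi (F := F) Cc 1 (1 : Matrix J₁ J₁ L) (1 : Matrix J₂ J₂ L) f = f := by
  unfold Psi
  rw [inv_one, TT_one]
  have : semiHom ((1 : L ≃ₐ[F] L) : L →+* L) (1 : Matrix (Cc × J₁ × J₂) (Cc × J₁ × J₂) L) = RingHom.id _ := by
    apply MvPolynomial.ringHom_ext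
    · intro c; simp [semiHom]
    · intro j
      simp [semiHom, Matrix.one_apply]
  rw [this]; rfl

theorem Psi_C (g : L ≃ₐ[F] L) (A : Matrix J₁ J₁ L) (B : Matrix J₂ J₂ L) (c : L) :
    Psi Cc g A B (C c) = C (g c) := by
  simp [Psi, semiHom]

/-- action on vectors -/
noncomputable def actV (Cc : Type) [Fintype Cc] [DecidableEq Cc] (g : L ≃ₐ[F] L) (A : Matrix J₁ J₁ L) (B : Matrix J₂ J₂ L) 
    (v : J₁ → MvPolynomial (Cc × J₁ × J₂) L) : J₁ → MvPolynomial (Cc × J₁ × J₂) L :=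
  fun i => ∑ k, C (A i k) * Psi Cc g A B (v k)

theorem actV_actV (g h : L ≃ₐ[F] L) (A A' : Matrix J₁ J₁ L) (hA' : IsUnit A') (B B' : Matrix J₂ J₂ L) 
    (v : J₁ → MvPolynomial (Cc × J₁ × J₂) L) :
    actV Cc g A B (actV Cc h A' B' v) = actV Cc (g * h) (A * A'.map g) (B * B'.map g) v := by
  funext i
  simp only [actV, map_sum, map_mul, Psi_C, Psi_comp _ _ _ _ hA', Matrix.mul_apply, Finset.mul_sum, Finset.sum_mul]
  rw [Finset.sum_comm]
  refine Finset.sum_congr rfl fun x _ => Finset.sum_congr rfl fun y _ => ?_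
  simp [Matrix.map_apply]
  ring

theorem Psi_homog (g : L ≃ₐ[F] L) (A : Matrix J₁ J₁ L) (B : Matrix J₂ J₂ L) (n : ℕ)
    (f : MvPolynomial (Cc × J₁ × J₂) L) (hf : f.IsHomogeneous n) : (Psi Cc g A B f).IsHomogeneous n :=
  semiHom_homog _ _ _ _ hf

/-- homogeneous vectors -/
abbrev HV (Cc J₁ J₂ L : Type) [Field L] (t : ℕ) : Type := J₁ → homogeneousSubmodule (Cc × J₁ × J₂) L t

/-- action on homogeneous vectors -/
noncomputable def actH (Cc : Type) [Fintype Cc] [DecidableEq Cc] (t : ℕ) (g : L ≃ₐ[F] L) (A : Matrix J₁ J₁ L) (B : Matrix J₂ J₂ L) :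
    HV Cc J₁ J₂ L t →+ HV Cc J₁ J₂ L t where
  toFun v := fun i => ⟨actV Cc g A B (fun k => (v k).1) i, by
    apply Submodule.sum_mem
    intro k _
    rw [← MvPolynomial.smul_eq_C_mul]
    exact Submodule.smul_mem _ _ (Psi_homog _ _ _ _ _ (v k).2)⟩
  map_zero' := by funext i; ext1; simp [actV]
  map_add' := by 
    intro a b; funext i; ext1
    simp [actV, mul_add, Finset.sum_add_distrib]

theorem actH_val (t : ℕ) (g : L ≃ₐ[F] L) (A : Matrix J₁ J₁ L) (B : Matrix J₂ J₂ L) (v : HV Cc J₁ J₂ L t) :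
    (fun i => (actH Cc t g A B v i).1) = actV Cc g A B (fun k => (v k).1) := rfl

theorem actH_actH (t : ℕ) (g h : L ≃ₐ[F] L) (A A' : Matrix J₁ J₁ L) (hA' : IsUnit A') (B B' : Matrix J₂ J₂ L) 
    (v : HV Cc J₁ J₂ L t) :
    actH Cc t g A B (actH Cc t h A' B' v) = actH Cc t (g * h) (A * A'.map g) (B * B'.map g) v := by
  funext i; ext1
  exact congrFun (actV_actV g h A A' hA' B B' (fun k => (v k).1)) i

theorem actH_one (t : ℕ) (v : HV Cc J₁ J₂ L t) : actH (F := F) Cc t 1 1 1 v = v := by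
  funext i; ext1
  change ∑ k, _ = _
  simp [Psi_one, Matrix.one_apply]

theorem actH_smul (t : ℕ) (g : L ≃ₐ[F] L) (A : Matrix J₁ J₁ L) (B : Matrix J₂ J₂ L) (c : L) (v : HV Cc J₁ J₂ L t) :
    actH Cc t g A B (c • v) = g c • actH Cc t g A B v := by
  funext i; ext1
  change ∑ k, C (A i k) * Psi Cc g A B (c • (v k).1) = g c • ∑ k, C (A i k) * Psi Cc g A B (v k).1
  rw [Finset.smul_sum]
  refine Finset.sum_congr rfl fun k _ => ?_
  simp only [smul_eq_C_mul, map_mul, Psi_C]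
  ring

theorem homB_exists (σ L : Type) [Field L] (t : ℕ) : 
    ∃ b : Basis {m : σ →₀ ℕ | m.degree = t} L (homogeneousSubmodule σ L t), ∀ m, (b m).1 = monomial m.1 1 := by
  classical
  let v : {m : σ →₀ ℕ | m.degree = t} → homogeneousSubmodule σ L t := fun m => 
    ⟨monomial m.1 1, isHomogeneous_monomial _ m.2⟩
  have hli : LinearIndependent L v := by
    apply LinearIndependent.of_comp (homogeneousSubmodule σ L t).subtype
    have := (basisMonomials σ L).linearIndependent.comp (fun m : {m : σ →₀ ℕ | m.degree = t} => m.1) Subtype.val_injective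
    convert this using 1
    funext m
    simp [v]
  have hsp : ⊤ ≤ Submodule.span L (Set.range v) := by
    rintro ⟨f, hf⟩ -
    have h1 : (⟨f, hf⟩ : homogeneousSubmodule σ L t) = ∑ m ∈ f.support.attach, f.coeff m.1 • v ⟨m.1, by
        have := hf (mem_support_iff.1 m.2)
        rw [← this, Set.mem_setOf_eq, Finsupp.degree_eq_weight_one]; rfl⟩ := by
      ext1
      rw [AddSubmonoidClass.coe_finset_sum]
      simp only [Submodule.coe_smul, v, smul_monomial, smul_eq_mul, mul_one]
      rw [Finset.sum_attach f.support (fun m => monomial m (f.coeff m))]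
      exact f.as_sum
    rw [h1]
    apply Submodule.sum_mem
    intro m _
    exact Submodule.smul_mem _ _ (Submodule.subset_span ⟨_, rfl⟩)
  exact ⟨Basis.mk hli hsp, fun m => by rw [Basis.mk_apply]⟩

theorem degree_finite (σ : Type) [Fintype σ] (t : ℕ) : Finite {m : σ →₀ ℕ | m.degree = t} := by
  classical
  have : {m : σ →₀ ℕ | m.degree = t} ⊆ ((Finset.univ : Finset σ).finsuppAntidiag t : Set _) := by
    intro m hm
    rw [Finset.mem_coe, Finset.mem_finsuppAntidiag]
    refine ⟨?_, by simp⟩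
    rw [← hm, Finsupp.degree_eq_sum]
  exact (Finset.finite_toSet _).subset this

theorem fiber_prod {X Y K : Type} [Fintype X] [Fintype Y] [DecidableEq Y] [Fintype K] [DecidableEq K] (π : X → Y × K)
    (m : X → ℤ) (t : Y → K → Lˣ) :
    ∏ x, t (π x).1 (π x).2 ^ m x = ∏ i, ∏ j, t i j ^ (∑ x, if π x = (i, j) then m x else 0) := by
  classical
  have key : ∀ s : Finset X, ∏ x ∈ s, t (π x).1 (π x).2 ^ m x = ∏ i, ∏ j, t i j ^ (∑ x ∈ s, if π x = (i, j) then m x else 0) := by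
    intro s
    induction s using Finset.cons_induction with
    | empty => simp
    | cons a s ha ih => 
      simp only [Finset.prod_cons, Finset.sum_cons, zpow_add, ih, Finset.prod_mul_distrib]
      congr 1
      rw [Finset.prod_eq_single (π a).1, Finset.prod_eq_single (π a).2]
      · simp
      · intro b _ hb
        rw [if_neg, zpow_zero]
        intro h; apply hb; rw [h]
      · simp
      · intro b _ hb
        apply Finset.prod_eq_one
        intro j _
        rw [if_neg, zpow_zero]
        intro h; apply hb; rw [h]
      · simp
  exact key _

theorem fiber_sum {X Y K : Type} [Fintype X] [Fintype Y] [DecidableEq Y] [Fintype K] [DecidableEq K] (π : X → Y × K)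
    (m : X → ℤ) :
    ∑ i, ∑ j, (∑ x, if π x = (i, j) then m x else 0) = ∑ x, m x := by
  rw [← Fintype.sum_prod_type' (f := fun i j => ∑ x, if π x = (i, j) then m x else 0)]
  rw [Finset.sum_comm]
  simp

theorem Psi_diag (a : J₁ → Lˣ) (b : J₂ → Lˣ) (m : Cc × J₁ × J₂ →₀ ℕ) :
    Psi (F := F) Cc 1 (Matrix.diagonal fun i => (a i : L)) (Matrix.diagonal fun i => (b i : L)) (monomial m 1) =
      ((∏ x, ((a x.2.1)⁻¹ * b x.2.2) ^ (m x : ℤ) : Lˣ) : L) • monomial m 1 := by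
  have hinv : (Matrix.diagonal fun i => (a i : L))⁻¹ = Matrix.diagonal fun i => ((a i)⁻¹ : Lˣ).1 := by
    apply Matrix.inv_eq_right_inv
    rw [Matrix.diagonal_mul_diagonal]; simp
  have hX : ∀ x, Psi (F := F) Cc 1 (Matrix.diagonal fun i => (a i : L)) (Matrix.diagonal fun i => (b i : L)) (X x) =
     C (((a x.2.1)⁻¹ * b x.2.2 : Lˣ) : L) * X x := by
    intro x
    unfold Psi
    rw [hinv]
    simp only [semiHom, eval₂Hom_X']
    rw [Finset.sum_eq_single x]
    · simp [TT]
    · intro y _ hy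
      have : TT Cc (Matrix.diagonal fun i => ((a i)⁻¹ : Lˣ).1) (Matrix.diagonal fun i => (b i : L)) y x = 0 := by
        simp only [TT, Matrix.diagonal_apply]
        by_cases h1 : y.1 = x.1
        · by_cases h2 : x.2.1 = y.2.1
          · by_cases h3 : y.2.2 = x.2.2
            · exact absurd (Prod.ext h1 (Prod.ext h2.symm h3)) hy
            · simp [h3]
          · simp [h2]
        · simp [h1]
      rw [this]; simp
    · simp
  rw [MvPolynomial.monomial_eq, map_mul, Psi_C, Finsupp.prod_fintype _ _ (by simp), map_prod]
  simp only [map_pow, hX, mul_pow, Finset.prod_mul_distrib, smul_eq_C_mul]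
  simp
end Acts

section Sides
open Module MvPolynomial
variable {F L D I : Type} {d : ℕ} [Field F] [Field L] [Algebra F L] [DivisionRing D]
    [Algebra F D] [Fintype I] [DecidableEq I] [MulAction (L ≃ₐ[F] L) I]
variable {κ : Type} [Fintype κ] [DecidableEq κ]
variable {Cc J : Type} [Fintype Cc] [DecidableEq Cc] [Fintype J] [DecidableEq J]

/-- right action -/
noncomputable def TwAct.right (Cc : Type) [Fintype Cc] [DecidableEq Cc] (S : SplitData F L D I d) (κ : Type) [Fintype κ] [DecidableEq κ]
    (A : (L ≃ₐ[F] L) → Matrix J J L) (hA : ∀ g, IsUnit (A g)) (hA1 : A 1 = 1)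
    (hAm : ∀ g h, A g * (A h).map g = A (g * h)) (t : ℕ) : 
    TwAct S κ (HV Cc J (I × κ × Fin d) L t) where
  ρ g P := actH Cc t g (A g) (S.E g P)
  smul g P c m := actH_smul _ _ _ _ _ _
  one m := by rw [hA1, S.E_one, actH_one]
  mul g h P P' m _ _ := by rw [actH_actH _ _ _ _ _ (hA h), hAm, S.E_mul]

/-- left action -/
noncomputable def TwAct.left (Cc : Type) [Fintype Cc] [DecidableEq Cc] (S : SplitData F L D I d) (κ : Type) [Fintype κ] [DecidableEq κ]
    (B : (L ≃ₐ[F] L) → Matrix J J L) (hB1 : B 1 = 1)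
    (hBm : ∀ g h, B g * (B h).map g = B (g * h)) (t : ℕ) : 
    TwAct S κ (HV Cc (I × κ × Fin d) J L t) where
  ρ g P := actH Cc t g (S.E g P) (B g)
  smul g P c m := actH_smul _ _ _ _ _ _
  one m := by rw [hB1, S.E_one, actH_one]
  mul g h P P' m _ hP' := by rw [actH_actH _ _ _ _ _ (S.E_unit h P' hP'), hBm, S.E_mul]

theorem HV_basis (Cc J₁ J₂ L : Type) [Field L] [Fintype Cc] [Fintype J₁] [DecidableEq J₁] [Fintype J₂] (t : ℕ) :
    ∃ b : Basis (Σ _ : J₁, {m : Cc × J₁ × J₂ →₀ ℕ | m.degree = t}) L (HV Cc J₁ J₂ L t),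
      ∀ a k, (b a k).1 = if k = a.1 then monomial a.2.1 1 else 0 := by
  obtain ⟨b, hb⟩ := homB_exists (Cc × J₁ × J₂) L t
  refine ⟨Pi.basis (fun _ => b), ?_⟩
  intro a k
  rw [Pi.basis_apply]
  by_cases h : k = a.1
  · subst h; simp [hb]
  · simp [h]

theorem deg_sum {X : Type} [Fintype X] {t : ℕ} (m : {m : X →₀ ℕ | m.degree = t}) : ∑ x, (m.1 x : ℤ) = t := by
  have := m.2
  rw [Set.mem_setOf_eq, Finsupp.degree_eq_sum] at this
  exact_mod_cast this

theorem actH_diag {J₁ J₂ : Type} [Fintype J₁] [DecidableEq J₁] [Fintype J₂] [DecidableEq J₂] (t : ℕ)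
    (u : J₁ → Lˣ) (w : J₂ → Lˣ) (v : HV Cc J₁ J₂ L t) (i : J₁) (m : Cc × J₁ × J₂ →₀ ℕ) 
    (hv : ∀ k, (v k).1 = if k = i then monomial m 1 else 0) :
    actH (F := F) Cc t 1 (Matrix.diagonal fun i => (u i : L)) (Matrix.diagonal fun i => (w i : L)) v =
      ((u i * ∏ x, ((u x.2.1)⁻¹ * w x.2.2) ^ (m x : ℤ) : Lˣ) : L) • v := by
  funext k
  ext1
  change ∑ l, _ * Psi _ _ _ _ (v l).1 = _ • (v k).1
  simp only [hv]
  rw [Finset.sum_eq_single k]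
  · rw [Matrix.diagonal_apply_eq]
    by_cases h : k = i
    · simp only [h, if_true]
      rw [Psi_diag, Units.val_mul, mul_smul, smul_eq_C_mul, smul_eq_C_mul]
    · simp [h]
  · intro l _ hl
    rw [Matrix.diagonal_apply_ne _ hl.symm]; simp
  · simp

variable [FiniteDimensional F L] [IsGalois F L] [FiniteDimensional F D] [Infinite L]

theorem right_dvd (S : SplitData F L D I d) (s : ℕ)
    (A : (L ≃ₐ[F] L) → Matrix J J L) (hA : ∀ g, IsUnit (A g)) (hA1 : A 1 = 1)
    (hAm : ∀ g h, A g * (A h).map g = A (g * h)) (t : ℕ) (W : Submodule L (HV Cc J (I × (Fin s × Fin d) × Fin d) L t))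
    (hW : ∀ g P, (∀ i, IsUnit (P i)) → ∀ m ∈ W, actH Cc t g (A g) (S.E g P) m ∈ W)
    (p : ℕ) [hp : Fact p.Prime] (hpt : ¬ (p : ℤ) ∣ t) :
    p ^ padicValNat p (d * Fintype.card I) * p ^ padicValNat p (Fintype.card (Fin s × Fin d)) ∣ finrank L W := by
  classical
  obtain ⟨Hn, h1, h2, h3⟩ := S.honest s
  have := degree_finite (Cc × J × (I × (Fin s × Fin d) × Fin d)) t
  letI := Fintype.ofFinite {m : Cc × J × (I × (Fin s × Fin d) × Fin d) →₀ ℕ | m.degree = t}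
  obtain ⟨b, hb⟩ := HV_basis Cc J (I × (Fin s × Fin d) × Fin d) L t
  have : FiniteDimensional L (HV Cc J (I × (Fin s × Fin d) × Fin d) L t) := b.finiteDimensional_of_finite
  apply (TwAct.right Cc S (Fin s × Fin d) A hA hA1 hAm t).main Hn h1 h2 h3 b
    (fun a i j => ∑ x : Cc × J × (I × (Fin s × Fin d) × Fin d), if (x.2.2.1, x.2.2.2.1) = (i, j) then (a.2.1 x : ℤ) else 0) 
    _ t _ W hW p hpt
  · intro a u
    change actH Cc t 1 (A 1) (S.E 1 _) _ = _
    rw [hA1, S.E_diag]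
    have e : (1 : Matrix J J L) = Matrix.diagonal (fun i => ((1 : J → Lˣ) i : L)) := by
      ext i j; simp [Matrix.one_apply, Matrix.diagonal_apply]
    rw [e, actH_diag (F := F) t 1 (fun x : I × (Fin s × Fin d) × Fin d => u x.1 x.2.1) (b a) a.1 a.2.1 (hb a)]
    congr 2
    rw [← fiber_prod (fun x : Cc × J × (I × (Fin s × Fin d) × Fin d) => (x.2.2.1, x.2.2.2.1))]
    simp
  · intro a
    rw [fiber_sum (fun x : Cc × J × (I × (Fin s × Fin d) × Fin d) => (x.2.2.1, x.2.2.2.1)), deg_sum]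

theorem left_dvd (S : SplitData F L D I d) (s : ℕ)
    (B : (L ≃ₐ[F] L) → Matrix J J L) (hB1 : B 1 = 1)
    (hBm : ∀ g h, B g * (B h).map g = B (g * h)) (t : ℕ) (W : Submodule L (HV Cc (I × (Fin s × Fin d) × Fin d) J L t))
    (hW : ∀ g P, (∀ i, IsUnit (P i)) → ∀ m ∈ W, actH Cc t g (S.E g P) (B g) m ∈ W)
    (p : ℕ) [hp : Fact p.Prime] (hpt : ¬ (p : ℤ) ∣ 1 - t) :
    p ^ padicValNat p (d * Fintype.card I) * p ^ padicValNat p (Fintype.card (Fin s × Fin d)) ∣ finrank L W := by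
  classical
  obtain ⟨Hn, h1, h2, h3⟩ := S.honest s
  have := degree_finite (Cc × (I × (Fin s × Fin d) × Fin d) × J) t
  letI := Fintype.ofFinite {m : Cc × (I × (Fin s × Fin d) × Fin d) × J →₀ ℕ | m.degree = t}
  obtain ⟨b, hb⟩ := HV_basis Cc (I × (Fin s × Fin d) × Fin d) J L t
  have : FiniteDimensional L (HV Cc (I × (Fin s × Fin d) × Fin d) J L t) := b.finiteDimensional_of_finite
  let π : (I × (Fin s × Fin d) × Fin d) → Option (Cc × (I × (Fin s × Fin d) × Fin d) × J) → I × (Fin s × Fin d) := fun i o =>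
    o.elim (i.1, i.2.1) (fun x => (x.2.1.1, x.2.1.2.1))
  let ν : (Cc × (I × (Fin s × Fin d) × Fin d) × J →₀ ℕ) → Option (Cc × (I × (Fin s × Fin d) × Fin d) × J) → ℤ := fun m o =>
    o.elim 1 (fun x => - (m x : ℤ))
  apply (TwAct.left Cc S (Fin s × Fin d) B hB1 hBm t).main Hn h1 h2 h3 b
    (fun a i j => ∑ x, if π a.1 x = (i, j) then ν a.2.1 x else 0) 
    _ (1 - t) _ W hW p hpt
  · intro a u
    change actH Cc t 1 (S.E 1 _) (B 1) _ = _
    rw [hB1, S.E_diag]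
    have e : (1 : Matrix J J L) = Matrix.diagonal (fun i => ((1 : J → Lˣ) i : L)) := by
      ext i j; simp [Matrix.one_apply, Matrix.diagonal_apply]
    rw [e, actH_diag (F := F) t (fun x : I × (Fin s × Fin d) × Fin d => u x.1 x.2.1) 1 (b a) a.1 a.2.1 (hb a)]
    congr 2
    rw [← fiber_prod (π a.1), Fintype.prod_option]
    simp [π, ν]
  · intro a
    rw [fiber_sum (π a.1), Fintype.sum_option]
    simp only [ν, Option.elim, Finset.sum_neg_distrib]
    rw [deg_sum]; ring

/-- combination of both sides -/
theorem both_dvd {D' I' : Type} {d' : ℕ} [DivisionRing D'] [Algebra F D'] [Fintype I'] [DecidableEq I']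
    [MulAction (L ≃ₐ[F] L) I'] [FiniteDimensional F D']
    (S : SplitData F L D I d) (S' : SplitData F L D' I' d') (s s' N : ℕ) (hN : N ≠ 0)
    (hs : Fintype.card (I × (Fin s × Fin d) × Fin d) = N) (hs' : Fintype.card (I' × (Fin s' × Fin d') × Fin d') = N)
    (t : ℕ) (W : Submodule L (HV Cc (I × (Fin s × Fin d) × Fin d) (I' × (Fin s' × Fin d') × Fin d') L t))
    (hW : ∀ g P P', (∀ i, IsUnit (P i)) → (∀ i, IsUnit (P' i)) → ∀ m ∈ W, actH Cc t g (S.E g P) (S'.E g P') m ∈ W) :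
    N ∣ finrank L W := by
  obtain ⟨Hn, h1, h2, h3⟩ := S.honest s
  obtain ⟨Hn', h1', h2', h3'⟩ := S'.honest s'
  rw [Nat.dvd_iff_prime_pow_dvd_dvd]
  intro p k hp hk
  haveI : Fact p.Prime := ⟨hp⟩
  have hk' : k ≤ padicValNat p N := (padicValNat_dvd_iff_le hN).1 hk
  apply (pow_dvd_pow p hk').trans
  by_cases hpt : (p : ℤ) ∣ t
  · have hpt' : ¬ (p : ℤ) ∣ 1 - t := by
      intro h
      have : (p : ℤ) ∣ 1 := by simpa using dvd_add h hpt
      exact hp.one_lt.ne' (by exact_mod_cast Int.eq_one_of_dvd_one (by positivity) this)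
    have := left_dvd S s (fun g => S'.E g (Hn' g)) 
      (by change S'.E 1 (Hn' 1) = 1; rw [show Hn' 1 = 1 from funext h2', S'.E_one]) (by
        intro g h; rw [S'.E_mul]; simp only [h3']) t W (fun g P hP m hm => hW g P _ hP (h1' g) m hm) p hpt'
    rw [← pow_add] at this
    have e : N = (d * Fintype.card I) * Fintype.card (Fin s × Fin d) := by
      rw [← hs]; simp only [Fintype.card_prod, Fintype.card_fin]; ring
    rw [e] at hN
    rw [e, padicValNat.mul (left_ne_zero_of_mul hN) (right_ne_zero_of_mul hN)]
    exact this
  · have := right_dvd S' s' (fun g => S.E g (Hn g)) (fun g => S.E_unit g _ (h1 g))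
      (by change S.E 1 (Hn 1) = 1; rw [show Hn 1 = 1 from funext h2, S.E_one]) (by
        intro g h; rw [S.E_mul]; simp only [h3]) t W (fun g P hP m hm => hW g _ P (h1 g) hP m hm) p hpt
    rw [← pow_add] at this
    have e : N = (d' * Fintype.card I') * Fintype.card (Fin s' × Fin d') := by
      rw [← hs']; simp only [Fintype.card_prod, Fintype.card_fin]; ring
    rw [e] at hN
    rw [e, padicValNat.mul (left_ne_zero_of_mul hN) (right_ne_zero_of_mul hN)]
    exact this

end Sides

section Hilb
open Module

/-- counting function of a set of exponents -/
noncomputable def hcount {M : ℕ} (U : Set (Fin M → ℕ)) (t : ℕ) : ℕ := {m | m ∈ U ∧ ∑ i, m i = t}.ncard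

/-- generating series -/
noncomputable def hser {M : ℕ} (U : Set (Fin M → ℕ)) : PowerSeries ℤ := PowerSeries.mk fun t => (hcount U t : ℤ)

theorem hset_finite {M : ℕ} (U : Set (Fin M → ℕ)) (t : ℕ) : {m | m ∈ U ∧ ∑ i, m i = t}.Finite := by
  apply Set.Finite.subset (Set.finite_Iic (fun _ : Fin M => t))
  rintro m ⟨-, hm⟩ i
  rw [← hm]
  exact Finset.single_le_sum (f := m) (fun _ _ => Nat.zero_le _) (Finset.mem_univ i)

theorem hcount_succ {M : ℕ} (U : Set (Fin (M + 1) → ℕ)) (t : ℕ) :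
    hcount U (t + 1) = hcount {m | (Fin.cons 0 m : Fin (M + 1) → ℕ) ∈ U} (t + 1) + 
      hcount {m : Fin (M + 1) → ℕ | (Fin.cons (m 0 + 1) (Fin.tail m) : Fin (M + 1) → ℕ) ∈ U} t := by
  unfold hcount
  have i1 : Function.Injective (fun m : Fin M → ℕ => (Fin.cons 0 m : Fin (M + 1) → ℕ)) := Fin.cons_right_injective (α := fun _ => ℕ) 0
  have i2 : Function.Injective (fun m : Fin (M + 1) → ℕ => (Fin.cons (m 0 + 1) (Fin.tail m) : Fin (M + 1) → ℕ)) := by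
    intro m m' h
    have h0 := congrFun h 0
    have h1 := congrArg Fin.tail h
    simp at h0 h1
    rw [← Fin.cons_self_tail m, ← Fin.cons_self_tail m', h0, h1]
  rw [← Set.ncard_image_of_injective {m | m ∈ {m : Fin M → ℕ | (Fin.cons 0 m : Fin (M + 1) → ℕ) ∈ U} ∧ ∑ i, m i = t + 1} i1,
    ← Set.ncard_image_of_injective {m | m ∈ {m : Fin (M + 1) → ℕ | (Fin.cons (m 0 + 1) (Fin.tail m) : Fin (M + 1) → ℕ) ∈ U} ∧ ∑ i, m i = t} i2]
  rw [← Set.ncard_union_eq _ ((hset_finite _ _).image _) ((hset_finite _ _).image _)]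
  · congr 1
    ext m
    constructor
    · rintro ⟨hm, hs⟩
      rw [Fin.sum_univ_succ] at hs
      rcases Nat.eq_zero_or_pos (m 0) with h0 | h0
      · left
        refine ⟨Fin.tail m, ⟨?_, ?_⟩, ?_⟩
        · change Fin.cons 0 (Fin.tail m) ∈ U
          rw [← h0, Fin.cons_self_tail]; exact hm
        · rw [h0, zero_add] at hs; exact hs
        · change Fin.cons 0 (Fin.tail m) = m
          rw [← h0, Fin.cons_self_tail]
      · right
        have e : (Fin.cons (m 0 - 1 + 1) (Fin.tail m) : Fin (M + 1) → ℕ) = m := by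
          rw [Nat.sub_add_cancel h0, Fin.cons_self_tail]
        refine ⟨Fin.cons (m 0 - 1) (Fin.tail m), ⟨?_, ?_⟩, ?_⟩
        · simpa [e] using hm
        · rw [Fin.sum_univ_succ]
          simp only [Fin.cons_zero, Fin.cons_succ, Fin.tail]
          omega
        · simpa using e
    · rintro (⟨m, ⟨hm, hs⟩, rfl⟩ | ⟨m, ⟨hm, hs⟩, rfl⟩)
      · exact ⟨hm, by simpa [Fin.sum_univ_succ] using hs⟩
      · refine ⟨hm, ?_⟩
        rw [Fin.sum_univ_succ] at hs ⊢
        simp only [Fin.cons_zero, Fin.cons_succ, Fin.tail]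
        omega
  · rw [Set.disjoint_left]
    rintro _ ⟨m, _, rfl⟩ ⟨m', _, h⟩
    have := congrFun h 0
    simp at this

theorem hcount_zero {M : ℕ} (U : Set (Fin (M + 1) → ℕ)) :
    hcount U 0 = hcount {m | (Fin.cons 0 m : Fin (M + 1) → ℕ) ∈ U} 0 := by
  unfold hcount
  have i1 : Function.Injective (fun m : Fin M → ℕ => (Fin.cons 0 m : Fin (M + 1) → ℕ)) := Fin.cons_right_injective (α := fun _ => ℕ) 0
  rw [← Set.ncard_image_of_injective _ i1]
  congr 1
  ext m
  constructor
  · rintro ⟨hm, hs⟩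
    rw [Fin.sum_univ_succ] at hs
    have h0 : m 0 = 0 := by omega
    refine ⟨Fin.tail m, ⟨?_, ?_⟩, ?_⟩
    · change Fin.cons 0 (Fin.tail m) ∈ U
      rw [← h0, Fin.cons_self_tail]; exact hm
    · rw [h0, zero_add] at hs; exact hs
    · change Fin.cons 0 (Fin.tail m) = m
      rw [← h0, Fin.cons_self_tail]
  · rintro ⟨m, ⟨hm, hs⟩, rfl⟩
    exact ⟨hm, by simpa [Fin.sum_univ_succ] using hs⟩

theorem hser_rec {M : ℕ} (U : Set (Fin (M + 1) → ℕ)) :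
    hser U = hser {m | (Fin.cons 0 m : Fin (M + 1) → ℕ) ∈ U} + PowerSeries.X * 
      hser {m : Fin (M + 1) → ℕ | (Fin.cons (m 0 + 1) (Fin.tail m) : Fin (M + 1) → ℕ) ∈ U} := by
  ext t
  cases t with
  | zero => simp [hser, hcount_zero U]
  | succ t =>
    rw [map_add, PowerSeries.coeff_succ_X_mul]
    simp only [hser, PowerSeries.coeff_mk]
    rw [hcount_succ U]; simp

theorem chain_stab {M : ℕ} (U : ℕ → Set (Fin M → ℕ)) (hmono : Monotone U) (hup : ∀ k, IsUpperSet (U k)) :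
    ∃ k0, ∀ k, k0 ≤ k → U k = U k0 := by
  let V : Set (Fin M → ℕ) := ⋃ k, U k
  have hfin : {m | Minimal (· ∈ V) m}.Finite := by
    have hpwo : ({m | Minimal (· ∈ V) m} : Set (Fin M → ℕ)).IsPWO := Set.isPWO_of_wellQuasiOrderedLE _
    exact (setOf_minimal_antichain (· ∈ V)).finite_of_partiallyWellOrderedOn hpwo
  have hex : ∀ m, ∃ k, Minimal (· ∈ V) m → m ∈ U k := by
    intro m
    by_cases h : Minimal (· ∈ V) m
    · obtain ⟨k, hk⟩ := Set.mem_iUnion.1 h.1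
      exact ⟨k, fun _ => hk⟩
    · exact ⟨0, fun h' => absurd h' h⟩
  choose κ hκ using hex
  obtain ⟨k0, hk0⟩ := (hfin.image κ).bddAbove
  refine ⟨k0, fun k hk => ?_⟩
  apply Set.Subset.antisymm _ (hmono hk)
  intro m hm
  have hmV : m ∈ V := Set.mem_iUnion.2 ⟨k, hm⟩
  obtain ⟨n, hnm, hn⟩ := exists_minimal_le_of_wellFoundedLT (· ∈ V) m hmV
  exact hup k0 hnm (hmono (hk0 ⟨n, hn, rfl⟩) (hκ n hn))

theorem hser_poly (M : ℕ) : ∀ U : Set (Fin M → ℕ), IsUpperSet U → 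
    ∃ Q : Polynomial ℤ, hser U * (1 - PowerSeries.X) ^ M = (Q : PowerSeries ℤ) ∧ (U.Nonempty → Q.eval 1 = 1) ∧
      (U = ∅ → Q = 0) := by
  have hempty : ∀ M (U : Set (Fin M → ℕ)), U = ∅ → hser U = 0 := by
    rintro M U rfl
    ext t
    simp [hser, hcount]
  induction M with
  | zero =>
    intro U _
    rcases U.eq_empty_or_nonempty with h | ⟨m, hm⟩
    · exact ⟨0, by simp [hempty _ _ h], fun h' => absurd h h'.ne_empty, fun _ => rfl⟩
    · refine ⟨1, ?_, by simp, fun h => by rw [h] at hm; exact absurd hm (by simp)⟩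
      ext t
      simp only [pow_zero, mul_one, hser, PowerSeries.coeff_mk, Polynomial.coe_one, PowerSeries.coeff_one, hcount]
      by_cases ht : t = 0
      · subst ht
        have : {m : Fin 0 → ℕ | m ∈ U ∧ ∑ i, m i = 0} = {m} := by
          ext m'
          have := Subsingleton.elim m m'
          subst this
          simp [hm]
        rw [this]; simp
      · have : {m : Fin 0 → ℕ | m ∈ U ∧ ∑ i, m i = t} = ∅ := by
          ext m'
          simp [eq_comm, ht]
        rw [this]; simp [ht]
  | succ M ih =>
    have key : ∀ (k0 : ℕ) (U : Set (Fin (M + 1) → ℕ)), IsUpperSet U → 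
        (∀ k, k0 ≤ k → {m : Fin M → ℕ | (Fin.cons k m : Fin (M + 1) → ℕ) ∈ U} = {m | (Fin.cons k0 m : Fin (M + 1) → ℕ) ∈ U}) →
        ∃ Q : Polynomial ℤ, hser U * (1 - PowerSeries.X) ^ (M + 1) = (Q : PowerSeries ℤ) ∧ (U.Nonempty → Q.eval 1 = 1) := by
      have hup0 : ∀ U : Set (Fin (M + 1) → ℕ), IsUpperSet U → IsUpperSet {m : Fin M → ℕ | (Fin.cons 0 m : Fin (M + 1) → ℕ) ∈ U} := by
        intro U hU a b hab ha
        exact hU (Fin.cons_le_cons.2 ⟨le_rfl, hab⟩) ha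
      intro k0
      induction k0 with
      | zero =>
        intro U hU hst
        obtain ⟨Q, hQ, hQ1, -⟩ := ih _ (hup0 U hU)
        have e : {m : Fin (M + 1) → ℕ | (Fin.cons (m 0 + 1) (Fin.tail m) : Fin (M + 1) → ℕ) ∈ U} = U := by
          ext m
          have h1 := Set.ext_iff.1 (hst (m 0 + 1) (Nat.zero_le _)) (Fin.tail m)
          have h2 := Set.ext_iff.1 (hst (m 0) (Nat.zero_le _)) (Fin.tail m)
          simp only [Set.mem_setOf_eq, Fin.cons_self_tail] at h1 h2 ⊢
          rw [h1, h2]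
        have h := hser_rec U
        rw [e] at h
        refine ⟨Q, ?_, ?_⟩
        · rw [← hQ]
          have : hser U * (1 - PowerSeries.X) = hser {m | (Fin.cons 0 m : Fin (M + 1) → ℕ) ∈ U} := by
            linear_combination h
          rw [← this]; ring
        · rintro ⟨m, hm⟩
          apply hQ1
          have h2 := Set.ext_iff.1 (hst (m 0) (Nat.zero_le _)) (Fin.tail m)
          simp only [Set.mem_setOf_eq, Fin.cons_self_tail] at h2
          exact ⟨_, h2.1 hm⟩
      | succ k0 ihk =>
        intro U hU hst
        obtain ⟨Q, hQ, -, -⟩ := ih _ (hup0 U hU)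
        obtain ⟨Q', hQ', hQ1'⟩ := ihk {m : Fin (M + 1) → ℕ | (Fin.cons (m 0 + 1) (Fin.tail m) : Fin (M + 1) → ℕ) ∈ U} (by
          intro a b hab ha
          refine hU (Fin.cons_le_cons.2 ⟨?_, ?_⟩) ha
          · exact Nat.add_le_add_right (hab 0) 1
          · intro i; exact hab _) (by
          intro k hk
          simpa using hst (k + 1) (by omega))
        refine ⟨(1 - Polynomial.X) * Q + Polynomial.X * Q', ?_, ?_⟩
        · rw [hser_rec U]
          push_cast
          rw [← hQ, ← hQ']
          ring
        · rintro ⟨m, hm⟩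
          simp only [Polynomial.eval_add, Polynomial.eval_mul, Polynomial.eval_sub, Polynomial.eval_one, Polynomial.eval_X]
          rw [hQ1']
          · ring
          · refine ⟨m, ?_⟩
            refine hU ?_ hm
            conv_lhs => rw [← Fin.cons_self_tail m]
            exact Fin.cons_le_cons.2 ⟨Nat.le_succ _, le_rfl⟩
    intro U hU
    rcases U.eq_empty_or_nonempty with h | hne
    · exact ⟨0, by simp [hempty _ _ h], fun h' => absurd h h'.ne_empty, fun _ => rfl⟩
    obtain ⟨k0, hk0⟩ := chain_stab (fun k => {m : Fin M → ℕ | (Fin.cons k m : Fin (M + 1) → ℕ) ∈ U}) (by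
      intro k k' hk m hm
      exact hU (Fin.cons_le_cons.2 ⟨hk, le_rfl⟩) hm) (by
      intro k a b hab ha
      exact hU (Fin.cons_le_cons.2 ⟨le_rfl, hab⟩) ha)
    obtain ⟨Q, h1, h2⟩ := key k0 U hU hk0
    exact ⟨Q, h1, h2, fun h => absurd h hne.ne_empty⟩

/-- The arithmetic consequence. -/
theorem hcount_dvd {M : ℕ} {J : Type} [Fintype J] (U : J → Set (Fin M → ℕ)) (hU : ∀ j, IsUpperSet (U j)) (q : ℕ)
    (hq : ∀ t, q ∣ ∑ j, hcount (U j) t) : q ∣ {j | (U j).Nonempty}.ncard := by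
  classical
  choose Q h1 h2 h3 using fun j => hser_poly M (U j) (hU j)
  have hsum : (∑ j, hser (U j)) * (1 - PowerSeries.X) ^ M = ((∑ j, Q j : Polynomial ℤ) : PowerSeries ℤ) := by
    rw [Finset.sum_mul, ← Polynomial.coeToPowerSeries.ringHom_apply, map_sum]
    exact Finset.sum_congr rfl fun j _ => h1 j
  have hd : ∃ R : PowerSeries ℤ, ∑ j, hser (U j) = PowerSeries.C (q : ℤ) * R := by
    choose r hr using hq
    refine ⟨PowerSeries.mk fun t => (r t : ℤ), ?_⟩
    ext t
    rw [map_sum]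
    simp only [hser, PowerSeries.coeff_mk, PowerSeries.coeff_C_mul]
    exact_mod_cast hr t
  obtain ⟨R, hR⟩ := hd
  have hco : ∀ n, (q : ℤ) ∣ (∑ j, Q j).coeff n := by
    intro n
    rw [← Polynomial.coeff_coe, ← hsum, hR, mul_assoc, PowerSeries.coeff_C_mul]
    exact dvd_mul_right _ _
  have hev : (q : ℤ) ∣ (∑ j, Q j).eval 1 := by
    rw [Polynomial.eval_eq_sum]
    apply Finset.dvd_sum
    intro n _
    exact (hco n).mul_right _
  have : (∑ j, Q j).eval 1 = ({j | (U j).Nonempty}.ncard : ℤ) := by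
    rw [Polynomial.eval_finset_sum, Set.ncard_eq_toFinset_card', Finset.cast_card]
    simp only [Set.toFinset_setOf, Finset.sum_filter]
    refine Finset.sum_congr rfl fun j _ => ?_
    split_ifs with h
    · exact h2 j h
    · rw [h3 j (Set.not_nonempty_iff_eq_empty.1 h)]; simp
  rw [this] at hev
  exact_mod_cast hev

end Hilb

section Lead
open Module MvPolynomial

theorem lead_card {ι K : Type} [Fintype ι] [LinearOrder ι] [Field K] (V : Submodule K (ι → K)) :
    finrank K V = {i | ∃ v ∈ V, v i ≠ 0 ∧ ∀ j < i, v j = 0}.ncard := by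
  classical
  set Λ : Set ι := {i | ∃ v ∈ V, v i ≠ 0 ∧ ∀ j < i, v j = 0} with hΛ
  rw [← Nat.card_coe_set_eq, Nat.card_eq_fintype_card]
  apply le_antisymm
  · let r : V →ₗ[K] (Λ → K) := (LinearMap.funLeft K K (Subtype.val : Λ → ι)) ∘ₗ V.subtype
    have hr : Function.Injective r := by
      rw [← LinearMap.ker_eq_bot, LinearMap.ker_eq_bot']
      rintro ⟨v, hv⟩ h0
      by_contra hne
      have hne' : (Finset.univ.filter fun i => v i ≠ 0).Nonempty := by
        by_contra hh
        apply hne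
        ext i
        by_contra hi
        exact hh ⟨i, by simpa using hi⟩
      obtain ⟨i, hi, hmin⟩ := Finset.exists_min_image _ id hne'
      have hiv : v i ≠ 0 := by simpa using hi
      have hΛi : i ∈ Λ := ⟨v, hv, hiv, fun j hj => by
        by_contra hjv
        exact absurd (hmin j (by simpa using hjv)) (not_le.mpr hj)⟩
      exact hiv (congrFun h0 ⟨i, hΛi⟩)
    have := LinearMap.finrank_le_finrank_of_injective hr
    simpa using this
  · have hch : ∀ i : Λ, ∃ v ∈ V, v i.1 ≠ 0 ∧ ∀ j < i.1, v j = 0 := fun i => i.2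
    choose w hwV hw0 hwl using hch
    have hli : LinearIndependent K (fun i : Λ => (⟨w i, hwV i⟩ : V)) := by
      rw [Fintype.linearIndependent_iff]
      intro c hc
      have hc' : ∑ i, c i • w i = 0 := by
        have := congrArg (V.subtype) hc
        simpa [map_sum] using this
      by_contra hcon
      push Not at hcon
      have hne' : (Finset.univ.filter fun i => c i ≠ 0).Nonempty := by
        obtain ⟨i, hi⟩ := hcon
        exact ⟨i, by simpa using hi⟩
      obtain ⟨i, hi, hmin⟩ := Finset.exists_min_image _ id hne'
      have hiv : c i ≠ 0 := by simpa using hi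
      have := congrFun hc' i.1
      rw [Finset.sum_apply, Finset.sum_eq_single i] at this
      · simp [hiv, hw0 i] at this
      · intro j _ hji
        by_cases hcj : c j = 0
        · simp [hcj]
        · have h1 : i ≤ j := hmin j (by simpa using hcj)
          have h2 : i.1 < j.1 := lt_of_le_of_ne h1 (fun h => hji (Subtype.ext h.symm))
          simp [hwl j i.1 h2]
      · simp
    exact hli.fintype_card_le_finrank

variable {σ J L 𝓛 : Type} [Fintype σ] [Fintype J] [LinearOrder J] [Field L] [Field 𝓛] [Algebra (MvPolynomial σ L) 𝓛]

/-- leading exponents in position `j` -/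
def leadU (mo : MonomialOrder σ) (Q : Submodule 𝓛 (J → 𝓛)) (j : J) : Set (σ →₀ ℕ) :=
  {m | ∃ v : J → MvPolynomial σ L, (∀ i, (v i).IsHomogeneous m.degree) ∧ (fun i => algebraMap (MvPolynomial σ L) 𝓛 (v i)) ∈ Q ∧
    coeff m (v j) ≠ 0 ∧ (∀ j' < j, v j' = 0) ∧ ∀ m', mo.toSyn m' < mo.toSyn m → coeff m' (v j) = 0}

theorem leadU_upper (mo : MonomialOrder σ) (Q : Submodule 𝓛 (J → 𝓛)) (j : J) {m m' : σ →₀ ℕ} (h : m ≤ m') 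
    (hm : m ∈ leadU (L := L) mo Q j) : m' ∈ leadU (L := L) mo Q j := by
  classical
  obtain ⟨c, rfl⟩ := exists_add_of_le h
  obtain ⟨v, h1, h2, h3, h4, h5⟩ := hm
  refine ⟨fun i => monomial c 1 * v i, ?_, ?_, ?_, ?_, ?_⟩
  · intro i
    rw [add_comm m c, map_add]
    exact (isHomogeneous_monomial _ rfl).mul (h1 i)
  · have := Q.smul_mem (algebraMap (MvPolynomial σ L) 𝓛 (monomial c 1)) h2
    convert this using 1
    ext i
    simp
  · rw [add_comm m c, coeff_monomial_mul, one_mul]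
    exact h3
  · intro j' hj'
    simp [h4 j' hj']
  · intro m' hm'
    simp only
    rw [coeff_monomial_mul']
    split_ifs with hcm
    · obtain ⟨k, rfl⟩ := exists_add_of_le hcm
      rw [add_tsub_cancel_left, one_mul]
      apply h5
      rw [add_comm m c, map_add, map_add] at hm'
      exact lt_of_add_lt_add_left hm'
    · rfl

theorem lead_Q [IsFractionRing (MvPolynomial σ L) 𝓛] (mo : MonomialOrder σ) (Q : Submodule 𝓛 (J → 𝓛))
    (hgr : ∀ v : J → MvPolynomial σ L, (fun i => algebraMap _ 𝓛 (v i)) ∈ Q → ∀ t, 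
      (fun i => algebraMap _ 𝓛 (homogeneousComponent t (v i))) ∈ Q) :
    finrank 𝓛 Q = {j | (leadU (L := L) mo Q j).Nonempty}.ncard := by
  classical
  rw [lead_card]
  congr 1
  ext j
  constructor
  · rintro ⟨v, hv, hvj, hvl⟩
    obtain ⟨b, hb⟩ := IsLocalization.exist_integer_multiples_of_finite (nonZeroDivisors (MvPolynomial σ L)) v
    choose w hw using hb
    have inj : Function.Injective (algebraMap (MvPolynomial σ L) 𝓛) := IsFractionRing.injective _ _
    have hwQ : (fun i => algebraMap _ 𝓛 (w i)) ∈ Q := by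
      have := Q.smul_mem (algebraMap (MvPolynomial σ L) 𝓛 b) hv
      convert this using 1
      ext i
      rw [hw]; simp [Algebra.smul_def]
    have hb0 : algebraMap (MvPolynomial σ L) 𝓛 b ≠ 0 := by
      simpa using nonZeroDivisors.coe_ne_zero b
    have hwj : w j ≠ 0 := by
      intro h
      have := hw j
      rw [h, map_zero, Algebra.smul_def] at this
      exact mul_ne_zero hb0 hvj this.symm
    have hwl : ∀ j' < j, w j' = 0 := by
      intro j' hj'
      apply inj
      rw [hw, hvl j' hj', smul_zero, map_zero]
    obtain ⟨t, ht⟩ : ∃ t, homogeneousComponent t (w j) ≠ 0 := by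
      by_contra hcon
      push Not at hcon
      apply hwj
      rw [← sum_homogeneousComponent (w j)]
      simp [hcon]
    have hne : (homogeneousComponent t (w j)).support.Nonempty := by
      rwa [Finset.nonempty_iff_ne_empty, ne_eq, MvPolynomial.support_eq_empty]
    obtain ⟨m, hm, hmin⟩ := Finset.exists_min_image _ mo.toSyn hne
    have hmt : m.degree = t := by
      have := (homogeneousComponent_isHomogeneous t (w j)) (mem_support_iff.mp hm)
      rw [← this, Finsupp.degree_eq_weight_one]; rfl
    refine ⟨m, fun i => homogeneousComponent t (w i), ?_, hgr w hwQ t, mem_support_iff.mp hm, ?_, ?_⟩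
    · intro i; rw [hmt]; exact homogeneousComponent_isHomogeneous t _
    · intro j' hj'; simp [hwl j' hj']
    · intro m' hm'
      by_contra hh
      exact absurd (hmin m' (mem_support_iff.mpr hh)) (not_le.mpr hm')
  · rintro ⟨m, v, -, h2, h3, h4, -⟩
    refine ⟨_, h2, ?_, ?_⟩
    · intro h
      have inj : Function.Injective (algebraMap (MvPolynomial σ L) 𝓛) := IsFractionRing.injective _ _
      rw [map_eq_zero_iff _ inj] at h
      rw [h] at h3; simp at h3
    · intro j' hj'
      simp [h4 j' hj']

theorem lead_card_key {ι K : Type} {O : Type*} [Fintype ι] [LinearOrder O] (key : ι → O) (hk : Function.Injective key) [Field K] (V : Submodule K (ι → K)) :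
    finrank K V = {i | ∃ v ∈ V, v i ≠ 0 ∧ ∀ j, key j < key i → v j = 0}.ncard := by
  letI : LinearOrder ι := LinearOrder.lift' key hk
  exact lead_card V

theorem lead_P (mo : MonomialOrder σ) (Q : Submodule 𝓛 (J → 𝓛)) (t : ℕ) (P : Submodule L (J → homogeneousSubmodule σ L t))
    (hP : ∀ v, v ∈ P ↔ (fun i => algebraMap _ 𝓛 (v i).1) ∈ Q) :
    finrank L P = ∑ j, {m | m ∈ leadU (L := L) mo Q j ∧ m.degree = t}.ncard := by
  classical
  let T := J × {m : σ →₀ ℕ | m.degree = t}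
  haveI := degree_finite σ t
  letI : Fintype {m : σ →₀ ℕ | m.degree = t} := Fintype.ofFinite _
  let enc : (J → homogeneousSubmodule σ L t) →ₗ[L] (T → L) :=
    { toFun := fun v p => coeff p.2.1 (v p.1).1
      map_add' := fun v w => by ext p; simp
      map_smul' := fun c v => by ext p; simp }
  have henc : Function.Injective enc := by
    intro v w h
    ext j m
    by_cases hm : m.degree = t
    · exact congrFun h (j, ⟨m, hm⟩)
    · rw [(mem_homogeneousSubmodule t _ |>.1 (v j).2).coeff_eq_zero hm, (mem_homogeneousSubmodule t _ |>.1 (w j).2).coeff_eq_zero hm]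
  rw [LinearEquiv.finrank_eq (Submodule.equivMapOfInjective enc henc P)]
  let key : T → J ×ₗ mo.syn := fun p => toLex (p.1, mo.toSyn p.2.1)
  have hkey : Function.Injective key := by
    rintro ⟨j, m⟩ ⟨j', m'⟩ h
    have h' : (j, mo.toSyn m.1) = (j', mo.toSyn m'.1) := toLex.injective h
    simp only [Prod.mk.injEq, EmbeddingLike.apply_eq_iff_eq] at h'
    exact Prod.ext h'.1 (Subtype.ext h'.2)
  rw [lead_card_key key hkey]
  have hset : {i | ∃ v ∈ P.map enc, v i ≠ 0 ∧ ∀ j, key j < key i → v j = 0} = 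
      {i : T | i.2.1 ∈ leadU (L := L) mo Q i.1} := by
    ext ⟨j, m, hm⟩
    have hm' : m.degree = t := hm
    constructor
    · rintro ⟨_, ⟨v, hv, rfl⟩, h1, h2⟩
      refine ⟨fun i => (v i).1, ?_, (hP v).1 hv, h1, ?_, ?_⟩
      · intro i; rw [hm']; exact (v i).2
      · intro j' hj'
        ext m'
        by_cases hmt : m'.degree = t
        · exact h2 (j', ⟨m', hmt⟩) (Prod.Lex.toLex_lt_toLex.2 (Or.inl hj'))
        · rw [(mem_homogeneousSubmodule t _ |>.1 (v j').2).coeff_eq_zero hmt, coeff_zero]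
      · intro m' hlt
        by_cases hmt : m'.degree = t
        · exact h2 (j, ⟨m', hmt⟩) (Prod.Lex.toLex_lt_toLex.2 (Or.inr ⟨rfl, hlt⟩))
        · exact (mem_homogeneousSubmodule t _ |>.1 (v j).2).coeff_eq_zero hmt
    · rintro ⟨v, h1, h2, h3, h4, h5⟩
      refine ⟨_, ⟨fun i => ⟨v i, ?_⟩, (hP _).2 h2, rfl⟩, h3, ?_⟩
      · rw [mem_homogeneousSubmodule, ← hm']; exact h1 i
      · rintro ⟨j', m'⟩ hlt
        rcases Prod.Lex.toLex_lt_toLex.1 hlt with h | ⟨h, h'⟩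
        · change coeff _ (v j') = 0
          rw [h4 j' h, coeff_zero]
        · change coeff _ (v j') = 0
          have hjj : j' = j := h
          rw [hjj]
          exact h5 _ h'
  rw [hset]
  have : ∀ j : J, {m | m ∈ leadU (L := L) mo Q j ∧ m.degree = t}.ncard = (Finset.univ.filter fun m : {m : σ →₀ ℕ | m.degree = t} => m.1 ∈ leadU (L := L) mo Q j).card := by
    intro j
    rw [← Set.ncard_coe_finset, ← Set.ncard_image_of_injective _ (Subtype.val_injective)]
    congr 1
    ext m
    constructor
    · rintro ⟨h1, h2⟩
      exact ⟨⟨m, h2⟩, Finset.mem_coe.2 (Finset.mem_filter.2 ⟨Finset.mem_univ _, h1⟩), rfl⟩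
    · rintro ⟨⟨m, h2⟩, h1, rfl⟩
      exact ⟨(Finset.mem_filter.1 (Finset.mem_coe.1 h1)).2, h2⟩
  simp only [this]
  rw [Set.ncard_eq_toFinset_card', Set.toFinset_setOf, Finset.card_filter, Fintype.sum_prod_type]
  simp only [Finset.card_filter]

theorem ker_dvd [IsFractionRing (MvPolynomial σ L) 𝓛] (Q : Submodule 𝓛 (J → 𝓛))
    (hgr : ∀ v : J → MvPolynomial σ L, (fun i => algebraMap _ 𝓛 (v i)) ∈ Q → ∀ t, 
      (fun i => algebraMap _ 𝓛 (homogeneousComponent t (v i))) ∈ Q)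
    (P : ∀ t, Submodule L (J → homogeneousSubmodule σ L t))
    (hP : ∀ t v, v ∈ P t ↔ (fun i => algebraMap _ 𝓛 (v i).1) ∈ Q) (q : ℕ) (hq : ∀ t, q ∣ finrank L (P t)) :
    q ∣ finrank 𝓛 Q := by
  classical
  let e := Fintype.equivFin σ
  letI : LinearOrder σ := LinearOrder.lift' e e.injective
  let mo : MonomialOrder σ := MonomialOrder.lex
  rw [lead_Q mo Q hgr]
  let φ : (Fin (Fintype.card σ) → ℕ) ≃ (σ →₀ ℕ) := (Equiv.arrowCongr e.symm (Equiv.refl ℕ)).trans Finsupp.equivFunOnFinite.symm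
  have hφ : ∀ u s, φ u s = u (e s) := fun u s => rfl
  have hφd : ∀ u, (φ u).degree = ∑ i, u i := by
    intro u
    rw [Finsupp.degree_eq_sum]
    simp only [hφ]
    exact Equiv.sum_comp e u
  let U : J → Set (Fin (Fintype.card σ) → ℕ) := fun j => {u | φ u ∈ leadU (L := L) mo Q j}
  have hU : ∀ j, IsUpperSet (U j) := by
    intro j u u' h hu
    exact leadU_upper mo Q j (fun s => h (e s)) hu
  have := hcount_dvd U hU q (by
    intro t
    have h := hq t
    rw [lead_P mo Q t (P t) (hP t)] at h
    convert h using 1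
    refine Finset.sum_congr rfl fun j _ => ?_
    unfold hcount
    rw [← Set.ncard_image_of_injective _ φ.injective]
    congr 1
    ext m
    constructor
    · rintro ⟨u, ⟨h1, h2⟩, rfl⟩
      exact ⟨h1, by rw [hφd, h2]⟩
    · rintro ⟨h1, h2⟩
      refine ⟨φ.symm m, ⟨?_, ?_⟩, by simp⟩
      · change φ (φ.symm m) ∈ leadU (L := L) mo Q j
        simpa using h1
      · rw [← hφd]; simpa using h2)
  convert this using 3
  ext j
  constructor
  · rintro ⟨m, hm⟩
    exact ⟨φ.symm m, by change φ (φ.symm m) ∈ leadU (L := L) mo Q j; simpa using hm⟩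
  · rintro ⟨m, hm⟩
    exact ⟨φ m, hm⟩

end Lead

theorem ker_dvd' {σ J L 𝓛 : Type} [Fintype σ] [Fintype J] [Field L] [Field 𝓛] [Algebra (MvPolynomial σ L) 𝓛]
    [IsFractionRing (MvPolynomial σ L) 𝓛] (Q : Submodule 𝓛 (J → 𝓛))
    (hgr : ∀ v : J → MvPolynomial σ L, (fun i => algebraMap _ 𝓛 (v i)) ∈ Q → ∀ t, 
      (fun i => algebraMap _ 𝓛 (MvPolynomial.homogeneousComponent t (v i))) ∈ Q)
    (P : ∀ t, Submodule L (J → MvPolynomial.homogeneousSubmodule σ L t))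
    (hP : ∀ t v, v ∈ P t ↔ (fun i => algebraMap _ 𝓛 (v i).1) ∈ Q) (q : ℕ) (hq : ∀ t, q ∣ Module.finrank L (P t)) :
    q ∣ Module.finrank 𝓛 Q := by
  letI : LinearOrder J := LinearOrder.lift' (Fintype.equivFin J) (Fintype.equivFin J).injective
  exact ker_dvd Q hgr P hP q hq

section Gam
open Module MvPolynomial
variable {F L : Type} [Field F] [Field L] [Algebra F L]
variable {D D' : Type} [Ring D] [Algebra F D] [Ring D'] [Algebra F D']
variable {J₁ J₂ : Type} [Fintype J₁] [DecidableEq J₁] [Fintype J₂] [DecidableEq J₂]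

/-- the acting triples -/
structure Gam (Φ₁ : D →ₐ[F] Matrix J₁ J₁ L) (Φ₂ : D' →ₐ[F] Matrix J₂ J₂ L) where
  g : L ≃ₐ[F] L
  A : Matrix J₁ J₁ L
  B : Matrix J₂ J₂ L
  hA : IsUnit A
  hB : IsUnit B
  cA : ∀ y, A * (Φ₁ y).map g = Φ₁ y * A
  cB : ∀ y, B * (Φ₂ y).map g = Φ₂ y * B

theorem Psi_inj {Cc : Type} [Fintype Cc] [DecidableEq Cc] (g : L ≃ₐ[F] L) {A : Matrix J₁ J₁ L} (hA : IsUnit A) {B : Matrix J₂ J₂ L} (hB : IsUnit B) :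
    Function.Injective (Psi Cc g A B) := by
  have key : ∀ {J : Type} [Fintype J] [DecidableEq J] {A : Matrix J J L}, IsUnit A → (A⁻¹).map (g⁻¹ : L ≃ₐ[F] L) * A.map (g⁻¹ : L ≃ₐ[F] L) = 1 := by
    intro J _ _ A hA
    have h3 : (A⁻¹ * A).map (g⁻¹ : L ≃ₐ[F] L) = (A⁻¹).map (g⁻¹ : L ≃ₐ[F] L) * A.map (g⁻¹ : L ≃ₐ[F] L) := Matrix.map_mul (f := ((g⁻¹ : L ≃ₐ[F] L) : L →+* L))
    rw [← h3, Matrix.nonsing_inv_mul _ ((Matrix.isUnit_iff_isUnit_det _).1 hA), Matrix.map_one] <;> simp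
  apply Function.LeftInverse.injective (g := Psi Cc g⁻¹ ((A⁻¹).map (g⁻¹ : L ≃ₐ[F] L)) ((B⁻¹).map (g⁻¹ : L ≃ₐ[F] L)))
  intro f
  rw [Psi_comp _ _ _ _ hA, key hA, key hB, inv_mul_cancel, Psi_one]

variable {Φ₁ : D →ₐ[F] Matrix J₁ J₁ L} {Φ₂ : D' →ₐ[F] Matrix J₂ J₂ L}

variable {𝓛 : Type} [Field 𝓛] [Algebra (MvPolynomial ((J₁ × J₂) × J₁ × J₂) L) 𝓛] 
  [IsFractionRing (MvPolynomial ((J₁ × J₂) × J₁ × J₂) L) 𝓛] [Algebra L 𝓛] [IsScalarTower L (MvPolynomial ((J₁ × J₂) × J₁ × J₂) L) 𝓛]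
  [Algebra F 𝓛] [IsScalarTower F L 𝓛]

namespace Gam

/-- extension to the function field -/
noncomputable def psi (γ : Gam Φ₁ Φ₂) : 𝓛 →+* 𝓛 :=
  IsFractionRing.map (A := MvPolynomial ((J₁ × J₂) × J₁ × J₂) L) (B := MvPolynomial ((J₁ × J₂) × J₁ × J₂) L) (Psi_inj γ.g γ.hA γ.hB)

theorem psi_alg (γ : Gam Φ₁ Φ₂) (p : MvPolynomial ((J₁ × J₂) × J₁ × J₂) L) :
    γ.psi (algebraMap _ 𝓛 p) = algebraMap _ 𝓛 (Psi (J₁ × J₂) γ.g γ.A γ.B p) := by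
  unfold psi IsFractionRing.map
  exact IsLocalization.map_eq _ _

theorem psi_L (γ : Gam Φ₁ Φ₂) (c : L) : γ.psi (algebraMap L 𝓛 c) = algebraMap L 𝓛 (γ.g c) := by
  rw [IsScalarTower.algebraMap_apply L (MvPolynomial ((J₁ × J₂) × J₁ × J₂) L) 𝓛, psi_alg, MvPolynomial.algebraMap_eq, Psi_C,
    IsScalarTower.algebraMap_apply L (MvPolynomial ((J₁ × J₂) × J₁ × J₂) L) 𝓛, MvPolynomial.algebraMap_eq]

theorem psi_F (γ : Gam Φ₁ Φ₂) (c : F) : γ.psi (algebraMap F 𝓛 c) = algebraMap F 𝓛 c := by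
  rw [IsScalarTower.algebraMap_apply F L 𝓛, psi_L, AlgEquiv.commutes]

/-- constants as matrices -/
noncomputable abbrev cm (𝓛 : Type) [Field 𝓛] [Algebra L 𝓛] {J J' : Type} (A : Matrix J J' L) : Matrix J J' 𝓛 := A.map (algebraMap L 𝓛)

theorem cm_mul {J J' J'' : Type} [Fintype J'] (A : Matrix J J' L) (B : Matrix J' J'' L) : cm 𝓛 (A * B) = cm 𝓛 A * cm 𝓛 B :=
  Matrix.map_mul (f := algebraMap L 𝓛)

theorem cm_unit {J : Type} [Fintype J] [DecidableEq J] {A : Matrix J J L} (h : IsUnit A) : IsUnit (cm 𝓛 A) := by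
  have := h.map (algebraMap L 𝓛).mapMatrix
  exact this

theorem map_cm (γ : Gam Φ₁ Φ₂) {J J' : Type} (A : Matrix J J' L) : (cm 𝓛 A).map γ.psi = cm 𝓛 (A.map γ.g) := by
  ext i j
  simp only [cm, Matrix.map_apply, psi_L]

variable (𝓛) in
/-- generic matrices -/
noncomputable def xm (c : J₁ × J₂) : Matrix J₁ J₂ 𝓛 := fun i j => algebraMap (MvPolynomial ((J₁ × J₂) × J₁ × J₂) L) 𝓛 (X (c, i, j))

theorem psi_xm (γ : Gam Φ₁ Φ₂) (c : J₁ × J₂) : cm 𝓛 γ.A * (xm (L := L) 𝓛 c).map γ.psi = xm (L := L) 𝓛 c * cm 𝓛 γ.B := by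
  have h : (xm (L := L) 𝓛 c).map γ.psi = cm 𝓛 γ.A⁻¹ * xm (L := L) 𝓛 c * cm 𝓛 γ.B := by
    ext i j
    simp only [Matrix.map_apply, xm, psi_alg, Matrix.mul_apply, cm, Psi, semiHom, eval₂Hom_X', map_sum, map_mul, TT]
    rw [Fintype.sum_prod_type, Finset.sum_eq_single c]
    · rw [Fintype.sum_prod_type, Finset.sum_comm]
      refine Finset.sum_congr rfl fun y _ => ?_
      rw [Finset.sum_mul]
      refine Finset.sum_congr rfl fun x _ => ?_
      simp only [if_true, IsScalarTower.algebraMap_apply L (MvPolynomial ((J₁ × J₂) × J₁ × J₂) L) 𝓛, MvPolynomial.algebraMap_eq, map_mul]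
      ring
    · intro b _ hb
      simp [hb]
    · simp
  rw [h, ← Matrix.mul_assoc, ← Matrix.mul_assoc, ← cm_mul, Matrix.mul_nonsing_inv _ ((Matrix.isUnit_iff_isUnit_det _).1 γ.hA)]
  simp [cm]


variable (Φ₁ Φ₂ 𝓛) in
/-- fixed field -/
noncomputable def fixF : IntermediateField F 𝓛 where
  carrier := {f | ∀ γ : Gam Φ₁ Φ₂, γ.psi f = f}
  mul_mem' := fun ha hb γ => by rw [map_mul, ha γ, hb γ]
  add_mem' := fun ha hb γ => by rw [map_add, ha γ, hb γ]
  algebraMap_mem' := fun c γ => psi_F γ c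
  inv_mem' := fun a ha γ => by rw [map_inv₀, ha γ]

theorem mem_fixF (f : 𝓛) : f ∈ fixF Φ₁ Φ₂ 𝓛 ↔ ∀ γ : Gam Φ₁ Φ₂, γ.psi f = f := Iff.rfl

variable (Φ₁ Φ₂ 𝓛) in
/-- the algebra of invariants -/
noncomputable def fixE : Subalgebra (fixF Φ₁ Φ₂ 𝓛) (Matrix J₁ J₁ 𝓛) where
  carrier := {a | ∀ γ : Gam Φ₁ Φ₂, cm 𝓛 γ.A * a.map γ.psi = a * cm 𝓛 γ.A}
  mul_mem' := fun {a b} ha hb γ => by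
    have : (a * b).map γ.psi = a.map γ.psi * b.map γ.psi := Matrix.map_mul (f := γ.psi)
    rw [this, ← mul_assoc, ha γ, mul_assoc, hb γ, mul_assoc]
  add_mem' := fun {a b} ha hb γ => by
    rw [Matrix.map_add γ.psi (map_add γ.psi), mul_add, add_mul, ha γ, hb γ]
  algebraMap_mem' := fun c γ => by
    have : (algebraMap (fixF Φ₁ Φ₂ 𝓛) (Matrix J₁ J₁ 𝓛) c) = (c.1 : 𝓛) • (1 : Matrix J₁ J₁ 𝓛) := by
      rw [Algebra.algebraMap_eq_smul_one]; rfl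
    have h2 : (c.1 • (1 : Matrix J₁ J₁ 𝓛)).map γ.psi = c.1 • (1 : Matrix J₁ J₁ 𝓛) := by
      have := c.2 γ
      ext i j
      simp only [Matrix.map_apply, Matrix.smul_apply, smul_eq_mul, map_mul, this, Matrix.one_apply]
      split_ifs <;> simp
    rw [this, h2]
    simp

theorem mem_fixE (a : Matrix J₁ J₁ 𝓛) : a ∈ fixE Φ₁ Φ₂ 𝓛 ↔ ∀ γ : Gam Φ₁ Φ₂, cm 𝓛 γ.A * a.map γ.psi = a * cm 𝓛 γ.A := Iff.rfl

theorem Phi1_mem (y : D) : cm 𝓛 (Φ₁ y) ∈ fixE Φ₁ Φ₂ 𝓛 := by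
  intro γ
  rw [map_cm, ← cm_mul, γ.cA, cm_mul]

/-- entries `x B y` with `x`, `y` transforming suitably -/
theorem conj_mem {x : Matrix J₁ J₂ 𝓛} {y : Matrix J₂ J₁ 𝓛} (b : Matrix J₂ J₂ 𝓛)
    (hb : ∀ γ : Gam Φ₁ Φ₂, cm 𝓛 γ.B * b.map γ.psi = b * cm 𝓛 γ.B)
    (hx : ∀ γ : Gam Φ₁ Φ₂, cm 𝓛 γ.A * x.map γ.psi = x * cm 𝓛 γ.B)
    (hy : ∀ γ : Gam Φ₁ Φ₂, cm 𝓛 γ.B * y.map γ.psi = y * cm 𝓛 γ.A) : x * b * y ∈ fixE Φ₁ Φ₂ 𝓛 := by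
  intro γ
  have h1 : (x * b * y).map γ.psi = x.map γ.psi * b.map γ.psi * y.map γ.psi := by
    have h1 : (x * b).map γ.psi = x.map γ.psi * b.map γ.psi := Matrix.map_mul (f := γ.psi)
    have h2 : (x * b * y).map γ.psi = (x * b).map γ.psi * y.map γ.psi := Matrix.map_mul (f := γ.psi)
    rw [h2, h1]
  rw [h1, ← Matrix.mul_assoc, ← Matrix.mul_assoc, hx, Matrix.mul_assoc x, hb, Matrix.mul_assoc, Matrix.mul_assoc, Matrix.mul_assoc, hy]
  simp only [Matrix.mul_assoc]

theorem xm_inv (c : J₁ × J₂) (hc : Fintype.card J₁ = Fintype.card J₂) : 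
    ∃ y : Matrix J₂ J₁ 𝓛, xm (L := L) 𝓛 c * y = 1 ∧ y * xm (L := L) 𝓛 c = 1 := by
  let e := Fintype.equivOfCardEq hc
  let M : Matrix J₁ J₁ (MvPolynomial ((J₁ × J₂) × J₁ × J₂) L) := fun i j => X (c, i, e j)
  have hM : M.det ≠ 0 := by
    intro h
    let ev : MvPolynomial ((J₁ × J₂) × J₁ × J₂) L →+* L := (aeval (fun x : (J₁ × J₂) × J₁ × J₂ => if e x.2.1 = x.2.2 then (1 : L) else 0)).toRingHom
    have h1 := congrArg ev h
    rw [RingHom.map_det, map_zero] at h1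
    have h2 : ev.mapMatrix M = 1 := by
      ext i j
      change ev (X (c, i, e j)) = _
      simp [ev, Matrix.one_apply]
    rw [h2] at h1
    simp at h1
  let M' : Matrix J₁ J₁ 𝓛 := (algebraMap _ 𝓛).mapMatrix M
  have hM' : IsUnit M'.det := by
    rw [isUnit_iff_ne_zero]
    change ((algebraMap _ 𝓛).mapMatrix M).det ≠ 0
    rw [← RingHom.map_det]
    simpa using hM
  have hx : xm (L := L) 𝓛 c = M'.submatrix id e.symm := by
    ext i j
    change _ = algebraMap _ 𝓛 (X (c, i, e (e.symm j)))
    simp [xm]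
  refine ⟨M'⁻¹.submatrix e.symm id, ?_, ?_⟩
  · rw [hx, Matrix.submatrix_mul_equiv, Matrix.mul_nonsing_inv _ hM']; simp
  · have := Matrix.submatrix_mul_equiv M'⁻¹ M' e.symm (Equiv.refl J₁) e.symm
    rw [hx]
    erw [this]
    rw [Matrix.nonsing_inv_mul _ hM']; simp

theorem xm_span : ⊤ ≤ Submodule.span 𝓛 (Set.range (xm (L := L) (J₁ := J₁) (J₂ := J₂) 𝓛)) := by
  let X₀ : Matrix (J₁ × J₂) (J₁ × J₂) 𝓛 := (algebraMap _ 𝓛).mapMatrix (Matrix.mvPolynomialX (J₁ × J₂) (J₁ × J₂) L)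
  have hX : IsUnit X₀.det := by
    rw [isUnit_iff_ne_zero]
    change ((algebraMap _ 𝓛).mapMatrix (Matrix.mvPolynomialX (J₁ × J₂) (J₁ × J₂) L)).det ≠ 0
    rw [← RingHom.map_det]
    simpa using Matrix.det_mvPolynomialX_ne_zero (J₁ × J₂) L
  rintro a -
  have h : a = ∑ c, (∑ p : J₁ × J₂, a p.1 p.2 * X₀⁻¹ p c) • xm (L := L) 𝓛 c := by
    ext i j
    have h2 := congrFun ((congrArg (fun M => Matrix.vecMul (fun p : J₁ × J₂ => a p.1 p.2) M) (Matrix.nonsing_inv_mul _ hX))) (i, j)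
    simp only [Matrix.vecMul_one] at h2
    rw [← h2, ← Matrix.vecMul_vecMul, Matrix.sum_apply]
    rfl
  rw [h]
  exact Submodule.sum_mem _ fun c _ => Submodule.smul_mem _ _ (Submodule.subset_span ⟨c, rfl⟩)

theorem y_transf (c : J₁ × J₂) {y : Matrix J₂ J₁ 𝓛} (h1 : xm (L := L) 𝓛 c * y = 1) (h2 : y * xm (L := L) 𝓛 c = 1) (γ : Gam Φ₁ Φ₂) :
    cm 𝓛 γ.B * y.map γ.psi = y * cm 𝓛 γ.A := by
  have h3 : (xm (L := L) 𝓛 c).map γ.psi * y.map γ.psi = 1 := by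
    have : ((xm (L := L) 𝓛 c) * y).map γ.psi = (xm (L := L) 𝓛 c).map γ.psi * y.map γ.psi := Matrix.map_mul (f := γ.psi)
    rw [← this, h1, Matrix.map_one] <;> simp
  calc cm 𝓛 γ.B * y.map γ.psi = (y * xm (L := L) 𝓛 c) * (cm 𝓛 γ.B * y.map γ.psi) := by rw [h2, Matrix.one_mul]
    _ = y * ((xm (L := L) 𝓛 c * cm 𝓛 γ.B) * y.map γ.psi) := by simp only [Matrix.mul_assoc]
    _ = y * cm 𝓛 γ.A := by rw [← psi_xm, Matrix.mul_assoc, h3, Matrix.mul_one]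

theorem fixE_span (hc : Fintype.card J₁ = Fintype.card J₂) [Nonempty J₁] : ⊤ ≤ Submodule.span 𝓛 (fixE Φ₁ Φ₂ 𝓛 : Set (Matrix J₁ J₁ 𝓛)) := by
  obtain ⟨i⟩ := ‹Nonempty J₁›
  let c0 : J₁ × J₂ := (i, Fintype.equivOfCardEq hc i)
  obtain ⟨y, h1, h2⟩ := xm_inv (L := L) (𝓛 := 𝓛) c0 hc
  rintro a -
  have h3 : a * xm (L := L) 𝓛 c0 ∈ Submodule.span 𝓛 (Set.range (xm (L := L) (J₁ := J₁) (J₂ := J₂) 𝓛)) := xm_span trivial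
  let T : Matrix J₁ J₂ 𝓛 →ₗ[𝓛] Matrix J₁ J₁ 𝓛 := 
    { toFun := fun m => m * y
      map_add' := fun m m' => Matrix.add_mul _ _ _
      map_smul' := fun c m => by simp }
  have h4 : T (a * xm (L := L) 𝓛 c0) = a := by
    change a * xm (L := L) 𝓛 c0 * y = a
    rw [Matrix.mul_assoc, h1, Matrix.mul_one]
  rw [← h4]
  have h5 := Submodule.mem_map_of_mem (f := T) h3
  rw [Submodule.map_span] at h5
  refine Submodule.span_mono ?_ h5
  rintro _ ⟨_, ⟨c, rfl⟩, rfl⟩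
  have := conj_mem (Φ₁ := Φ₁) (Φ₂ := Φ₂) (x := xm (L := L) 𝓛 c) (y := y) 1 (fun γ => by
    rw [Matrix.map_one] <;> simp) (fun γ => psi_xm γ c) (y_transf c0 h1 h2)
  rw [Matrix.mul_one] at this
  exact this

end Gam
end Gam

section Gam2
open Module MvPolynomial
variable {F L : Type} [Field F] [Field L] [Algebra F L]
variable {D D' : Type} [Ring D] [Algebra F D] [Ring D'] [Algebra F D']
variable {J₁ J₂ : Type} [Fintype J₁] [DecidableEq J₁] [Fintype J₂] [DecidableEq J₂]
variable {Φ₁ : D →ₐ[F] Matrix J₁ J₁ L} {Φ₂ : D' →ₐ[F] Matrix J₂ J₂ L}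
variable {𝓛 : Type} [Field 𝓛] [Algebra (MvPolynomial ((J₁ × J₂) × J₁ × J₂) L) 𝓛] 
  [IsFractionRing (MvPolynomial ((J₁ × J₂) × J₁ × J₂) L) 𝓛] [Algebra L 𝓛] [IsScalarTower L (MvPolynomial ((J₁ × J₂) × J₁ × J₂) L) 𝓛]
  [Algebra F 𝓛] [IsScalarTower F L 𝓛]

namespace Gam

theorem fixE_finrank (hc : Fintype.card J₁ = Fintype.card J₂) [Nonempty J₁] : 
    finrank (fixF Φ₁ Φ₂ 𝓛) (fixE Φ₁ Φ₂ 𝓛) = (Fintype.card J₁) ^ 2 := by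
  let ρ : Gam Φ₁ Φ₂ → Matrix J₁ J₁ 𝓛 →+ Matrix J₁ J₁ 𝓛 := fun γ =>
    { toFun := fun a => cm 𝓛 γ.A * a.map γ.psi * (cm 𝓛 γ.A)⁻¹
      map_zero' := by simp
      map_add' := fun a b => by rw [Matrix.map_add γ.psi (map_add γ.psi), mul_add, add_mul] }
  obtain ⟨B, -⟩ := desc_exists_basis (fun γ : Gam Φ₁ Φ₂ => γ.psi (𝓛 := 𝓛)) ρ (by
    intro γ c v
    change cm 𝓛 γ.A * (c • v).map γ.psi * (cm 𝓛 γ.A)⁻¹ = γ.psi c • (cm 𝓛 γ.A * v.map γ.psi * (cm 𝓛 γ.A)⁻¹)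
    have : (c • v).map γ.psi = γ.psi c • v.map γ.psi := by ext i j; simp
    rw [this]; simp) (k := fixF Φ₁ Φ₂ 𝓛) (by
    intro c h
    exact ⟨⟨c, h⟩, rfl⟩) (Subalgebra.toSubmodule (fixE Φ₁ Φ₂ 𝓛)) (by
    intro a
    rw [Subalgebra.mem_toSubmodule, mem_fixE]
    refine forall_congr' fun γ => ?_
    have hu : IsUnit (cm 𝓛 γ.A).det := (Matrix.isUnit_iff_isUnit_det _).1 (cm_unit γ.hA)
    change _ ↔ cm 𝓛 γ.A * a.map γ.psi * (cm 𝓛 γ.A)⁻¹ = a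
    constructor
    · intro h; rw [h, Matrix.mul_nonsing_inv_cancel_right _ _ hu]
    · intro h; rw [← h, Matrix.nonsing_inv_mul_cancel_right _ _ hu, h]) (fixE_span hc)
  have := finrank_eq_card_basis B
  rw [Fintype.card_fin] at this
  refine this.trans ?_
  rw [Module.finrank_matrix]
  simp [sq]

theorem fixE_center (hc : Fintype.card J₁ = Fintype.card J₂) [Nonempty J₁] :
    Subalgebra.center (fixF Φ₁ Φ₂ 𝓛) (fixE Φ₁ Φ₂ 𝓛) = ⊥ := by
  rw [eq_bot_iff]
  rintro ⟨a, ha⟩ hcen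
  rw [Subalgebra.mem_center_iff] at hcen
  have h1 : ∀ b : Matrix J₁ J₁ 𝓛, b * a = a * b := by
    intro b
    have hb : b ∈ Submodule.span 𝓛 (fixE Φ₁ Φ₂ 𝓛 : Set (Matrix J₁ J₁ 𝓛)) := fixE_span hc trivial
    induction hb using Submodule.span_induction with
    | mem x hx => exact congrArg Subtype.val (hcen ⟨x, hx⟩)
    | zero => simp
    | add x y _ _ hx hy => rw [add_mul, mul_add, hx, hy]
    | smul c x _ hx => rw [smul_mul_assoc, mul_smul_comm, hx]
  have h2 : a ∈ Subalgebra.center 𝓛 (Matrix J₁ J₁ 𝓛) := Subalgebra.mem_center_iff.2 h1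
  rw [Algebra.IsCentral.center_eq_bot, Algebra.mem_bot] at h2
  obtain ⟨f, rfl⟩ := h2
  have hf : f ∈ fixF Φ₁ Φ₂ 𝓛 := by
    intro γ
    have h3 := ha γ
    have h4 : (algebraMap 𝓛 (Matrix J₁ J₁ 𝓛) f).map γ.psi = algebraMap 𝓛 (Matrix J₁ J₁ 𝓛) (γ.psi f) := by
      ext i j
      simp only [Matrix.map_apply, Matrix.algebraMap_matrix_apply]
      split_ifs <;> simp
    rw [h4, ← Algebra.commutes] at h3
    have h5 := (cm_unit (𝓛 := 𝓛) γ.hA).mul_left_injective h3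
    exact (algebraMap 𝓛 (Matrix J₁ J₁ 𝓛)).injective h5
  rw [Algebra.mem_bot]
  exact ⟨⟨f, hf⟩, Subtype.ext rfl⟩

theorem fixF_algClosed [FiniteDimensional F L] [IsGalois F L] (hg : ∀ g : L ≃ₐ[F] L, ∃ γ : Gam Φ₁ Φ₂, γ.g = g)
    (x : fixF Φ₁ Φ₂ 𝓛) (hx : IsAlgebraic F x) : x ∈ (algebraMap F (fixF Φ₁ Φ₂ 𝓛)).range := by
  obtain ⟨f, hf⟩ := x
  have hf' : IsAlgebraic F f := (isAlgebraic_algebraMap_iff (FaithfulSMul.algebraMap_injective (fixF Φ₁ Φ₂ 𝓛) 𝓛)).2 hx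
  by_cases h0 : f = 0
  · exact ⟨0, Subtype.ext (by simp [h0])⟩
  have key : ∀ f : 𝓛, IsAlgebraic F f → ∃ p : MvPolynomial ((J₁ × J₂) × J₁ × J₂) L, algebraMap _ 𝓛 p = f := by
    intro f hf
    have h1 : IsIntegral L f := hf.isIntegral.tower_top
    have h2 : IsIntegral (MvPolynomial ((J₁ × J₂) × J₁ × J₂) L) f := h1.tower_top
    exact IsIntegrallyClosed.isIntegral_iff.1 h2
  obtain ⟨p, hp⟩ := key f hf'
  obtain ⟨q, hq⟩ := key f⁻¹ hf'.inv
  have inj : Function.Injective (algebraMap (MvPolynomial ((J₁ × J₂) × J₁ × J₂) L) 𝓛) := IsFractionRing.injective _ _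
  have hpq : p * q = 1 := by
    apply inj
    rw [map_mul, hp, hq, map_one, mul_inv_cancel₀ h0]
  have hpu : IsUnit p := IsUnit.of_mul_eq_one _ hpq
  rw [MvPolynomial.isUnit_iff_eq_C_of_isReduced] at hpu
  obtain ⟨c, -, rfl⟩ := hpu
  have hfix : ∀ g : L ≃ₐ[F] L, g c = c := by
    intro g
    obtain ⟨γ, rfl⟩ := hg g
    have := hf γ
    rw [← hp, psi_alg, Psi_C] at this
    exact C_injective _ _ (inj this)
  obtain ⟨a, rfl⟩ := (IsGalois.mem_range_algebraMap_iff_fixed c).2 hfix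
  refine ⟨a, Subtype.ext ?_⟩
  change algebraMap F 𝓛 a = f
  rw [← hp]
  rw [IsScalarTower.algebraMap_apply F L 𝓛, IsScalarTower.algebraMap_apply L (MvPolynomial ((J₁ × J₂) × J₁ × J₂) L) 𝓛]
  rfl

/-- the scaling elements -/
noncomputable def scal (c : Lˣ) : Gam Φ₁ Φ₂ where
  g := 1
  A := Matrix.diagonal fun _ => ((1 : Lˣ) : L)
  B := Matrix.diagonal fun _ => (c : L)
  hA := by simp
  hB := by
    rw [Matrix.isUnit_diagonal]
    exact Pi.isUnit_iff.2 fun _ => c.isUnit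
  cA y := by ext i j; simp
  cB y := by
    ext i j
    simp [mul_comm]

theorem scal_homog (c : Lˣ) (f : MvPolynomial ((J₁ × J₂) × J₁ × J₂) L) :
    Psi (J₁ × J₂) (scal (Φ₁ := Φ₁) (Φ₂ := Φ₂) c).g (scal (Φ₁ := Φ₁) (Φ₂ := Φ₂) c).A (scal (Φ₁ := Φ₁) (Φ₂ := Φ₂) c).B f =
      ∑ t ∈ Finset.range (f.totalDegree + 1), C ((c : L) ^ t) * homogeneousComponent t f := by
  have hmon : ∀ (m : (J₁ × J₂) × J₁ × J₂ →₀ ℕ) (a : L), Psi (J₁ × J₂) (scal (Φ₁ := Φ₁) (Φ₂ := Φ₂) c).g (scal (Φ₁ := Φ₁) (Φ₂ := Φ₂) c).A (scal (Φ₁ := Φ₁) (Φ₂ := Φ₂) c).B (monomial m a) =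
      C ((c : L) ^ m.degree) * monomial m a := by
    intro m a
    have h := Psi_diag (F := F) (Cc := J₁ × J₂) (fun _ : J₁ => (1 : Lˣ)) (fun _ : J₂ => c) m
    have h1 : (monomial m a : MvPolynomial ((J₁ × J₂) × J₁ × J₂) L) = C a * monomial m 1 := by simp [C_mul_monomial]
    rw [h1, map_mul, Psi_C]
    erw [h]
    have h2 : ((∏ x : (J₁ × J₂) × J₁ × J₂, ((1 : Lˣ)⁻¹ * c) ^ (m x : ℤ) : Lˣ) : L) = (c : L) ^ m.degree := by
      rw [Finsupp.degree_eq_sum, ← Finset.prod_pow_eq_pow_sum]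
      simp
    rw [h2, smul_eq_C_mul]
    change C a * _ = _
    ring
  have hh : ∀ t, Psi (J₁ × J₂) (scal (Φ₁ := Φ₁) (Φ₂ := Φ₂) c).g (scal (Φ₁ := Φ₁) (Φ₂ := Φ₂) c).A (scal (Φ₁ := Φ₁) (Φ₂ := Φ₂) c).B (homogeneousComponent t f) =
      C ((c : L) ^ t) * homogeneousComponent t f := by
    intro t
    conv_lhs => rw [(homogeneousComponent t f).as_sum]
    conv_rhs => rw [(homogeneousComponent t f).as_sum]
    rw [map_sum, Finset.mul_sum]
    refine Finset.sum_congr rfl fun m hm => ?_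
    have : m.degree = t := by
      have := (homogeneousComponent_isHomogeneous t f) (mem_support_iff.mp hm)
      rw [← this, Finsupp.degree_eq_weight_one]; rfl
    rw [hmon, this]
  conv_lhs => rw [← sum_homogeneousComponent f]
  rw [map_sum]
  exact Finset.sum_congr rfl fun t _ => hh t

theorem fixE_graded [Infinite L] {a : Matrix J₁ J₁ 𝓛} (ha : a ∈ fixE Φ₁ Φ₂ 𝓛) (v : J₁ → MvPolynomial ((J₁ × J₂) × J₁ × J₂) L)
    (hv : a.mulVec (fun i => algebraMap _ 𝓛 (v i)) = 0) (t : ℕ) :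
    a.mulVec (fun i => algebraMap _ 𝓛 (homogeneousComponent t (v i))) = 0 := by
  let n := ∑ i, (v i).totalDegree
  have hn : ∀ i, (v i).totalDegree ≤ n := fun i => Finset.single_le_sum (f := fun i => (v i).totalDegree) (fun _ _ => Nat.zero_le _) (Finset.mem_univ i)
  funext i
  let Q : Polynomial 𝓛 := ∑ t ∈ Finset.range (n + 1), Polynomial.monomial t (a.mulVec (fun i => algebraMap _ 𝓛 (homogeneousComponent t (v i))) i)
  have hroot : ∀ c : Lˣ, Q.IsRoot (algebraMap L 𝓛 c) := by
    intro c
    have h1 := ha (scal c)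
    have h2 : cm 𝓛 (scal (Φ₁ := Φ₁) (Φ₂ := Φ₂) c).A = 1 := by simp [scal, cm]
    rw [h2, one_mul, mul_one] at h1
    have h3 : a.mulVec (fun i => (scal (Φ₁ := Φ₁) (Φ₂ := Φ₂) c).psi (algebraMap _ 𝓛 (v i))) = 0 := by
      funext k
      have := congrArg (scal (Φ₁ := Φ₁) (Φ₂ := Φ₂) c).psi (congrFun hv k)
      simp only [Matrix.mulVec, dotProduct, map_sum, map_mul, Pi.zero_apply, map_zero] at this ⊢
      rw [← this]
      refine Finset.sum_congr rfl fun j _ => ?_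
      have h9 : (scal (Φ₁ := Φ₁) (Φ₂ := Φ₂) c).psi (a k j) = a k j := congrFun (congrFun h1 k) j
      rw [h9]
    have h4 := congrFun h3 i
    simp only [psi_alg, scal_homog] at h4
    rw [Polynomial.IsRoot.def]
    simp only [Q, Polynomial.eval_finset_sum, Polynomial.eval_monomial]
    refine Eq.trans ?_ h4
    simp only [Matrix.mulVec, dotProduct]
    simp only [Finset.sum_mul]
    rw [Finset.sum_comm]
    refine Finset.sum_congr rfl fun j _ => ?_
    rw [map_sum, Finset.mul_sum]
    symm
    rw [Finset.sum_subset (Finset.range_subset_range.2 (Nat.succ_le_succ (hn j)))]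
    · refine Finset.sum_congr rfl fun t _ => ?_
      rw [map_mul, ← MvPolynomial.algebraMap_eq, ← IsScalarTower.algebraMap_apply L (MvPolynomial ((J₁ × J₂) × J₁ × J₂) L) 𝓛, map_pow]
      ring
    · intro t _ ht
      have ht2 : (v j).totalDegree < t := by
        rw [Finset.mem_range, not_lt] at ht; exact ht
      rw [homogeneousComponent_eq_zero _ _ ht2]
      simp
  have hQ : Q = 0 := by
    apply Polynomial.eq_zero_of_infinite_isRoot
    have hinj : Function.Injective (fun c : Lˣ => algebraMap L 𝓛 c) := (algebraMap L 𝓛).injective.comp Units.val_injective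
    have : Infinite Lˣ := by
      rw [← not_finite_iff_infinite]
      intro hfin
      haveI : Finite L := by
        have := Finite.of_surjective (fun o : Option Lˣ => o.elim 0 (fun u => (u : L))) (by
          intro x
          by_cases h : x = 0
          · exact ⟨none, h.symm⟩
          · exact ⟨some (Units.mk0 x h), rfl⟩)
        exact this
      exact not_finite L
    refine (Set.infinite_range_of_injective hinj).mono ?_
    rintro _ ⟨c, rfl⟩
    exact hroot c
  by_cases ht : t < n + 1
  · have := congrArg (fun q => Polynomial.coeff q t) hQ
    simp only [Q, Polynomial.finset_sum_coeff, Polynomial.coeff_monomial, Polynomial.coeff_zero] at this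
    rw [Finset.sum_ite_eq' ] at this
    simpa [ht] using this
  · have : ∀ j, homogeneousComponent t (v j) = 0 := fun j => homogeneousComponent_eq_zero _ _ (by have := hn j; omega)
    simp [this, Matrix.mulVec, dotProduct]

theorem fixE_noZeroDivisors [Infinite L] (hc : Fintype.card J₁ = Fintype.card J₂) [Nonempty J₁]
    (hdvd : ∀ t (W : Submodule L (HV (J₁ × J₂) J₁ J₂ L t)), (∀ γ : Gam Φ₁ Φ₂, ∀ m ∈ W, actH (J₁ × J₂) t γ.g γ.A γ.B m ∈ W) → 
      Fintype.card J₁ ∣ finrank L W) : NoZeroDivisors (fixE Φ₁ Φ₂ 𝓛) := by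
  refine ⟨?_⟩
  rintro ⟨a, ha⟩ ⟨b, hb⟩ hab
  have hab' : a * b = 0 := congrArg Subtype.val hab
  let Q : Submodule 𝓛 (J₁ → 𝓛) := LinearMap.ker a.mulVecLin
  have hQ : ∀ v, v ∈ Q ↔ a.mulVec v = 0 := fun v => LinearMap.mem_ker
  let P : ∀ t, Submodule L (J₁ → homogeneousSubmodule ((J₁ × J₂) × J₁ × J₂) L t) := fun t =>
    { carrier := {v | (fun i => algebraMap _ 𝓛 (v i).1) ∈ Q}
      add_mem' := fun {v w} hv hw => by
        have := Q.add_mem hv hw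
        change _ ∈ Q
        convert this using 1
        funext i
        simp
      zero_mem' := by
        change _ ∈ Q
        convert Q.zero_mem using 1
        funext i
        simp
      smul_mem' := fun c v hv => by
        have := Q.smul_mem (algebraMap L 𝓛 c) hv
        change _ ∈ Q
        convert this using 1
        funext i
        simp [smul_eq_C_mul, IsScalarTower.algebraMap_apply L (MvPolynomial ((J₁ × J₂) × J₁ × J₂) L) 𝓛] }
  have h1 := ker_dvd' Q (fun v hv t => (hQ _).2 (fixE_graded ha v ((hQ _).1 hv) t)) P (fun t v => Iff.rfl) (Fintype.card J₁) (by
    intro t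
    apply hdvd
    intro γ m hm
    have hm' := (hQ _).1 hm
    change _ ∈ Q
    rw [hQ]
    have e1 : (fun i => algebraMap _ 𝓛 (actH (J₁ × J₂) t γ.g γ.A γ.B m i).1) = 
        (cm 𝓛 γ.A).mulVec (fun i => γ.psi (algebraMap _ 𝓛 (m i).1)) := by
      funext i
      change algebraMap _ 𝓛 (∑ k, C (γ.A i k) * Psi (J₁ × J₂) γ.g γ.A γ.B (m k).1) = _
      simp only [map_sum, map_mul, ← psi_alg, Matrix.mulVec, dotProduct, cm, Matrix.map_apply, 
        IsScalarTower.algebraMap_apply L (MvPolynomial ((J₁ × J₂) × J₁ × J₂) L) 𝓛, MvPolynomial.algebraMap_eq]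
    rw [e1, Matrix.mulVec_mulVec, ← ha γ, ← Matrix.mulVec_mulVec]
    have e2 : (a.map γ.psi).mulVec (fun i => γ.psi (algebraMap _ 𝓛 (m i).1)) = 0 := by
      funext k
      have := congrArg γ.psi (congrFun hm' k)
      simp only [Matrix.mulVec, dotProduct, map_sum, map_mul, Pi.zero_apply, map_zero] at this ⊢
      rw [← this]
      rfl
    rw [e2, Matrix.mulVec_zero])
  have h2 : finrank 𝓛 Q ≤ Fintype.card J₁ := by
    have := Submodule.finrank_le Q
    simpa using this
  rcases Nat.eq_zero_or_pos (finrank 𝓛 Q) with h0 | h0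
  · right
    have hQ0 : Q = ⊥ := Submodule.finrank_eq_zero.1 h0
    ext i j
    have : (fun i => b i j) ∈ Q := by
      rw [hQ]
      funext k
      exact congrFun (congrFun hab' k) j
    rw [hQ0, Submodule.mem_bot] at this
    exact congrFun this i
  · left
    have hQ1 : Q = ⊤ := by
      apply Submodule.eq_top_of_finrank_eq
      rw [finrank_fintype_fun_eq_card]
      exact le_antisymm h2 (Nat.le_of_dvd h0 h1)
    have : a.mulVecLin = 0 := LinearMap.ker_eq_top.1 hQ1
    ext i j
    have h3 := congrFun (LinearMap.congr_fun this (Pi.single j 1)) i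
    simpa using h3

end Gam
end Gam2

section FGL
open Module

theorem fg_lemma {F F' E' D D' : Type} [Field F] [Field F'] [Algebra F F'] [Ring E'] [Algebra F' E'] [Algebra F E'] [IsScalarTower F F' E']
    [Ring D] [Algebra F D] [Ring D'] [Algebra F D'] [FiniteDimensional F D] [FiniteDimensional F D']
    [NoZeroDivisors E'] (n : ℕ) (hn : 0 < n) (hfr : finrank F' E' = n)
    (halg : ∀ x : F', IsAlgebraic F x → x ∈ (algebraMap F F').range)
    (hcen : Subalgebra.center F' E' = ⊥) (f₁ : D →ₐ[F] E') (f₂ : D' →ₐ[F] E') :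
    ∃ W : RegularEmbeddingWitness F,
      (⊤ : IntermediateField F W.F').FG ∧
      (∀ x : W.F', IsAlgebraic F x → x ∈ (algebraMap F W.F').range) ∧
      Subalgebra.center W.F' W.E' = ⊥ ∧
      Module.finrank W.F' W.E' = n ∧
      Nonempty (D →ₐ[F] W.E') ∧ Nonempty (D' →ₐ[F] W.E') := by
  classical
  haveI : FiniteDimensional F' E' := FiniteDimensional.of_finrank_pos (by omega)
  haveI : Nontrivial E' := Module.nontrivial_of_finrank_pos (R := F') (by omega)
  let b : Basis (Fin n) F' E' := finBasisOfFinrankEq F' E' hfr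
  let T : Set F' := Set.range (fun p : Fin n × Fin n × Fin n => b.repr (b p.1 * b p.2.1) p.2.2) ∪ Set.range (fun k => b.repr 1 k) ∪
    Set.range (fun p : Fin (finrank F D) × Fin n => b.repr (f₁ (finBasis F D p.1)) p.2) ∪ 
    Set.range (fun p : Fin (finrank F D') × Fin n => b.repr (f₂ (finBasis F D' p.1)) p.2)
  have hT : T.Finite := by
    simp only [T]
    exact (((Set.finite_range _).union (Set.finite_range _)).union (Set.finite_range _)).union (Set.finite_range _)
  let K : IntermediateField F F' := IntermediateField.adjoin F T
  have hTK : ∀ x ∈ T, x ∈ K := fun x hx => IntermediateField.subset_adjoin F T hx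
  have hmulc : ∀ i j k, b.repr (b i * b j) k ∈ K := fun i j k => hTK _ (Or.inl (Or.inl (Or.inl ⟨(i, j, k), rfl⟩)))
  have h1c : ∀ k, b.repr 1 k ∈ K := fun k => hTK _ (Or.inl (Or.inl (Or.inr ⟨k, rfl⟩)))
  have hDc : ∀ i k, b.repr (f₁ (finBasis F D i)) k ∈ K := fun i k => hTK _ (Or.inl (Or.inr ⟨(i, k), rfl⟩))
  have hDc' : ∀ i k, b.repr (f₂ (finBasis F D' i)) k ∈ K := fun i k => hTK _ (Or.inr ⟨(i, k), rfl⟩)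
  let E₀ : Subalgebra K E' :=
    { carrier := {e | ∀ k, b.repr e k ∈ K}
      mul_mem' := fun {x y} hx hy k => by
        have : x * y = ∑ i, ∑ j, (b.repr x i * b.repr y j) • (b i * b j) := by
          conv_lhs => rw [← b.sum_repr x, ← b.sum_repr y]
          rw [Finset.sum_mul_sum]
          refine Finset.sum_congr rfl fun i _ => Finset.sum_congr rfl fun j _ => ?_
          rw [smul_mul_smul_comm]
        rw [this]
        simp only [map_sum, map_smul, Finsupp.coe_finset_sum, Finset.sum_apply, Finsupp.smul_apply, smul_eq_mul]
        exact sum_mem fun i _ => sum_mem fun j _ => mul_mem (mul_mem (hx i) (hy j)) (hmulc i j k)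
      add_mem' := fun {x y} hx hy k => by
        rw [map_add, Finsupp.add_apply]
        exact add_mem (hx k) (hy k)
      algebraMap_mem' := fun c k => by
        have : algebraMap K E' c = (c : F') • 1 := by rw [Algebra.algebraMap_eq_smul_one]; rfl
        rw [this, map_smul, Finsupp.smul_apply, smul_eq_mul]
        exact mul_mem c.2 (h1c k) }
  have hE₀ : ∀ e, e ∈ E₀ ↔ ∀ k, b.repr e k ∈ K := fun e => Iff.rfl
  have hb : ∀ i, b i ∈ E₀ := fun i k => by
    rw [b.repr_self, Finsupp.single_apply]
    split_ifs
    · exact one_mem _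
    · exact zero_mem _
  let eqv : E₀ ≃ₗ[K] (Fin n → K) :=
    { toFun := fun e k => ⟨b.repr e.1 k, e.2 k⟩
      map_add' := fun x y => by ext k; simp
      map_smul' := fun c x => by
        ext k
        have : ((c • x : E₀) : E') = (c : F') • (x : E') := rfl
        simp [this]
      invFun := fun v => ⟨∑ k, (v k : F') • b k, fun k => by
        rw [Basis.repr_sum_self]; exact (v k).2⟩
      left_inv := fun e => Subtype.ext (b.sum_repr e.1)
      right_inv := fun v => by
        funext k
        apply Subtype.ext
        exact congrFun (b.repr_sum_self (fun k => (v k : F'))) k }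
  have hfrE : finrank K E₀ = n := by rw [eqv.finrank_eq]; simp
  haveI : FiniteDimensional K E₀ := FiniteDimensional.of_finrank_pos (by omega)
  haveI : IsDomain E₀ := NoZeroDivisors.to_isDomain _
  letI : DivisionRing E₀ := divisionRingOfFiniteDimensional K E₀
  have lift : ∀ {X : Type} [Ring X] [Algebra F X] [FiniteDimensional F X] (f : X →ₐ[F] E'), 
      (∀ i k, b.repr (f (finBasis F X i)) k ∈ K) → ∀ x, f x ∈ E₀ := by
    intro X _ _ _ f hf x k
    rw [← (finBasis F X).sum_repr x]
    simp only [map_sum, map_smul, ← algebraMap_smul F' (_ : F) (_ : E')]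
    simp only [map_sum, map_smul, Finsupp.coe_finset_sum, Finset.sum_apply, Finsupp.smul_apply, smul_eq_mul]
    exact sum_mem fun i _ => mul_mem (K.algebraMap_mem _) (hf i k)
  refine ⟨⟨K, E₀⟩, ?_, ?_, ?_, hfrE, ⟨?_⟩, ⟨?_⟩⟩
  · have : Algebra.EssFiniteType F K := IntermediateField.essFiniteType_iff.2 (IntermediateField.fg_adjoin_of_finite hT)
    exact IntermediateField.fg_top F K
  · intro x hx
    have : IsAlgebraic F (x : F') := (isAlgebraic_algebraMap_iff (FaithfulSMul.algebraMap_injective K F')).2 hx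
    obtain ⟨a, ha⟩ := halg _ this
    exact ⟨a, Subtype.ext ha⟩
  · rw [eq_bot_iff]
    rintro z hz
    have hz1 := Subalgebra.mem_center_iff.1 hz
    have hz2 : z.1 ∈ Subalgebra.center F' E' := by
      rw [Subalgebra.mem_center_iff]
      intro y
      rw [← b.sum_repr y, Finset.sum_mul, Finset.mul_sum]
      refine Finset.sum_congr rfl fun i _ => ?_
      have := congrArg Subtype.val (hz1 ⟨b i, hb i⟩)
      have h2 : b i * z.1 = z.1 * b i := this
      rw [smul_mul_assoc, mul_smul_comm, h2]
    rw [hcen, Algebra.mem_bot] at hz2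
    obtain ⟨f, hf⟩ := hz2
    obtain ⟨k, hk⟩ : ∃ k, b.repr 1 k ≠ 0 := by
      by_contra hcon
      push Not at hcon
      have : b.repr 1 = 0 := Finsupp.ext hcon
      exact one_ne_zero (b.repr.map_eq_zero_iff.1 this)
    have hfK : f ∈ K := by
      have h3 := z.2 k
      rw [← hf, Algebra.algebraMap_eq_smul_one, map_smul, Finsupp.smul_apply, smul_eq_mul] at h3
      have h4 := mul_mem h3 (inv_mem (h1c k))
      rwa [mul_inv_cancel_right₀ hk] at h4
    rw [Algebra.mem_bot]
    exact ⟨⟨f, hfK⟩, Subtype.ext hf⟩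
  · exact
      { toFun := fun x => ⟨f₁ x, lift f₁ hDc x⟩
        map_one' := Subtype.ext (map_one f₁)
        map_mul' := fun x y => Subtype.ext (map_mul f₁ x y)
        map_zero' := Subtype.ext (map_zero f₁)
        map_add' := fun x y => Subtype.ext (map_add f₁ x y)
        commutes' := fun c => Subtype.ext (f₁.commutes c) }
  · exact
      { toFun := fun x => ⟨f₂ x, lift f₂ hDc' x⟩
        map_one' := Subtype.ext (map_one f₂)
        map_mul' := fun x y => Subtype.ext (map_mul f₂ x y)
        map_zero' := Subtype.ext (map_zero f₂)
        map_add' := fun x y => Subtype.ext (map_add f₂ x y)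
        commutes' := fun c => Subtype.ext (f₂.commutes c) }

end FGL

section Gam3
open Module MvPolynomial
variable {F L : Type} [Field F] [Field L] [Algebra F L]
variable {D D' : Type} [Ring D] [Algebra F D] [Ring D'] [Algebra F D']
variable {J₁ J₂ : Type} [Fintype J₁] [DecidableEq J₁] [Fintype J₂] [DecidableEq J₂]
variable {Φ₁ : D →ₐ[F] Matrix J₁ J₁ L} {Φ₂ : D' →ₐ[F] Matrix J₂ J₂ L}
variable {𝓛 : Type} [Field 𝓛] [Algebra (MvPolynomial ((J₁ × J₂) × J₁ × J₂) L) 𝓛] 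
  [IsFractionRing (MvPolynomial ((J₁ × J₂) × J₁ × J₂) L) 𝓛] [Algebra L 𝓛] [IsScalarTower L (MvPolynomial ((J₁ × J₂) × J₁ × J₂) L) 𝓛]
  [Algebra F 𝓛] [IsScalarTower F L 𝓛]

theorem Gam.exists_homs (Φ₁ : D →ₐ[F] Matrix J₁ J₁ L) (Φ₂ : D' →ₐ[F] Matrix J₂ J₂ L) (𝓛 : Type) [Field 𝓛] [Algebra (MvPolynomial ((J₁ × J₂) × J₁ × J₂) L) 𝓛] 
  [IsFractionRing (MvPolynomial ((J₁ × J₂) × J₁ × J₂) L) 𝓛] [Algebra L 𝓛] [IsScalarTower L (MvPolynomial ((J₁ × J₂) × J₁ × J₂) L) 𝓛]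
  [Algebra F 𝓛] [IsScalarTower F L 𝓛] (hc : Fintype.card J₁ = Fintype.card J₂) [hne : Nonempty J₁] :
    Nonempty (D →ₐ[F] Gam.fixE Φ₁ Φ₂ 𝓛) ∧ Nonempty (D' →ₐ[F] Gam.fixE Φ₁ Φ₂ 𝓛) := by
  obtain ⟨i⟩ := hne
  let c0 : J₁ × J₂ := (i, Fintype.equivOfCardEq hc i)
  obtain ⟨y, h1, h2⟩ := Gam.xm_inv (L := L) (𝓛 := 𝓛) c0 hc
  have hcmalg : ∀ {J : Type} [Fintype J] [DecidableEq J] (c : F), Gam.cm 𝓛 (algebraMap F (Matrix J J L) c) = algebraMap F (Matrix J J 𝓛) c := by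
    intro J _ _ c
    ext i j
    simp only [Gam.cm, Matrix.map_apply, Matrix.algebraMap_matrix_apply]
    split_ifs
    · rw [← IsScalarTower.algebraMap_apply]
    · simp
  have f₁ : D →ₐ[F] Gam.fixE Φ₁ Φ₂ 𝓛 :=
    { toFun := fun x => ⟨Gam.cm 𝓛 (Φ₁ x), Gam.Phi1_mem x⟩
      map_one' := Subtype.ext (by
        change Gam.cm 𝓛 (Φ₁ 1) = 1
        rw [map_one]
        simp [Gam.cm])
      map_mul' := fun x y => Subtype.ext (by
        change Gam.cm 𝓛 (Φ₁ (x * y)) = Gam.cm 𝓛 (Φ₁ x) * Gam.cm 𝓛 (Φ₁ y)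
        rw [map_mul, Gam.cm_mul])
      map_zero' := Subtype.ext (by
        change Gam.cm 𝓛 (Φ₁ 0) = 0
        rw [map_zero]
        simp [Gam.cm])
      map_add' := fun x y => Subtype.ext (by
        change Gam.cm 𝓛 (Φ₁ (x + y)) = Gam.cm 𝓛 (Φ₁ x) + Gam.cm 𝓛 (Φ₁ y)
        rw [map_add]
        exact Matrix.map_add _ (map_add _) _ _)
      commutes' := fun c => Subtype.ext (by
        change Gam.cm 𝓛 (Φ₁ (algebraMap F D c)) = algebraMap F (Matrix J₁ J₁ 𝓛) c
        rw [AlgHom.commutes, hcmalg]) }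
  have hm2 : ∀ x, Gam.xm (L := L) 𝓛 c0 * Gam.cm 𝓛 (Φ₂ x) * y ∈ Gam.fixE Φ₁ Φ₂ 𝓛 := by
    intro x
    apply Gam.conj_mem
    · intro γ
      rw [Gam.map_cm, ← Gam.cm_mul, γ.cB, Gam.cm_mul]
    · exact fun γ => Gam.psi_xm γ c0
    · exact Gam.y_transf c0 h1 h2
  have f₂ : D' →ₐ[F] Gam.fixE Φ₁ Φ₂ 𝓛 :=
    { toFun := fun x => ⟨Gam.xm (L := L) 𝓛 c0 * Gam.cm 𝓛 (Φ₂ x) * y, hm2 x⟩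
      map_one' := Subtype.ext (by
        change Gam.xm (L := L) 𝓛 c0 * Gam.cm 𝓛 (Φ₂ 1) * y = 1
        rw [map_one]
        have : Gam.cm 𝓛 (1 : Matrix J₂ J₂ L) = 1 := by simp [Gam.cm]
        rw [this, Matrix.mul_one, h1])
      map_mul' := fun x x' => Subtype.ext (by
        change Gam.xm (L := L) 𝓛 c0 * Gam.cm 𝓛 (Φ₂ (x * x')) * y = (Gam.xm (L := L) 𝓛 c0 * Gam.cm 𝓛 (Φ₂ x) * y) * (Gam.xm (L := L) 𝓛 c0 * Gam.cm 𝓛 (Φ₂ x') * y)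
        have e : ∀ M M' : Matrix J₂ J₂ 𝓛, (Gam.xm (L := L) 𝓛 c0 * M * y) * (Gam.xm (L := L) 𝓛 c0 * M' * y) = 
            Gam.xm (L := L) 𝓛 c0 * (M * M') * y := by
          intro M M'
          calc _ = Gam.xm (L := L) 𝓛 c0 * M * (y * Gam.xm (L := L) 𝓛 c0) * M' * y := by simp only [Matrix.mul_assoc]
            _ = _ := by rw [h2, Matrix.mul_one, Matrix.mul_assoc _ M M']
        rw [e, map_mul, Gam.cm_mul])
      map_zero' := Subtype.ext (by
        change Gam.xm (L := L) 𝓛 c0 * Gam.cm 𝓛 (Φ₂ 0) * y = 0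
        rw [map_zero]
        have : Gam.cm 𝓛 (0 : Matrix J₂ J₂ L) = 0 := by simp [Gam.cm]
        rw [this, Matrix.mul_zero, Matrix.zero_mul])
      map_add' := fun x x' => Subtype.ext (by
        change Gam.xm (L := L) 𝓛 c0 * Gam.cm 𝓛 (Φ₂ (x + x')) * y = (Gam.xm (L := L) 𝓛 c0 * Gam.cm 𝓛 (Φ₂ x) * y) + (Gam.xm (L := L) 𝓛 c0 * Gam.cm 𝓛 (Φ₂ x') * y)
        have : Gam.cm 𝓛 (Φ₂ (x + x')) = Gam.cm 𝓛 (Φ₂ x) + Gam.cm 𝓛 (Φ₂ x') := by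
          rw [map_add]
          exact Matrix.map_add _ (map_add _) _ _
        rw [this, Matrix.mul_add, Matrix.add_mul])
      commutes' := fun c => Subtype.ext (by
        change Gam.xm (L := L) 𝓛 c0 * Gam.cm 𝓛 (Φ₂ (algebraMap F D' c)) * y = algebraMap F (Matrix J₁ J₁ 𝓛) c
        rw [AlgHom.commutes, hcmalg, Algebra.algebraMap_eq_smul_one, Algebra.algebraMap_eq_smul_one, Matrix.mul_smul, Matrix.smul_mul,
          Matrix.mul_one, h1]) }
  exact ⟨⟨f₁⟩, ⟨f₂⟩⟩

set_option maxHeartbeats 2000000 in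
theorem Gam.core_generic0 [FiniteDimensional F L] [IsGalois F L] [Infinite L] [FiniteDimensional F D] [FiniteDimensional F D']
    (Φ₁ : D →ₐ[F] Matrix J₁ J₁ L) (Φ₂ : D' →ₐ[F] Matrix J₂ J₂ L) 
    (𝓛 : Type) [Field 𝓛] [Algebra (MvPolynomial ((J₁ × J₂) × J₁ × J₂) L) 𝓛] 
  [IsFractionRing (MvPolynomial ((J₁ × J₂) × J₁ × J₂) L) 𝓛] [Algebra L 𝓛] [IsScalarTower L (MvPolynomial ((J₁ × J₂) × J₁ × J₂) L) 𝓛]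
  [Algebra F 𝓛] [IsScalarTower F L 𝓛] (hc : Fintype.card J₁ = Fintype.card J₂) [Nonempty J₁]
    (hdvd : ∀ t (W : Submodule L (HV (J₁ × J₂) J₁ J₂ L t)), (∀ γ : Gam Φ₁ Φ₂, ∀ m ∈ W, actH (J₁ × J₂) t γ.g γ.A γ.B m ∈ W) → 
      Fintype.card J₁ ∣ finrank L W) (hg : ∀ g : L ≃ₐ[F] L, ∃ γ : Gam Φ₁ Φ₂, γ.g = g) :
    ∃ W : RegularEmbeddingWitness F,
      (⊤ : IntermediateField F W.F').FG ∧
      (∀ x : W.F', IsAlgebraic F x → x ∈ (algebraMap F W.F').range) ∧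
      Subalgebra.center W.F' W.E' = ⊥ ∧
      Module.finrank W.F' W.E' = (Fintype.card J₁) ^ 2 ∧
      Nonempty (D →ₐ[F] W.E') ∧ Nonempty (D' →ₐ[F] W.E') := by
  haveI : NoZeroDivisors (Gam.fixE Φ₁ Φ₂ 𝓛) := Gam.fixE_noZeroDivisors hc hdvd
  obtain ⟨⟨f₁⟩, ⟨f₂⟩⟩ := Gam.exists_homs Φ₁ Φ₂ 𝓛 hc
  have hpos : 0 < Fintype.card J₁ := Fintype.card_pos
  exact fg_lemma ((Fintype.card J₁) ^ 2) (by positivity) (Gam.fixE_finrank hc) (Gam.fixF_algClosed hg) (Gam.fixE_center hc) f₁ f₂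

theorem Gam.core_generic [FiniteDimensional F L] [IsGalois F L] [Infinite L] [FiniteDimensional F D] [FiniteDimensional F D']
    (Φ₁ : D →ₐ[F] Matrix J₁ J₁ L) (Φ₂ : D' →ₐ[F] Matrix J₂ J₂ L) 
    (hc : Fintype.card J₁ = Fintype.card J₂) [Nonempty J₁]
    (hdvd : ∀ t (W : Submodule L (HV (J₁ × J₂) J₁ J₂ L t)), (∀ γ : Gam Φ₁ Φ₂, ∀ m ∈ W, actH (J₁ × J₂) t γ.g γ.A γ.B m ∈ W) → 
      Fintype.card J₁ ∣ finrank L W) (hg : ∀ g : L ≃ₐ[F] L, ∃ γ : Gam Φ₁ Φ₂, γ.g = g) :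
    ∃ W : RegularEmbeddingWitness F,
      (⊤ : IntermediateField F W.F').FG ∧
      (∀ x : W.F', IsAlgebraic F x → x ∈ (algebraMap F W.F').range) ∧
      Subalgebra.center W.F' W.E' = ⊥ ∧
      Module.finrank W.F' W.E' = (Fintype.card J₁) ^ 2 ∧
      Nonempty (D →ₐ[F] W.E') ∧ Nonempty (D' →ₐ[F] W.E') :=
  Gam.core_generic0 Φ₁ Φ₂ (FractionRing (MvPolynomial ((J₁ × J₂) × J₁ × J₂) L)) hc hdvd hg

end Gam3

section Core
open Module MvPolynomial
variable {F L : Type} [Field F] [Field L] [Algebra F L]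
variable {D D' I I' : Type} {d d' : ℕ} [DivisionRing D] [Algebra F D] [DivisionRing D'] [Algebra F D']
  [Fintype I] [DecidableEq I] [MulAction (L ≃ₐ[F] L) I] [Fintype I'] [DecidableEq I'] [MulAction (L ≃ₐ[F] L) I']

/-- algebra hom version of `Phi` -/
noncomputable def SplitData.PhiA (S : SplitData F L D I d) (κ : Type) [Fintype κ] [DecidableEq κ] : 
    D →ₐ[F] Matrix (I × κ × Fin d) (I × κ × Fin d) L where
  toFun := S.Phi κ
  map_one' := S.Phi_one
  map_mul' := S.Phi_mul
  map_zero' := by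
    have := S.Phi_add (κ := κ) 0 0
    rw [add_zero] at this
    exact left_eq_add.1 this
  map_add' := S.Phi_add
  commutes' := S.Phi_alg

theorem core_embed [FiniteDimensional F L] [IsGalois F L] [Infinite L] [FiniteDimensional F D] [FiniteDimensional F D']
    (S : SplitData F L D I d) (S' : SplitData F L D' I' d') (s s' N : ℕ) (hN : N ≠ 0)
    (hs : Fintype.card (I × (Fin s × Fin d) × Fin d) = N) (hs' : Fintype.card (I' × (Fin s' × Fin d') × Fin d') = N) :
    ∃ W : RegularEmbeddingWitness F,
      (⊤ : IntermediateField F W.F').FG ∧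
      (∀ x : W.F', IsAlgebraic F x → x ∈ (algebraMap F W.F').range) ∧
      Subalgebra.center W.F' W.E' = ⊥ ∧
      Module.finrank W.F' W.E' = N ^ 2 ∧
      Nonempty (D →ₐ[F] W.E') ∧ Nonempty (D' →ₐ[F] W.E') := by
  let J₁ := I × (Fin s × Fin d) × Fin d
  let J₂ := I' × (Fin s' × Fin d') × Fin d'
  let Φ₁ := S.PhiA (Fin s × Fin d)
  let Φ₂ := S'.PhiA (Fin s' × Fin d')
  have hc : Fintype.card J₁ = Fintype.card J₂ := hs.trans hs'.symm
  haveI : Nonempty J₁ := Fintype.card_pos_iff.1 (by rw [hs]; omega)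
  let mkγ : ∀ (g : L ≃ₐ[F] L) (P : I → Matrix (Fin s × Fin d) (Fin s × Fin d) L) (P' : I' → Matrix (Fin s' × Fin d') (Fin s' × Fin d') L)
      (_ : ∀ i, IsUnit (P i)) (_ : ∀ i, IsUnit (P' i)), Gam Φ₁ Φ₂ := fun g P P' hP hP' => 
    { g := g, A := S.E g P, B := S'.E g P', hA := S.E_unit g P hP, hB := S'.E_unit g P' hP', cA := S.E_Phi g P, cB := S'.E_Phi g P' }
  have key := Gam.core_generic Φ₁ Φ₂ hc (by
    intro t W hW
    rw [hs]
    exact both_dvd S S' s s' N hN hs hs' t W (fun g P P' hP hP' m hm => hW (mkγ g P P' hP hP') m hm)) 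
    (fun g => ⟨mkγ g 1 1 (fun _ => isUnit_one) (fun _ => isUnit_one), rfl⟩)
  rw [hs] at key
  exact key

end Core

section Tens
open Module TensorProduct
variable {K D L : Type} [Field K] [DivisionRing D] [Algebra K D] [Field L] [Algebra K L]

theorem tens_repr_right {ι : Type} (b : Basis ι K L) (x : D ⊗[K] L) (y : D) (i : ι) :
    (Algebra.TensorProduct.basis D b).repr (x * (y ⊗ₜ 1)) i = (Algebra.TensorProduct.basis D b).repr x i * y := by
  induction x using TensorProduct.induction_on with
  | zero => simp
  | tmul a m =>
    rw [Algebra.TensorProduct.tmul_mul_tmul, mul_one, Algebra.TensorProduct.basis_repr_tmul, Algebra.TensorProduct.basis_repr_tmul]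
    simp only [Finsupp.smul_apply, Finsupp.mapRange_apply, smul_eq_mul]
    rw [mul_assoc, mul_assoc, Algebra.commutes]
  | add x x' h h' => rw [add_mul, map_add, Finsupp.add_apply, h, h', map_add, Finsupp.add_apply, add_mul]

theorem tens_repr_left {ι : Type} (b : Basis ι K L) (x : D ⊗[K] L) (y : D) (i : ι) :
    (Algebra.TensorProduct.basis D b).repr ((y ⊗ₜ 1) * x) i = y * (Algebra.TensorProduct.basis D b).repr x i := by
  have : (y ⊗ₜ (1 : L)) * x = y • x := by
    induction x using TensorProduct.induction_on with
    | zero => simp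
    | tmul a m => rw [Algebra.TensorProduct.tmul_mul_tmul, one_mul, TensorProduct.smul_tmul', smul_eq_mul]
    | add x x' h h' => rw [mul_add, h, h', smul_add]
  rw [this, map_smul]; rfl

theorem tens_comm (hc : Subalgebra.center K D = ⊥) (x : D ⊗[K] L) (hx : ∀ y : D, (y ⊗ₜ 1) * x = x * (y ⊗ₜ 1)) :
    ∃ l : L, x = 1 ⊗ₜ l := by
  let b := Module.Free.chooseBasis K L
  let B := Algebra.TensorProduct.basis D b
  have h1 : ∀ i, ∃ k : K, algebraMap K D k = B.repr x i := by
    intro i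
    have : B.repr x i ∈ Subalgebra.center K D := by
      rw [Subalgebra.mem_center_iff]
      intro y
      rw [← tens_repr_left, ← tens_repr_right, hx]
    rw [hc] at this
    exact Algebra.mem_bot.1 this
  choose k hk using h1
  refine ⟨∑ i ∈ (B.repr x).support, k i • b i, ?_⟩
  rw [TensorProduct.tmul_sum]
  conv_lhs => rw [← B.linearCombination_repr x, Finsupp.linearCombination_apply, Finsupp.sum]
  refine Finset.sum_congr rfl fun i _ => ?_
  rw [Algebra.TensorProduct.basis_repr_symm_apply', ← hk, TensorProduct.tmul_smul, TensorProduct.smul_tmul', Algebra.smul_def, mul_one]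

theorem tens_simple (hc : Subalgebra.center K D = ⊥) : IsSimpleRing (D ⊗[K] L) := by
  let b := Module.Free.chooseBasis K L
  let B := Algebra.TensorProduct.basis D b
  apply IsSimpleRing.of_eq_bot_or_eq_top
  intro J
  by_contra! hJ
  obtain ⟨hJ1, hJ2⟩ := hJ
  have key : ∀ n : ℕ, ∀ x ∈ J, x ≠ 0 → (B.repr x).support.card = n → False := by
    intro n
    induction n using Nat.strong_induction_on with
    | _ n ih =>
      intro x hxJ hx0 hn
      have hne : B.repr x ≠ 0 := fun h => hx0 (B.repr.map_eq_zero_iff.1 h)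
      obtain ⟨i0, hi0⟩ := Finsupp.support_nonempty_iff.2 hne
      have hc0 : B.repr x i0 ≠ 0 := Finsupp.mem_support_iff.1 hi0
      let x' := ((B.repr x i0)⁻¹ ⊗ₜ[K] (1 : L)) * x
      have hx'J : x' ∈ J := J.mul_mem_left _ _ hxJ
      have hx'i : ∀ i, B.repr x' i = (B.repr x i0)⁻¹ * B.repr x i := fun i => tens_repr_left b x _ i
      by_cases hcomm : ∀ y : D, (y ⊗ₜ 1) * x' = x' * (y ⊗ₜ 1)
      · obtain ⟨l, hl⟩ := tens_comm hc x' hcomm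
        have hl0 : l ≠ 0 := by
          rintro rfl
          have := hx'i i0
          rw [hl, TensorProduct.tmul_zero, map_zero, inv_mul_cancel₀ hc0] at this
          exact zero_ne_one this
        apply hJ2
        have h1 : (1 : D ⊗[K] L) ∈ J := by
          have := J.mul_mem_left ((1 : D) ⊗ₜ[K] l⁻¹) _ hx'J
          rw [hl, Algebra.TensorProduct.tmul_mul_tmul, one_mul, inv_mul_cancel₀ hl0] at this
          exact this
        exact (TwoSidedIdeal.one_mem_iff J).1 h1
      · push Not at hcomm
        obtain ⟨y, hy⟩ := hcomm
        let w := (y ⊗ₜ 1) * x' - x' * (y ⊗ₜ 1)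
        have hwi : ∀ i, B.repr w i = y * B.repr x' i - B.repr x' i * y := fun i => by
          rw [← tens_repr_left, ← tens_repr_right]
          simp [w, B]
        refine ih _ ?_ w (J.sub_mem (J.mul_mem_left _ _ hx'J) (J.mul_mem_right _ _ hx'J)) (sub_ne_zero.2 hy) rfl
        rw [← hn]
        apply Finset.card_lt_card
        rw [Finset.ssubset_iff_of_subset]
        · refine ⟨i0, hi0, ?_⟩
          rw [Finsupp.notMem_support_iff, hwi, hx'i, inv_mul_cancel₀ hc0, mul_one, one_mul, sub_self]
        · intro i hi
          rw [Finsupp.mem_support_iff] at hi ⊢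
          intro h
          apply hi
          rw [hwi, hx'i, h]; simp
  apply hJ1
  rw [eq_bot_iff]
  intro x hx
  by_contra h
  exact key _ x hx (fun h0 => h (by rw [h0]; exact TwoSidedIdeal.zero_mem _)) rfl

theorem tens_simple' (hc : Subalgebra.center K D = ⊥) : IsSimpleRing (L ⊗[K] D) := by
  haveI := tens_simple (L := L) hc
  exact IsSimpleRing.of_ringEquiv (Algebra.TensorProduct.comm K D L).toRingEquiv inferInstance

theorem tens_central' (hc : Subalgebra.center K D = ⊥) : Algebra.IsCentral L (L ⊗[K] D) := by
  constructor
  intro x hx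
  rw [Subalgebra.mem_center_iff] at hx
  obtain ⟨l, hl⟩ := tens_comm (L := L) hc ((Algebra.TensorProduct.comm K D L).symm x) (by
    intro y
    apply (Algebra.TensorProduct.comm K D L).injective
    rw [map_mul, map_mul, AlgEquiv.apply_symm_apply, Algebra.TensorProduct.comm_tmul]
    exact hx _)
  rw [AlgEquiv.symm_apply_eq, Algebra.TensorProduct.comm_tmul] at hl
  rw [hl]
  exact Algebra.mem_bot.2 ⟨l, rfl⟩

end Tens

section Sep
open Module TensorProduct
variable {K D Ω : Type} [Field K] [DivisionRing D] [Algebra K D] [Field Ω] [Algebra K Ω]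

theorem sep_div {Δ : Type} [DivisionRing Δ] [Algebra Ω Δ] [FiniteDimensional Ω Δ] [Algebra.IsCentral Ω Δ] [IsSepClosed Ω] :
    Function.Bijective (algebraMap Ω Δ) := by
  refine ⟨(algebraMap Ω Δ).injective, ?_⟩
  by_contra h
  obtain ⟨x, hx, hs⟩ := JacobsonNoether.exists_separable_and_not_isCentral' (L := Ω) (D := Δ) (fun h' => h (Algebra.bijective_algebraMap_iff.2 h'.symm).2)
  apply hx
  have hint : IsIntegral Ω x := Algebra.IsIntegral.isIntegral x
  have hirr := minpoly.irreducible hint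
  have hdeg := IsSepClosed.degree_eq_one_of_irreducible Ω hirr hs
  have := minpoly.mem_range_of_degree_eq_one Ω x hdeg
  exact Algebra.mem_bot.2 this

theorem sep_split [IsSepClosed Ω] [FiniteDimensional K D] (hc : Subalgebra.center K D = ⊥) (d : ℕ) (hd : finrank K D = d ^ 2) :
    Nonempty (D →ₐ[K] Matrix (Fin d) (Fin d) Ω) := by
  haveI := tens_simple' (L := Ω) hc
  haveI := tens_central' (L := Ω) hc
  haveI : IsArtinianRing (Ω ⊗[K] D) := IsArtinianRing.of_finite Ω _
  obtain ⟨n, hn, Δ, i1, i2, i3, ⟨e⟩⟩ := IsSimpleRing.exists_algEquiv_matrix_divisionRing_finite Ω (Ω ⊗[K] D)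
  haveI : Algebra.IsCentral Ω (Matrix (Fin n) (Fin n) Δ) := Algebra.IsCentral.of_algEquiv Ω _ _ e
  haveI : Algebra.IsCentral Ω Δ := by
    constructor
    intro x hx
    rw [Subalgebra.mem_center_iff] at hx
    have hm : Matrix.diagonal (fun _ => x) ∈ Subalgebra.center Ω (Matrix (Fin n) (Fin n) Δ) := by
      rw [Subalgebra.mem_center_iff]
      intro M
      ext i j
      rw [Matrix.mul_diagonal, Matrix.diagonal_mul, hx]
    have := Algebra.IsCentral.out hm
    obtain ⟨c, hc⟩ := Algebra.mem_bot.1 this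
    have h0 : 0 < n := Nat.pos_of_ne_zero hn.out
    refine Algebra.mem_bot.2 ⟨c, ?_⟩
    have := congrFun (congrFun hc ⟨0, h0⟩) ⟨0, h0⟩
    rw [Matrix.diagonal_apply_eq, Matrix.algebraMap_matrix_apply, if_pos rfl] at this
    exact this
  let e1 : Ω ≃ₐ[Ω] Δ := AlgEquiv.ofBijective (Algebra.ofId Ω Δ) sep_div
  let e2 : (Ω ⊗[K] D) ≃ₐ[Ω] Matrix (Fin n) (Fin n) Ω := e.trans e1.symm.mapMatrix
  have hfr := e2.toLinearEquiv.finrank_eq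
  rw [Module.finrank_baseChange, hd, Module.finrank_matrix] at hfr
  simp only [Fintype.card_fin, finrank_self, mul_one] at hfr
  have hnd : d = n := by
    rw [← pow_two] at hfr
    exact Nat.pow_left_injective (n := 2) (by norm_num) hfr
  subst hnd
  exact ⟨(e2.toAlgHom.restrictScalars K).comp Algebra.TensorProduct.includeRight⟩

/-- the base change of a map to matrices is an isomorphism -/
theorem split_equiv {L : Type} [Field L] [Algebra K L] [FiniteDimensional K D] (hc : Subalgebra.center K D = ⊥) (d : ℕ) (hd : finrank K D = d ^ 2)
    (φ : D →ₐ[K] Matrix (Fin d) (Fin d) L) :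
    ∃ e : (L ⊗[K] D) ≃ₐ[L] Matrix (Fin d) (Fin d) L, ∀ y, e (1 ⊗ₜ y) = φ y := by
  haveI := tens_simple' (L := L) hc
  have hd0 : 0 < d := by
    have := finrank_pos (R := K) (M := D)
    by_contra h
    have : d = 0 := by omega
    subst this
    simp at hd
    omega
  haveI : Nonempty (Fin d) := ⟨⟨0, hd0⟩⟩
  let f : (L ⊗[K] D) →ₐ[L] Matrix (Fin d) (Fin d) L := 
    Algebra.TensorProduct.lift (Algebra.ofId L _) φ (fun l y => Algebra.commutes l (φ y))
  have hinj : Function.Injective f.toLinearMap := RingHom.injective f.toRingHom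
  have hfr : finrank L (L ⊗[K] D) = finrank L (Matrix (Fin d) (Fin d) L) := by
    rw [Module.finrank_baseChange, hd, Module.finrank_matrix]
    simp [pow_two]
  refine ⟨AlgEquiv.ofBijective f ⟨hinj, (LinearMap.injective_iff_surjective_of_finrank_eq_finrank hfr).1 hinj⟩, fun y => ?_⟩
  change f (1 ⊗ₜ y) = _
  have h : f (1 ⊗ₜ y) = Algebra.ofId L (Matrix (Fin d) (Fin d) L) 1 * φ y := Algebra.TensorProduct.lift_tmul _ _ _ _ _
  rw [h, map_one, one_mul]

theorem split_SN {L : Type} [Field L] [Algebra K L] [FiniteDimensional K D] (hc : Subalgebra.center K D = ⊥) (d : ℕ) (hd : finrank K D = d ^ 2)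
    (φ φ' : D →ₐ[K] Matrix (Fin d) (Fin d) L) :
    ∃ θ : Matrix (Fin d) (Fin d) L, IsUnit θ ∧ ∀ y, θ * φ y = φ' y * θ := by
  obtain ⟨e, he⟩ := split_equiv hc d hd φ
  obtain ⟨e', he'⟩ := split_equiv hc d hd φ'
  let m : Matrix (Fin d) (Fin d) L ≃ₐ[L] (End L (Fin d → L)) := Matrix.toLinAlgEquiv'
  obtain ⟨T, hT⟩ := AlgEquiv.eq_linearEquivConjAlgEquiv (m.symm.trans (e.symm.trans (e'.trans m)))
  have hmul : ∀ a : Module.End L (Fin d → L), (m.symm.trans (e.symm.trans (e'.trans m)) a) * T.toLinearMap = T.toLinearMap * a := by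
    intro a
    rw [hT]
    ext v
    simp [LinearEquiv.conjAlgEquiv_apply]
  have hu : IsUnit (T.toLinearMap : End L (Fin d → L)) := (Module.End.isUnit_iff _).2 T.bijective
  refine ⟨m.symm T.toLinearMap, hu.map m.symm, fun y => ?_⟩
  have := congrArg m.symm (hmul (m (φ y)))
  rw [map_mul, map_mul, AlgEquiv.symm_apply_apply] at this
  rw [← this]
  simp only [AlgEquiv.trans_apply, AlgEquiv.symm_apply_apply]
  rw [← he, AlgEquiv.symm_apply_apply, he']

theorem split_scalar {L : Type} [Field L] [Algebra K L] [FiniteDimensional K D] (hc : Subalgebra.center K D = ⊥) (d : ℕ) (hd : finrank K D = d ^ 2)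
    (φ : D →ₐ[K] Matrix (Fin d) (Fin d) L) (A : Matrix (Fin d) (Fin d) L) (hA : ∀ y, A * φ y = φ y * A) :
    ∃ c : L, A = c • 1 := by
  obtain ⟨e, he⟩ := split_equiv hc d hd φ
  have h1 : ∀ x : L ⊗[K] D, e x * A = A * e x := by
    intro x
    induction x using TensorProduct.induction_on with
    | zero => simp
    | tmul l y => 
      have : l ⊗ₜ[K] y = l • (1 ⊗ₜ[K] y) := by rw [TensorProduct.smul_tmul', smul_eq_mul, mul_one]
      rw [this, map_smul, he, Matrix.mul_smul, Matrix.smul_mul, hA]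
    | add x x' h h' => rw [map_add, add_mul, mul_add, h, h']
  have h2 : A ∈ Subalgebra.center L (Matrix (Fin d) (Fin d) L) := by
    rw [Subalgebra.mem_center_iff]
    intro M
    have := h1 (e.symm M)
    rwa [AlgEquiv.apply_symm_apply] at this
  obtain ⟨c, hc⟩ := Algebra.mem_bot.1 (Algebra.IsCentral.out h2)
  exact ⟨c, by rw [← hc, Algebra.algebraMap_eq_smul_one]⟩

end Sep

section MkSplit
open Module
variable {F K D L : Type} [Field F] [Field K] [Algebra F K] [DivisionRing D] [Algebra K D] [Algebra F D] [IsScalarTower F K D]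
  [Field L] [Algebra F L] [FiniteDimensional K D]

theorem twist_SN (hc : Subalgebra.center K D = ⊥) (d : ℕ) (hd : finrank K D = d ^ 2) (ι : K →ₐ[F] L) (ψ : D →ₐ[F] Matrix (Fin d) (Fin d) L)
    (hψ : ∀ k, ψ (algebraMap K D k) = algebraMap L _ (ι k)) (σ τ : L ≃ₐ[F] L) (hστ : ∀ k, σ (ι k) = τ (ι k)) :
    ∃ θ : Matrix (Fin d) (Fin d) L, IsUnit θ ∧ ∀ y, θ * (ψ y).map σ = (ψ y).map τ * θ := by
  letI : Algebra K L := (σ.toAlgHom.comp ι).toRingHom.toAlgebra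
  have halg : ∀ k, algebraMap K L k = σ (ι k) := fun k => rfl
  have hmk : ∀ ρ : L ≃ₐ[F] L, (∀ k, ρ (ι k) = σ (ι k)) → ∃ Φ : D →ₐ[K] Matrix (Fin d) (Fin d) L, ∀ y, Φ y = (ψ y).map ρ := by
    intro ρ hρ
    refine ⟨{ (ρ.mapMatrix.toAlgHom.comp ψ).toRingHom with
      commutes' := fun k => ?_ }, fun y => rfl⟩
    change (ψ (algebraMap K D k)).map ρ = _
    rw [hψ]
    ext i j
    rw [Matrix.map_apply, Matrix.algebraMap_matrix_apply, Matrix.algebraMap_matrix_apply]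
    split_ifs
    · rw [halg, ← hρ]; rfl
    · simp
  obtain ⟨Φ, hΦ⟩ := hmk σ (fun _ => rfl)
  obtain ⟨Φ', hΦ'⟩ := hmk τ (fun k => (hστ k).symm)
  obtain ⟨θ, h1, h2⟩ := split_SN hc d hd Φ Φ'
  exact ⟨θ, h1, fun y => by rw [← hΦ, ← hΦ', h2]⟩

theorem twist_scalar (hc : Subalgebra.center K D = ⊥) (d : ℕ) (hd : finrank K D = d ^ 2) (ι : K →ₐ[F] L) (ψ : D →ₐ[F] Matrix (Fin d) (Fin d) L)
    (hψ : ∀ k, ψ (algebraMap K D k) = algebraMap L _ (ι k)) (σ : L ≃ₐ[F] L) (A : Matrix (Fin d) (Fin d) L) 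
    (hA : ∀ y, A * (ψ y).map σ = (ψ y).map σ * A) :
    ∃ c : L, A = c • 1 := by
  letI : Algebra K L := (σ.toAlgHom.comp ι).toRingHom.toAlgebra
  have halg : ∀ k, algebraMap K L k = σ (ι k) := fun k => rfl
  let Φ : D →ₐ[K] Matrix (Fin d) (Fin d) L := { (σ.mapMatrix.toAlgHom.comp ψ).toRingHom with
      commutes' := fun k => by
        change (ψ (algebraMap K D k)).map σ = _
        rw [hψ]
        ext i j
        rw [Matrix.map_apply, Matrix.algebraMap_matrix_apply, Matrix.algebraMap_matrix_apply]
        split_ifs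
        · rw [halg]; rfl
        · simp }
  exact split_scalar hc d hd Φ A hA

theorem map_map_mul {d : ℕ} (g h : L ≃ₐ[F] L) (M : Matrix (Fin d) (Fin d) L) : (M.map h).map g = M.map (g * h : L ≃ₐ[F] L) := rfl

theorem mk_split [FiniteDimensional F L] [IsGalois F L] (hc : Subalgebra.center K D = ⊥) (d : ℕ) (hd : finrank K D = d ^ 2) 
    (ι : K →ₐ[F] L) (ψ : D →ₐ[F] Matrix (Fin d) (Fin d) L)
    (hψ : ∀ k, ψ (algebraMap K D k) = algebraMap L _ (ι k)) :
    ∃ (I : Type) (_ : Fintype I) (_ : MulAction (L ≃ₐ[F] L) I), Nonempty (SplitData F L D I d) ∧ Fintype.card I = finrank F K := by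
  classical
  let H := ι.fieldRange.fixingSubgroup
  let I := (L ≃ₐ[F] L) ⧸ H
  letI : Fintype I := Fintype.ofFinite _
  have hcard : Fintype.card I = finrank F K := by
    rw [← Nat.card_eq_fintype_card, (AlgEquiv.ofInjectiveField ι).toLinearEquiv.finrank_eq]
    exact (IntermediateField.finrank_eq_fixingSubgroup_index (L := ι.fieldRange)).symm
  have hd0 : 0 < d := by
    have := finrank_pos (R := K) (M := D)
    by_contra h
    have : d = 0 := by omega
    subst this
    simp at hd
    omega
  have hdim : finrank F D = d ^ 2 * Fintype.card I := by
    rw [hcard, ← finrank_mul_finrank F K D, hd, mul_comm]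
  have hout : ∀ (g : L ≃ₐ[F] L) (q : I) (k : K), (g * q.out) (ι k) = (g • q).out (ι k) := by
    intro g q k
    have h1 : (QuotientGroup.mk (g • q).out : I) = QuotientGroup.mk (g * q.out) := by
      rw [QuotientGroup.out_eq']
      conv_lhs => rw [← QuotientGroup.out_eq' q]
      rfl
    have h2 : (g • q).out⁻¹ * (g * q.out) ∈ H := QuotientGroup.eq.1 h1
    have h3 := (IntermediateField.mem_fixingSubgroup_iff _ _).1 h2 (ι k) ⟨k, rfl⟩
    have h4 := congrArg (g • q).out h3
    rw [← AlgEquiv.mul_apply, mul_inv_cancel_left] at h4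
    exact h4
  have hθ : ∀ (g : L ≃ₐ[F] L) (q : I), ∃ θ : Matrix (Fin d) (Fin d) L, IsUnit θ ∧ (g = 1 → θ = 1) ∧ 
      ∀ y, θ * ((ψ y).map q.out).map g = (ψ y).map (g • q).out * θ := by
    intro g q
    by_cases hg : g = 1
    · subst hg
      refine ⟨1, isUnit_one, fun _ => rfl, fun y => ?_⟩
      rw [one_mul, mul_one, one_smul]; rfl
    · obtain ⟨θ, h1, h2⟩ := twist_SN hc d hd ι ψ hψ (g * q.out) (g • q).out (hout g q)
      exact ⟨θ, h1, fun h => (hg h).elim, h2⟩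
  choose θ θu θ1 θφ using hθ
  have hz : ∀ (g h : L ≃ₐ[F] L) (q : I), ∃ z : Lˣ, θ g (h • q) * (θ h q).map g = (z : L) • θ (g * h) q := by
    intro g h q
    have hmap : ∀ M M' : Matrix (Fin d) (Fin d) L, (M * M').map g = M.map g * M'.map g := fun M M' => Matrix.map_mul (f := (g : L →+* L))
    let Θ := θ g (h • q) * (θ h q).map g
    have hΘu : IsUnit Θ := (θu g (h • q)).mul ((θu h q).map g.mapMatrix)
    have hΘ : ∀ y, Θ * ((ψ y).map q.out).map (g * h : L ≃ₐ[F] L) = (ψ y).map ((g * h) • q).out * Θ := by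
      intro y
      have e1 := congrArg (fun M => M.map g) (θφ h q y)
      simp only [hmap] at e1
      rw [map_map_mul] at e1
      change θ g (h • q) * (θ h q).map g * _ = _ * (θ g (h • q) * (θ h q).map g)
      rw [mul_assoc, e1, ← mul_assoc, θφ g (h • q) y, mul_smul, mul_assoc]
    obtain ⟨Q, hQ⟩ := θu (g * h) q
    have hQφ : ∀ y, Q.1 * ((ψ y).map q.out).map (g * h : L ≃ₐ[F] L) = (ψ y).map ((g * h) • q).out * Q.1 := by
      intro y; rw [hQ]; exact θφ (g * h) q y
    obtain ⟨c, hcA⟩ := twist_scalar hc d hd ι ψ hψ ((g * h) • q).out (Θ * Q⁻¹.1) (by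
      intro y
      have e2 : Q⁻¹.1 * (ψ y).map ((g * h) • q).out = ((ψ y).map q.out).map (g * h : L ≃ₐ[F] L) * Q⁻¹.1 := by
        have := congrArg (fun M => Q⁻¹.1 * M * Q⁻¹.1) (hQφ y)
        rw [← mul_assoc Q⁻¹.1 Q.1, Units.inv_mul, one_mul, mul_assoc, mul_assoc _ Q.1, Units.mul_inv, mul_one] at this
        exact this.symm
      rw [mul_assoc, e2, ← mul_assoc, hΘ, mul_assoc])
    have e3 : Θ = c • Q.1 := by
      have := congrArg (fun M => M * Q.1) hcA
      rwa [mul_assoc, Units.inv_mul, mul_one, smul_mul_assoc, one_mul] at this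
    have hc0 : c ≠ 0 := by
      rintro rfl
      rw [zero_smul] at e3
      rw [e3] at hΘu
      haveI : Nonempty (Fin d) := ⟨⟨0, hd0⟩⟩
      exact not_isUnit_zero hΘu
    exact ⟨Units.mk0 c hc0, by rw [← hQ]; exact e3⟩
  choose z hz using hz
  exact ⟨I, inferInstance, inferInstance, ⟨{ 
    φ := fun q => (AlgEquiv.mapMatrix q.out).toAlgHom.comp ψ
    θ := θ
    z := z
    θ_unit := θu
    θ_one := fun q => θ1 1 q rfl
    θ_φ := θφ
    θ_mul := hz
    dpos := hd0
    dim := hdim }⟩, hcard⟩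

end MkSplit

section InfCase
open Module

theorem split_omega {F K D Ω : Type} [Field F] [Field K] [Algebra F K] [Algebra.IsSeparable F K] [DivisionRing D] [Algebra K D] [Algebra F D] [IsScalarTower F K D]
    [FiniteDimensional K D] (hc : Subalgebra.center K D = ⊥) (d : ℕ) (hd : finrank K D = d ^ 2)
    [Field Ω] [Algebra F Ω] [IsSepClosed Ω] :
    ∃ (ι : K →ₐ[F] Ω) (ψ : D →ₐ[F] Matrix (Fin d) (Fin d) Ω), ∀ k, ψ (algebraMap K D k) = algebraMap Ω _ (ι k) := by
  let ι : K →ₐ[F] Ω := IsSepClosed.lift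
  letI : Algebra K Ω := ι.toRingHom.toAlgebra
  haveI : IsScalarTower F K Ω := IsScalarTower.of_algebraMap_eq fun x => (ι.commutes x).symm
  obtain ⟨Φ⟩ := sep_split (Ω := Ω) hc d hd
  exact ⟨ι, Φ.restrictScalars F, fun k => Φ.commutes k⟩

theorem split_descend {F K D Ω : Type} [Field F] [Field K] [Algebra F K] [DivisionRing D] [Algebra K D] [Algebra F D] [IsScalarTower F K D]
    (d : ℕ) (hd0 : 0 < d) [Field Ω] [Algebra F Ω] (ι : K →ₐ[F] Ω) (ψ : D →ₐ[F] Matrix (Fin d) (Fin d) Ω) 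
    (hψ : ∀ k, ψ (algebraMap K D k) = algebraMap Ω _ (ι k)) (L : IntermediateField F Ω) {n : Type} [Finite n] (b : Basis n F D)
    (hL : ∀ m i j, ψ (b m) i j ∈ L) :
    ∃ (ι : K →ₐ[F] L) (ψ : D →ₐ[F] Matrix (Fin d) (Fin d) L), ∀ k, ψ (algebraMap K D k) = algebraMap L _ (ι k) := by
  have hL' : ∀ y i j, ψ y i j ∈ L := by
    intro y i j
    haveI := Fintype.ofFinite n
    rw [← b.sum_repr y, map_sum, Matrix.sum_apply]
    refine sum_mem fun m _ => ?_
    rw [map_smul, Matrix.smul_apply]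
    exact L.smul_mem (hL m i j)
  have hι : ∀ k, ι k ∈ L := by
    intro k
    have := hL' (algebraMap K D k) ⟨0, hd0⟩ ⟨0, hd0⟩
    rwa [hψ, Matrix.algebraMap_matrix_apply, if_pos rfl] at this
  refine ⟨ι.codRestrict L.toSubalgebra hι, 
    { toFun := fun y => Matrix.of fun i j => ⟨ψ y i j, hL' y i j⟩
      map_one' := ?_, map_mul' := ?_, map_zero' := ?_, map_add' := ?_, commutes' := ?_ }, ?_⟩
  · ext i j
    simp [Matrix.one_apply]
    split_ifs <;> rfl
  · intro x y
    ext i j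
    simp [Matrix.mul_apply]
  · ext i j
    simp
  · intro x y
    ext i j
    simp
  · intro c
    ext i j
    simp [Matrix.algebraMap_matrix_apply]
    split_ifs <;> rfl
  · intro k
    ext i j
    change ψ (algebraMap K D k) i j = _
    rw [hψ, Matrix.algebraMap_matrix_apply, Matrix.algebraMap_matrix_apply]
    split_ifs <;> rfl

theorem infinite_case (F : Type) [Field F] [Infinite F]
    (K₁ K₂ : Type) [Field K₁] [Field K₂] [Algebra F K₁] [Algebra F K₂]
    [FiniteDimensional F K₁] [FiniteDimensional F K₂]
    [Algebra.IsSeparable F K₁] [Algebra.IsSeparable F K₂]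
    (D₁ D₂ : Type) [DivisionRing D₁] [DivisionRing D₂]
    [Algebra K₁ D₁] [Algebra K₂ D₂] [FiniteDimensional K₁ D₁] [FiniteDimensional K₂ D₂]
    (hc₁ : Subalgebra.center K₁ D₁ = ⊥) (hc₂ : Subalgebra.center K₂ D₂ = ⊥)
    (d₁ d₂ : ℕ) (hd₁ : Module.finrank K₁ D₁ = d₁ ^ 2) (hd₂ : Module.finrank K₂ D₂ = d₂ ^ 2)
    [Algebra F D₁] [Algebra F D₂] [IsScalarTower F K₁ D₁] [IsScalarTower F K₂ D₂]
    (N : ℕ) (hNpos : 0 < N) (h₁ : d₁ ^ 2 * finrank F K₁ ∣ N) (h₂ : d₂ ^ 2 * finrank F K₂ ∣ N) :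
    ∃ W : RegularEmbeddingWitness F,
      (⊤ : IntermediateField F W.F').FG ∧
      (∀ x : W.F', IsAlgebraic F x → x ∈ (algebraMap F W.F').range) ∧
      Subalgebra.center W.F' W.E' = ⊥ ∧
      Module.finrank W.F' W.E' = N ^ 2 ∧
      Nonempty (D₁ →ₐ[F] W.E') ∧ Nonempty (D₂ →ₐ[F] W.E') := by
  classical
  let Ω := SeparableClosure F
  haveI : FiniteDimensional F D₁ := FiniteDimensional.trans F K₁ D₁
  haveI : FiniteDimensional F D₂ := FiniteDimensional.trans F K₂ D₂
  obtain ⟨ι₁, ψ₁, hψ₁⟩ := split_omega (F := F) (Ω := Ω) hc₁ d₁ hd₁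
  obtain ⟨ι₂, ψ₂, hψ₂⟩ := split_omega (F := F) (Ω := Ω) hc₂ d₂ hd₂
  let b₁ := finBasis F D₁
  let b₂ := finBasis F D₂
  let s : Set Ω := Set.range (fun p : Fin (finrank F D₁) × Fin d₁ × Fin d₁ => ψ₁ (b₁ p.1) p.2.1 p.2.2) ∪ 
    Set.range (fun p : Fin (finrank F D₂) × Fin d₂ × Fin d₂ => ψ₂ (b₂ p.1) p.2.1 p.2.2)
  haveI : Finite s := ((Set.finite_range _).union (Set.finite_range _)).to_subtype
  let L := FiniteGaloisIntermediateField.adjoin F s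
  have hsL := FiniteGaloisIntermediateField.subset_adjoin F s
  have hdpos : ∀ {d : ℕ} {K D : Type} [Field K] [DivisionRing D] [Algebra K D] [FiniteDimensional K D], finrank K D = d ^ 2 → 0 < d := by
    intro d K D _ _ _ _ h
    have := finrank_pos (R := K) (M := D)
    rw [h] at this
    exact Nat.pos_of_ne_zero fun h0 => by simp [h0] at this
  obtain ⟨ι₁', ψ₁', hψ₁'⟩ := split_descend d₁ (hdpos hd₁) ι₁ ψ₁ hψ₁ L.toIntermediateField b₁ (fun m i j => hsL (Or.inl ⟨(m, i, j), rfl⟩))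
  obtain ⟨ι₂', ψ₂', hψ₂'⟩ := split_descend d₂ (hdpos hd₂) ι₂ ψ₂ hψ₂ L.toIntermediateField b₂ (fun m i j => hsL (Or.inr ⟨(m, i, j), rfl⟩))
  obtain ⟨I₁, _, _, ⟨S₁⟩, hI₁⟩ := mk_split hc₁ d₁ hd₁ ι₁' ψ₁' hψ₁'
  obtain ⟨I₂, _, _, ⟨S₂⟩, hI₂⟩ := mk_split hc₂ d₂ hd₂ ι₂' ψ₂' hψ₂'
  obtain ⟨s₁, hs₁⟩ := h₁
  obtain ⟨s₂, hs₂⟩ := h₂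
  haveI : Infinite L.toIntermediateField := Infinite.of_injective _ (algebraMap F L.toIntermediateField).injective
  exact core_embed S₁ S₂ s₁ s₂ N hNpos.ne' (by
    simp only [Fintype.card_prod, Fintype.card_fin, hI₁]; rw [hs₁]; ring) (by
    simp only [Fintype.card_prod, Fintype.card_fin, hI₂]; rw [hs₂]; ring)

end InfCase

section FinCase
open Module Polynomial

theorem rat_algclosed {F R : Type} [Field F] [Field R] [Algebra F[X] R] [IsFractionRing F[X] R] [Algebra F R] [IsScalarTower F F[X] R]
    (f : R) (hf : IsAlgebraic F f) : f ∈ (algebraMap F R).range := by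
  by_cases h0 : f = 0
  · exact ⟨0, by simp [h0]⟩
  have key : ∀ f : R, IsAlgebraic F f → ∃ p : F[X], algebraMap _ R p = f := by
    intro f hf
    have h2 : IsIntegral F[X] f := hf.isIntegral.tower_top
    exact IsIntegrallyClosed.isIntegral_iff.1 h2
  obtain ⟨p, hp⟩ := key f hf
  obtain ⟨q, hq⟩ := key f⁻¹ hf.inv
  have inj : Function.Injective (algebraMap F[X] R) := IsFractionRing.injective _ _
  have hpq : p * q = 1 := by
    apply inj
    rw [map_mul, hp, hq, map_one, mul_inv_cancel₀ h0]
  have hpu : IsUnit p := IsUnit.of_mul_eq_one _ hpq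
  rw [Polynomial.isUnit_iff] at hpu
  obtain ⟨c, -, rfl⟩ := hpu
  refine ⟨c, ?_⟩
  rw [← hp, IsScalarTower.algebraMap_apply F F[X] R]
  rfl

theorem minpoly_stable {F R Ω : Type} [Field F] [Field R] [Field Ω] [Algebra F R] [Algebra R Ω] [Algebra F Ω] [IsScalarTower F R Ω]
    (hR : ∀ x : R, IsAlgebraic F x → x ∈ (algebraMap F R).range) (a : Ω) (ha : IsIntegral F a) :
    minpoly R a = (minpoly F a).map (algebraMap F R) := by
  have haR : IsIntegral R a := ha.tower_top
  have hdvd : minpoly R a ∣ (minpoly F a).map (algebraMap F R) := minpoly.dvd_map_of_isScalarTower F R a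
  have h1 := integralClosure.mem_lifts_of_monic_of_dvd_map R (minpoly.monic ha) (minpoly.monic haR) hdvd
  have h2 : minpoly R a ∈ lifts (algebraMap F R) := by
    rw [Polynomial.lifts_iff_coeff_lifts] at h1 ⊢
    intro n
    obtain ⟨c, hc⟩ := h1 n
    rw [← hc]
    exact hR _ (IsIntegral.isAlgebraic c.2)
  obtain ⟨q, hq, hdeg, hqm⟩ := lifts_and_degree_eq_and_monic h2 (minpoly.monic haR)
  have h3 : q.aeval a = 0 := by
    rw [← Polynomial.aeval_map_algebraMap R, hq, minpoly.aeval]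
  have h4 : minpoly F a ∣ q := minpoly.dvd F a h3
  refine (Polynomial.eq_of_monic_of_dvd_of_natDegree_le (minpoly.monic haR) ((minpoly.monic ha).map _) hdvd ?_).symm
  rw [← hq, natDegree_map, natDegree_map]
  exact natDegree_le_of_dvd h4 hqm.ne_zero

theorem base_field {F R K : Type} [Field F] [Field R] [Algebra F R] [Field K] [Algebra F K] [FiniteDimensional F K] [Algebra.IsSeparable F K]
    (hR : ∀ x : R, IsAlgebraic F x → x ∈ (algebraMap F R).range) :
    ∃ (K' : Type) (_ : Field K') (_ : Algebra R K') (_ : Algebra F K') (_ : IsScalarTower F R K'), FiniteDimensional R K' ∧ Algebra.IsSeparable R K' ∧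
      finrank R K' = finrank F K ∧ Nonempty (K →ₐ[F] K') := by
  let Ω := AlgebraicClosure R
  let j : K →ₐ[F] Ω := IsAlgClosed.lift
  obtain ⟨α, hα⟩ := Field.exists_primitive_element F K
  have hint : IsIntegral F α := Algebra.IsIntegral.isIntegral α
  have hintj : IsIntegral F (j α) := hint.map j
  have hintR : IsIntegral R (j α) := hintj.tower_top
  have hsep : IsSeparable F (j α) := by
    have : IsSeparable F α := Algebra.IsSeparable.isSeparable F α
    unfold IsSeparable at this ⊢
    rwa [minpoly.algHom_eq j j.injective]
  have hsepR : IsSeparable R (j α) := hsep.tower_top R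
  let K' := IntermediateField.adjoin R {j α}
  have hmem : ∀ k, j k ∈ K'.restrictScalars F := by
    intro k
    have h1 : (⊤ : IntermediateField F K) ≤ (K'.restrictScalars F).comap j := by
      rw [← hα, IntermediateField.adjoin_le_iff]
      rintro x rfl
      exact IntermediateField.mem_adjoin_simple_self R (j x)
    exact h1 (IntermediateField.mem_top (x := k))
  refine ⟨K', inferInstance, inferInstance, inferInstance, inferInstance, IntermediateField.adjoin.finiteDimensional hintR, 
    (IntermediateField.isSeparable_adjoin_simple_iff_isSeparable R Ω).2 hsepR, ?_, ⟨j.codRestrict (K'.restrictScalars F).toSubalgebra hmem⟩⟩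
  rw [IntermediateField.adjoin.finrank hintR, minpoly_stable hR _ hintj, natDegree_map, minpoly.algHom_eq j j.injective]
  rw [← IntermediateField.adjoin.finrank hint, hα, IntermediateField.finrank_top']

theorem finite_case (F : Type) [Field F] [Finite F]
    (K₁ K₂ : Type) [Field K₁] [Field K₂] [Algebra F K₁] [Algebra F K₂]
    [FiniteDimensional F K₁] [FiniteDimensional F K₂]
    [Algebra.IsSeparable F K₁] [Algebra.IsSeparable F K₂]
    (N : ℕ) (hNpos : 0 < N) (h₁ : finrank F K₁ ∣ N) (h₂ : finrank F K₂ ∣ N) :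
    ∃ W : RegularEmbeddingWitness F,
      (⊤ : IntermediateField F W.F').FG ∧
      (∀ x : W.F', IsAlgebraic F x → x ∈ (algebraMap F W.F').range) ∧
      Subalgebra.center W.F' W.E' = ⊥ ∧
      Module.finrank W.F' W.E' = N ^ 2 ∧
      Nonempty (K₁ →ₐ[F] W.E') ∧ Nonempty (K₂ →ₐ[F] W.E') := by
  obtain ⟨R, _, _, _, hR, hinf, hess⟩ : ∃ (R : Type) (_ : Field R) (_ : Algebra F R) (_ : Algebra F[X] R), 
      (∀ x : R, IsAlgebraic F x → x ∈ (algebraMap F R).range) ∧ Infinite R ∧ Algebra.EssFiniteType F R := by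
    refine ⟨FractionRing F[X], inferInstance, inferInstance, inferInstance, fun x hx => rat_algclosed x hx, 
      Infinite.of_injective _ (IsFractionRing.injective F[X] (FractionRing F[X])), ?_⟩
    haveI : Algebra.EssFiniteType F[X] (FractionRing F[X]) := Algebra.EssFiniteType.of_isLocalization _ (nonZeroDivisors F[X])
    exact Algebra.EssFiniteType.comp F F[X] (FractionRing F[X])
  obtain ⟨L₁, _, _, _, _, _, _, hL₁, ⟨j₁⟩⟩ := base_field (K := K₁) hR
  obtain ⟨L₂, _, _, _, _, _, _, hL₂, ⟨j₂⟩⟩ := base_field (K := K₂) hR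
  have hcen : ∀ (L : Type) [Field L], Subalgebra.center L L = ⊥ := by
    intro L _
    rw [eq_bot_iff]
    intro x _
    exact Algebra.mem_bot.2 ⟨x, rfl⟩
  obtain ⟨W, hfg, halg, hc, hfr, ⟨f₁⟩, ⟨f₂⟩⟩ := infinite_case R L₁ L₂ L₁ L₂ (hcen L₁) (hcen L₂) 1 1 (by simp) (by simp) N hNpos 
    (by rwa [one_pow, one_mul, hL₁]) (by rwa [one_pow, one_mul, hL₂])
  letI : Algebra F W.F' := ((algebraMap R W.F').comp (algebraMap F R)).toAlgebra
  haveI t1 : IsScalarTower F R W.F' := IsScalarTower.of_algebraMap_eq fun _ => rfl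
  letI : Algebra F W.E' := ((algebraMap R W.E').comp (algebraMap F R)).toAlgebra' (fun c x => Algebra.commutes _ _)
  haveI t2 : IsScalarTower F R W.E' := IsScalarTower.of_algebraMap_eq fun _ => rfl
  haveI t3 : IsScalarTower F W.F' W.E' := IsScalarTower.of_algebraMap_eq fun c => by
    rw [IsScalarTower.algebraMap_apply F R W.E', IsScalarTower.algebraMap_apply F R W.F', IsScalarTower.algebraMap_apply R W.F' W.E']
  refine ⟨{ F' := W.F', E' := W.E' }, ?_, ?_, hc, hfr, ⟨(f₁.restrictScalars F).comp j₁⟩, ⟨(f₂.restrictScalars F).comp j₂⟩⟩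
  · haveI := IntermediateField.fg_top_iff.1 hfg
    haveI := Algebra.EssFiniteType.comp F R W.F'
    exact IntermediateField.fg_top F W.F'
  · intro x hx
    obtain ⟨r, rfl⟩ := halg x (IsAlgebraic.tower_top R hx)
    have : IsAlgebraic F r := (isAlgebraic_algebraMap_iff (algebraMap R W.F').injective).1 hx
    obtain ⟨c, rfl⟩ := hR r this
    exact ⟨c, rfl⟩

theorem main_ne (F : Type) [Field F]
    (K₁ K₂ : Type) [Field K₁] [Field K₂] [Algebra F K₁] [Algebra F K₂]
    [FiniteDimensional F K₁] [FiniteDimensional F K₂]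
    [Algebra.IsSeparable F K₁] [Algebra.IsSeparable F K₂]
    (D₁ D₂ : Type) [DivisionRing D₁] [DivisionRing D₂]
    [Algebra K₁ D₁] [Algebra K₂ D₂] [FiniteDimensional K₁ D₁] [FiniteDimensional K₂ D₂]
    (hc₁ : Subalgebra.center K₁ D₁ = ⊥) (hc₂ : Subalgebra.center K₂ D₂ = ⊥)
    (d₁ d₂ : ℕ) (hd₁ : Module.finrank K₁ D₁ = d₁ ^ 2) (hd₂ : Module.finrank K₂ D₂ = d₂ ^ 2)
    [Algebra F D₁] [Algebra F D₂] [IsScalarTower F K₁ D₁] [IsScalarTower F K₂ D₂]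
    (N : ℕ) (hNpos : 0 < N) (h₁ : d₁ ^ 2 * finrank F K₁ ∣ N) (h₂ : d₂ ^ 2 * finrank F K₂ ∣ N) :
    ∃ W : RegularEmbeddingWitness F,
      (⊤ : IntermediateField F W.F').FG ∧
      (∀ x : W.F', IsAlgebraic F x → x ∈ (algebraMap F W.F').range) ∧
      Subalgebra.center W.F' W.E' = ⊥ ∧
      Module.finrank W.F' W.E' = N ^ 2 ∧
      Nonempty (D₁ →ₐ[F] W.E') ∧ Nonempty (D₂ →ₐ[F] W.E') := by
  rcases finite_or_infinite F with hF | hF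
  · have key : ∀ (K D : Type) [Field K] [Algebra F K] [FiniteDimensional F K] [DivisionRing D] [Algebra K D] [FiniteDimensional K D] 
      [Algebra F D] [IsScalarTower F K D], Subalgebra.center K D = ⊥ → Nonempty (D →ₐ[F] K) := by
      intro K D _ _ _ _ _ _ _ _ hc
      haveI : Finite K := Module.finite_of_finite F
      haveI : Finite D := Module.finite_of_finite K
      have hcomm : ∀ x y : D, x * y = y * x := (littleWedderburn D).mul_comm
      have hbij : Function.Bijective (IsScalarTower.toAlgHom F K D) := by
        refine ⟨(algebraMap K D).injective, fun x => ?_⟩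
        have : x ∈ Subalgebra.center K D := Subalgebra.mem_center_iff.2 fun y => hcomm y x
        rw [hc] at this
        exact Algebra.mem_bot.1 this
      exact ⟨(AlgEquiv.ofBijective _ hbij).symm.toAlgHom⟩
    obtain ⟨p₁⟩ := key K₁ D₁ hc₁
    obtain ⟨p₂⟩ := key K₂ D₂ hc₂
    obtain ⟨W, a, b, c, e, ⟨f₁⟩, ⟨f₂⟩⟩ := finite_case F K₁ K₂ N hNpos (dvd_of_mul_left_dvd h₁) (dvd_of_mul_left_dvd h₂)
    exact ⟨W, a, b, c, e, ⟨f₁.comp p₁⟩, ⟨f₂.comp p₂⟩⟩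
  · exact infinite_case F K₁ K₂ D₁ D₂ hc₁ hc₂ d₁ d₂ hd₁ hd₂ N hNpos h₁ h₂

end FinCase

/-- Main embedding theorem over a common base field.  Given finite separable extensions
`K₁/F`, `K₂/F` of degrees `e₁`, `e₂`, division rings `D₁`, `D₂` with centers `K₁`, `K₂`
of degrees `d₁`, `d₂`, regarded as `F`-algebras, and any positive multiple `N` of
`lcm((d₁e₁)², (d₂e₂)²)`, there exist a finitely generated field extension `F'/F` in
which `F` is algebraically closed, and a division ring `E'` with center `F'` of degree
`N`, together with injective `F`-algebra homomorphisms `D₁ → E'` and `D₂ → E'`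
compatible with the inclusion `F ⊆ F'`. -/
theorem exists_regular_extension_and_common_embedding
    (F : Type) [Field F]
    (K₁ K₂ : Type) [Field K₁] [Field K₂] [Algebra F K₁] [Algebra F K₂]
    [FiniteDimensional F K₁] [FiniteDimensional F K₂]
    [Algebra.IsSeparable F K₁] [Algebra.IsSeparable F K₂]
    (e₁ e₂ : ℕ) (he₁ : Module.finrank F K₁ = e₁) (he₂ : Module.finrank F K₂ = e₂)
    (D₁ D₂ : Type) [DivisionRing D₁] [DivisionRing D₂]
    [Algebra K₁ D₁] [Algebra K₂ D₂] [FiniteDimensional K₁ D₁] [FiniteDimensional K₂ D₂]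
    (hc₁ : Subalgebra.center K₁ D₁ = ⊥) (hc₂ : Subalgebra.center K₂ D₂ = ⊥)
    (d₁ d₂ : ℕ) (hd₁ : Module.finrank K₁ D₁ = d₁ ^ 2) (hd₂ : Module.finrank K₂ D₂ = d₂ ^ 2)
    [Algebra F D₁] [Algebra F D₂] [IsScalarTower F K₁ D₁] [IsScalarTower F K₂ D₂]
    (N : ℕ) (hNpos : 0 < N) (hNmul : Nat.lcm ((d₁ * e₁) ^ 2) ((d₂ * e₂) ^ 2) ∣ N) :
    ∃ W : RegularEmbeddingWitness F,
      (⊤ : IntermediateField F W.F').FG ∧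
      (∀ x : W.F', IsAlgebraic F x → x ∈ (algebraMap F W.F').range) ∧
      Subalgebra.center W.F' W.E' = ⊥ ∧
      Module.finrank W.F' W.E' = N ^ 2 ∧
      (∃ f₁ : D₁ →ₐ[F] W.E', Function.Injective f₁) ∧
      (∃ f₂ : D₂ →ₐ[F] W.E', Function.Injective f₂) := by
  obtain ⟨W, a, b, c, e, ⟨f₁⟩, ⟨f₂⟩⟩ := main_ne F K₁ K₂ D₁ D₂ hc₁ hc₂ d₁ d₂ hd₁ hd₂ N hNpos
    (((Dvd.intro e₁ (by rw [he₁]; ring)).trans (Nat.dvd_lcm_left _ _)).trans hNmul)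
    (((Dvd.intro e₂ (by rw [he₂]; ring)).trans (Nat.dvd_lcm_right _ _)).trans hNmul)
  exact ⟨W, a, b, c, e, ⟨f₁, f₁.toRingHom.injective⟩, ⟨f₂, f₂.toRingHom.injective⟩⟩
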